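/- Let b be a rational function in the closed unit ball of H∞ with ‖b‖∞ = 1 that is not a finite Blaschke product. Let φ ∈ H(b) ∩ ball(H∞) with φ(ξ_j) ∈ Z_T(a) for 1 ≤ j ≤ p and φ(ξ_j) ∈ D for p+1 ≤ j ≤ n, let u = (a₁ ∘ φ) · ∏_{j=p+1}^n (φ − φ(ξ_j))^{m_j} / a₁, and let μ_{u,φ} be the Borel measure on the closed unit disk defined by μ_{u,φ}(E) = ∫_{φ⁻¹(E)∩T} |u|² dm. Then the following are equivalent: (i) C_φ : H(b) → H(b) is bounded; (ii) μ_{u,φ} is a Carleson measure; (iii) sup_{w∈D} ∫_T (1 − |w|²)|u(ξ)|²/|1 − conj(w)φ(ξ)|² dm(ξ) < ∞. -/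

import Mathlib

open Complex MeasureTheory Set Filter

noncomputable section

attribute [local instance] Classical.propDecidable

/-- The open unit disk in `ℂ`. -/
def unitDisk : Set ℂ := Metric.ball 0 1

/-- The unit circle in `ℂ`. -/
def unitCircle : Set ℂ := Metric.sphere 0 1

/-- Membership in `H^∞`: analytic and bounded on the unit disk. -/
def MemHinf (f : ℂ → ℂ) : Prop :=
  DifferentiableOn ℂ f unitDisk ∧ ∃ C : ℝ, ∀ z ∈ unitDisk, ‖f z‖ ≤ C

/-- Membership in the closed unit ball of `H^∞`. -/
def MemBallHinf (f : ℂ → ℂ) : Prop :=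
  DifferentiableOn ℂ f unitDisk ∧ ∀ z ∈ unitDisk, ‖f z‖ ≤ 1

/-- `f` agrees on the closed unit disk with a rational function without poles there. -/
def IsRationalOnDisk (f : ℂ → ℂ) : Prop :=
  ∃ P Q : Polynomial ℂ, ∀ z ∈ Metric.closedBall (0:ℂ) 1,
    Q.eval z ≠ 0 ∧ f z = P.eval z / Q.eval z

/-- `f` is a finite Blaschke product (multiplicities are encoded by repetition). -/
def IsFiniteBlaschke (f : ℂ → ℂ) : Prop :=
  ∃ (γ : ℂ) (k : ℕ) (lam : Fin k → ℂ), ‖γ‖ = 1 ∧ (∀ i, lam i ∈ unitDisk) ∧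
    ∀ z ∈ unitDisk, f z = γ * ∏ i, (z - lam i) / (1 - (starRingEnd ℂ) (lam i) * z)

/-- The `k`-th Taylor coefficient of `f` at the origin. -/
def taylorCoeff (f : ℂ → ℂ) (k : ℕ) : ℂ := iteratedDeriv k f 0 / k.factorial

/-- Membership in the Hardy space `H²` (square-summable Taylor coefficients). -/
def MemH2 (f : ℂ → ℂ) : Prop :=
  DifferentiableOn ℂ f unitDisk ∧ Summable fun k => ‖taylorCoeff f k‖ ^ 2

/-- The squared `H²` norm. -/
def h2NormSq (f : ℂ → ℂ) : ℝ := ∑' k, ‖taylorCoeff f k‖ ^ 2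

/-- The `H²` inner product. -/
def h2Inner (f g : ℂ → ℂ) : ℂ :=
  ∑' k, (starRingEnd ℂ) (taylorCoeff f k) * taylorCoeff g k

/-- The polynomial `a₁(z) = ∏ⱼ (z − ξⱼ)^{mⱼ}`. -/
def a1fun {n : ℕ} (ξ : Fin n → ℂ) (m : Fin n → ℕ) : ℂ → ℂ :=
  fun z => ∏ j, (z - ξ j) ^ (m j)

/-- A decomposition `f = a₁ g + q` with `g ∈ H²`, `deg q ≤ N − 1`, witnessing membership
in `H(b) = a₁H² ⊕ P_{N−1}`. -/
def HbDecompOf {n : ℕ} (ξ : Fin n → ℂ) (m : Fin n → ℕ)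
    (f g : ℂ → ℂ) (q : Polynomial ℂ) : Prop :=
  MemH2 g ∧ q.degree < ((∑ j, m j : ℕ) : WithBot ℕ) ∧
    ∀ z ∈ unitDisk, f z = a1fun ξ m z * g z + q.eval z

/-- Membership in `H(b) = a₁ H² ⊕ P_{N−1}` (description of `H(b)` for `b` rational,
not a finite Blaschke product, whose pythagorean mate has boundary zeros `ξ` with
multiplicities `m`). -/
def MemHb {n : ℕ} (ξ : Fin n → ℂ) (m : Fin n → ℕ) (f : ℂ → ℂ) : Prop :=
  ∃ gq : (ℂ → ℂ) × Polynomial ℂ, HbDecompOf ξ m f gq.1 gq.2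

/-- The (unique) decomposition of a member of `H(b)`. -/
def hbDecomp {n : ℕ} (ξ : Fin n → ℂ) (m : Fin n → ℕ) (f : ℂ → ℂ) :
    (ℂ → ℂ) × Polynomial ℂ :=
  if h : MemHb ξ m f then h.choose else (0, 0)

/-- The squared norm `⦀a₁g + q⦀² = ‖g‖²_{H²} + ‖q‖²_{H²}` on `H(b)`. -/
def hbNormSq {n : ℕ} (ξ : Fin n → ℂ) (m : Fin n → ℕ) (f : ℂ → ℂ) : ℝ :=
  h2NormSq (hbDecomp ξ m f).1 + h2NormSq fun z => ((hbDecomp ξ m f).2).eval z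

/-- The inner product on `H(b)` induced by the decomposition. -/
def hbInner {n : ℕ} (ξ : Fin n → ℂ) (m : Fin n → ℕ) (f g : ℂ → ℂ) : ℂ :=
  h2Inner (hbDecomp ξ m f).1 (hbDecomp ξ m g).1 +
    h2Inner (fun z => ((hbDecomp ξ m f).2).eval z)
      (fun z => ((hbDecomp ξ m g).2).eval z)

/-- The Stolz angle (non-tangential approach region) at a boundary point `ξ`. -/
def stolzAngle (ξ : ℂ) (M : ℝ) : Set ℂ := {z ∈ unitDisk | ‖z - ξ‖ ≤ M * (1 - ‖z‖)}

/-- `f` has non-tangential limit `L` at `ξ`. -/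
def NTLimit (f : ℂ → ℂ) (ξ L : ℂ) : Prop :=
  ∀ M : ℝ, 1 < M → Tendsto f (nhdsWithin ξ (stolzAngle ξ M)) (nhds L)

/-- Radial boundary value of `f` at `ζ` (junk value if the radial limit does not exist). -/
def bdryVal (f : ℂ → ℂ) (ζ : ℂ) : ℂ :=
  limUnder (nhdsWithin (1:ℝ) (Set.Iio 1)) fun r : ℝ => f ((r : ℂ) * ζ)

/-- The full setting: `b` is a rational function in the closed unit ball of `H^∞` with
`‖b‖_∞ = 1` which is not a finite Blaschke product; `a` is its pythagorean mate (rational,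
outer — i.e. zero-free on the disk —, `a(0) > 0`, `|a|² + |b|² = 1` on the circle); the
`ξ j` are the distinct zeros of `a` on the unit circle, with multiplicities `m j`. -/
structure RationalSetting (b a : ℂ → ℂ) (n : ℕ) (ξ : Fin n → ℂ) (m : Fin n → ℕ) :
    Prop where
  b_diff : DifferentiableOn ℂ b unitDisk
  b_rat : IsRationalOnDisk b
  b_le_one : ∀ z ∈ unitDisk, ‖b z‖ ≤ 1
  b_norm_one : sSup ((fun z => ‖b z‖) '' unitDisk) = 1
  b_not_fbp : ¬ IsFiniteBlaschke b
  a_diff : DifferentiableOn ℂ a unitDisk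
  a_rat : IsRationalOnDisk a
  a_outer : ∀ z ∈ unitDisk, a z ≠ 0
  a_zero_pos : 0 < (a 0).re ∧ (a 0).im = 0
  pyth : ∀ ζ ∈ unitCircle, ‖a ζ‖ ^ 2 + ‖b ζ‖ ^ 2 = 1
  zeros_mem : ∀ j, ξ j ∈ unitCircle
  zeros_inj : Function.Injective ξ
  mult_pos : ∀ j, 0 < m j
  factor : ∃ g : ℂ → ℂ, IsRationalOnDisk g ∧ (∀ ζ ∈ unitCircle, g ζ ≠ 0) ∧
    ∀ z ∈ Metric.closedBall (0:ℂ) 1, a z = a1fun ξ m z * g z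

/-- The composition operator `C_φ` maps `H(b)` into itself and is bounded there
(with respect to the equivalent norm `⦀·⦀_b`). -/
def CompBddHb {n : ℕ} (ξ : Fin n → ℂ) (m : Fin n → ℕ) (φ : ℂ → ℂ) : Prop :=
  (∀ f, MemHb ξ m f → MemHb ξ m fun z => f (φ z)) ∧
  ∃ C : ℝ, ∀ f, MemHb ξ m f →
    hbNormSq ξ m (fun z => f (φ z)) ≤ C * hbNormSq ξ m f

/-- The composition operator `C_φ` is compact on `H(b)`: it is bounded and the image of
every sequence in the unit ball has a subsequence whose image converges in `H(b)`. -/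
def CompCompactHb {n : ℕ} (ξ : Fin n → ℂ) (m : Fin n → ℕ) (φ : ℂ → ℂ) : Prop :=
  CompBddHb ξ m φ ∧
  ∀ f : ℕ → ℂ → ℂ, (∀ k, MemHb ξ m (f k) ∧ hbNormSq ξ m (f k) ≤ 1) →
    ∃ (κ : ℕ → ℕ) (g : ℂ → ℂ), StrictMono κ ∧ MemHb ξ m g ∧
      Tendsto (fun i => hbNormSq ξ m fun z => f (κ i) (φ z) - g z) atTop (nhds 0)

/-- The composition operator `C_φ` is Hilbert–Schmidt on `H(b)`: it is bounded and the sum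
of `⦀C_φ e⦀²` over the orthonormal basis `{a₁ z^k}ₖ ∪ {z^j}_{j<N}` of
`(H(b), ⦀·⦀_b)` is finite (the finite part of the sum being automatically finite). -/
def CompHSHb {n : ℕ} (ξ : Fin n → ℂ) (m : Fin n → ℕ) (φ : ℂ → ℂ) : Prop :=
  CompBddHb ξ m φ ∧
  Summable fun k : ℕ => hbNormSq ξ m fun z => a1fun ξ m (φ z) * φ z ^ k

/-- The weighted composition operator `W_{u,φ} f = u · (f ∘ φ)` maps `H²` boundedly
into itself. -/
def WCompBddH2 (u φ : ℂ → ℂ) : Prop :=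
  (∀ f, MemH2 f → MemH2 fun z => u z * f (φ z)) ∧
  ∃ C : ℝ, ∀ f, MemH2 f →
    h2NormSq (fun z => u z * f (φ z)) ≤ C * h2NormSq f

/-- The weighted composition operator `W_{u,φ}` is compact on `H²`. -/
def WCompCompactH2 (u φ : ℂ → ℂ) : Prop :=
  WCompBddH2 u φ ∧
  ∀ f : ℕ → ℂ → ℂ, (∀ k, MemH2 (f k) ∧ h2NormSq (f k) ≤ 1) →
    ∃ (κ : ℕ → ℕ) (g : ℂ → ℂ), StrictMono κ ∧ MemH2 g ∧
      Tendsto (fun i => h2NormSq fun z => u z * f (κ i) (φ z) - g z) atTop (nhds 0)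

/-- The weighted composition operator `W_{u,φ}` is Hilbert–Schmidt on `H²`
(sum over the orthonormal basis `{z^k}` of `H²`). -/
def WCompHSH2 (u φ : ℂ → ℂ) : Prop :=
  WCompBddH2 u φ ∧ Summable fun k : ℕ => h2NormSq fun z => u z * φ z ^ k

/-- The function `u = (a₁ ∘ φ) · ∏_{j ≥ p} (φ − φ(ξⱼ))^{mⱼ} / a₁`, where `Λ j = φ(ξ j)`
are the non-tangential limits of `φ` at the zeros of the mate. -/
def ufun {n : ℕ} (p : ℕ) (ξ : Fin n → ℂ) (m : Fin n → ℕ) (Λ : Fin n → ℂ)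
    (φ : ℂ → ℂ) : ℂ → ℂ :=
  fun z => a1fun ξ m (φ z) *
    (∏ j ∈ Finset.univ.filter fun j : Fin n => p ≤ (j : ℕ), (φ z - Λ j) ^ (m j)) /
      a1fun ξ m z

/-- The reproducing kernel of the de Branges–Rovnyak space `H(c)`:
`k_λ^c(z) = (1 − conj(c(λ)) c(z)) / (1 − conj(λ) z)`, as a function of the parameter `λ`
and the evaluation point `z`. -/
def rkKernel (c : ℂ → ℂ) (lam z : ℂ) : ℂ :=
  (1 - (starRingEnd ℂ) (c lam) * c z) / (1 - (starRingEnd ℂ) lam * z)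

/-- `f` belongs to the reproducing kernel Hilbert space `H(c)` with squared norm at
most `t`: for all finite linear combinations of kernels,
`|⟨f, Σ αᵢ k_{λᵢ}⟩|² ≤ t · ‖Σ αᵢ k_{λᵢ}‖²`. -/
def HbRKBound (c f : ℂ → ℂ) (t : ℝ) : Prop :=
  ∀ (k : ℕ) (lam α : Fin k → ℂ), (∀ i, lam i ∈ unitDisk) →
    ‖∑ i, (starRingEnd ℂ) (α i) * f (lam i)‖ ^ 2 ≤
      t * (∑ i, ∑ j, α i * (starRingEnd ℂ) (α j) * rkKernel c (lam i) (lam j)).re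

/-- Membership in the de Branges–Rovnyak space `H(c)` (general RKHS definition). -/
def MemHbRK (c f : ℂ → ℂ) : Prop := ∃ t : ℝ, HbRKBound c f t

/-- `φ` has an angular derivative in the sense of Carathéodory at `ξ`:
`φ` and `φ'` have non-tangential limits at `ξ` and `|φ(ξ)| = 1`. -/
def HasADC (φ : ℂ → ℂ) (ξ : ℂ) : Prop :=
  ∃ L L' : ℂ, ‖L‖ = 1 ∧ NTLimit φ ξ L ∧ NTLimit (deriv φ) ξ L'

/-- The measure `μ_{u,φ}(E) = ∫_{φ⁻¹(E) ∩ T} |u|² dm` (boundary values on the circle,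
normalized Lebesgue measure). -/
def muMeas (u φ : ℂ → ℂ) (E : Set ℂ) : ENNReal :=
  (ENNReal.ofReal (2 * Real.pi))⁻¹ *
    ∫⁻ θ in Set.Ioc (0:ℝ) (2 * Real.pi),
      (if bdryVal φ (Complex.exp (θ * Complex.I)) ∈ E then
        ENNReal.ofReal (‖bdryVal u (Complex.exp (θ * Complex.I))‖ ^ 2) else 0)

/-- `μ_{u,φ}` is a Carleson measure: `μ(S(ζ,r)) ≤ M r` for all Carleson windows
`S(ζ,r) = {z : |z| ≤ 1, |z − ζ| ≤ r}`, `ζ ∈ T`, `0 < r < 1`. -/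
def IsCarleson (u φ : ℂ → ℂ) : Prop :=
  ∃ M : ℝ, 0 < M ∧ ∀ ζ ∈ unitCircle, ∀ r ∈ Set.Ioo (0:ℝ) 1,
    muMeas u φ (Metric.closedBall ζ r ∩ Metric.closedBall 0 1) ≤ ENNReal.ofReal (M * r)

/-- `μ_{u,φ}` is a vanishing Carleson measure: `sup_{ζ∈T} μ(S(ζ,r))/r → 0` as `r → 0`. -/
def IsVanishingCarleson (u φ : ℂ → ℂ) : Prop :=
  ∀ ε > (0:ℝ), ∃ r₀ ∈ Set.Ioo (0:ℝ) 1, ∀ r ∈ Set.Ioo (0:ℝ) r₀, ∀ ζ ∈ unitCircle,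
    muMeas u φ (Metric.closedBall ζ r ∩ Metric.closedBall 0 1) ≤ ENNReal.ofReal (ε * r)

/-- The reproducing kernel integral
`∫_T (1 − |w|²) |u(ξ)|² / |1 − conj(w) φ(ξ)|² dm(ξ)`. -/
def repKerInt (u φ : ℂ → ℂ) (w : ℂ) : ENNReal :=
  (ENNReal.ofReal (2 * Real.pi))⁻¹ *
    ∫⁻ θ in Set.Ioc (0:ℝ) (2 * Real.pi),
      ENNReal.ofReal ((1 - ‖w‖ ^ 2) * ‖bdryVal u (Complex.exp (θ * Complex.I))‖ ^ 2 /
        ‖1 - (starRingEnd ℂ) w * bdryVal φ (Complex.exp (θ * Complex.I))‖ ^ 2)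

/-! ### Part 1: the circle measure, Taylor series and Parseval -/

/-- Lebesgue measure on the parameter interval. -/
abbrev circM : Measure ℝ := volume.restrict (Set.Ioc (0:ℝ) (2 * Real.pi))

/-- The parametrization of the circle. -/
abbrev eC (θ : ℝ) : ℂ := Complex.exp (θ * Complex.I)

lemma norm_eC (θ : ℝ) : ‖eC θ‖ = 1 := Complex.norm_exp_ofReal_mul_I θ

lemma continuous_eC : Continuous eC := by unfold eC; fun_prop

lemma mem_disk_iff {z : ℂ} : z ∈ unitDisk ↔ ‖z‖ < 1 := by simp [unitDisk]

lemma mem_circle_iff {z : ℂ} : z ∈ unitCircle ↔ ‖z‖ = 1 := by simp [unitCircle]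

lemma isOpen_unitDisk : IsOpen unitDisk := Metric.isOpen_ball

lemma smul_eC_mem {r : ℝ} (h0 : 0 ≤ r) (h1 : r < 1) (θ : ℝ) : (r : ℂ) * eC θ ∈ unitDisk := by
  rw [mem_disk_iff, norm_mul, norm_eC, mul_one, Complex.norm_real, Real.norm_eq_abs,
    abs_of_nonneg h0]
  exact h1

lemma taylor_hasSum {f : ℂ → ℂ} (hf : DifferentiableOn ℂ f unitDisk) {z : ℂ}
    (hz : z ∈ unitDisk) : HasSum (fun k => taylorCoeff f k * z ^ k) (f z) := by
  have h := Complex.hasSum_taylorSeries_on_ball (c := 0) (r := 1) (f := f)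
    (by simpa [unitDisk] using hf) (z := z) (by simpa [unitDisk] using hz)
  have e : (fun k => taylorCoeff f k * z ^ k) = fun n : ℕ ↦
      ((n.factorial : ℂ))⁻¹ • (z - 0) ^ n • iteratedDeriv n f 0 := by
    funext k
    simp only [taylorCoeff, smul_eq_mul, sub_zero]
    ring
  rw [e]; exact h

lemma taylor_unique {f : ℂ → ℂ} (hf : DifferentiableOn ℂ f unitDisk) (a : ℕ → ℂ)
    (ha : ∀ z ∈ unitDisk, HasSum (fun k => a k * z ^ k) (f z)) (k : ℕ) :
    taylorCoeff f k = a k := by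
  have key : ∀ c : ℕ → ℂ, (∀ z ∈ unitDisk, HasSum (fun k => c k * z ^ k) (f z)) →
      HasFPowerSeriesAt f (FormalMultilinearSeries.ofScalars ℂ c) 0 := by
    intro c hc
    rw [hasFPowerSeriesAt_iff]
    filter_upwards [isOpen_unitDisk.mem_nhds (show (0:ℂ) ∈ unitDisk by simp [unitDisk])] with z hz
    have := hc z hz
    simpa [FormalMultilinearSeries.coeff_ofScalars, mul_comm] using this
  have h := (key _ (fun z hz => taylor_hasSum hf hz)).eq_formalMultilinearSeries (key a ha)
  have := congrArg (fun p : FormalMultilinearSeries ℂ ℂ ℂ => p.coeff k) h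
  simpa [FormalMultilinearSeries.coeff_ofScalars] using this

lemma taylorCoeff_congr {f g : ℂ → ℂ} (h : ∀ z ∈ unitDisk, f z = g z) (k : ℕ) :
    taylorCoeff f k = taylorCoeff g k := by
  unfold taylorCoeff
  have : f =ᶠ[nhds 0] g := by
    filter_upwards [isOpen_unitDisk.mem_nhds (show (0:ℂ) ∈ unitDisk by simp [unitDisk])] with z hz
    exact h z hz
  rw [this.iteratedDeriv_eq k]

lemma memH2_congr {f g : ℂ → ℂ} (h : ∀ z ∈ unitDisk, f z = g z) (hf : MemH2 f) : MemH2 g := by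
  refine ⟨hf.1.congr (fun z hz => (h z hz).symm), ?_⟩
  have : (fun k => ‖taylorCoeff g k‖ ^ 2) = fun k => ‖taylorCoeff f k‖ ^ 2 := by
    funext k; rw [taylorCoeff_congr h]
  rw [this]; exact hf.2

lemma h2NormSq_congr {f g : ℂ → ℂ} (h : ∀ z ∈ unitDisk, f z = g z) :
    h2NormSq f = h2NormSq g := by
  unfold h2NormSq
  congr 1; funext k; rw [taylorCoeff_congr h]

lemma h2NormSq_nonneg (f : ℂ → ℂ) : 0 ≤ h2NormSq f := tsum_nonneg fun _ => by positivity

lemma enorm_sq_eq (z : ℂ) : ‖z‖ₑ ^ 2 = ENNReal.ofReal (‖z‖ ^ 2) := by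
  rw [← ofReal_norm, ENNReal.ofReal_pow (norm_nonneg _)]

lemma parseval_poly (P : Polynomial ℂ) :
    ∫⁻ θ, ‖P.eval (eC θ)‖ₑ ^ 2 ∂circM =
      ENNReal.ofReal (2 * Real.pi) * ENNReal.ofReal (∑ i ∈ P.support, ‖P.coeff i‖ ^ 2) := by
  have hpi : (0:ℝ) < 2 * Real.pi := by positivity
  have hc : Continuous fun θ : ℝ => ‖P.eval (eC θ)‖ ^ 2 := by
    have := P.continuous.comp continuous_eC
    exact (this.norm.pow 2)
  simp_rw [enorm_sq_eq]
  rw [← ofReal_integral_eq_lintegral_ofReal]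
  · rw [← ENNReal.ofReal_mul hpi.le, Polynomial.sum_sq_norm_coeff_eq_circleAverage,
      Real.circleAverage_def, intervalIntegral.integral_of_le hpi.le, smul_eq_mul,
      mul_inv_cancel_left₀ hpi.ne']
    simp [circleMap]
  · exact (hc.integrableOn_Icc (a := 0) (b := 2 * Real.pi)).mono_set Ioc_subset_Icc_self
  · exact ae_of_all _ fun _ => by positivity

lemma cont_slice {f : ℂ → ℂ} (hf : DifferentiableOn ℂ f unitDisk) {r : ℝ} (h0 : 0 ≤ r)
    (h1 : r < 1) : Continuous fun θ : ℝ => f ((r : ℂ) * eC θ) := by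
  have : ContinuousOn f unitDisk := hf.continuousOn
  refine this.comp_continuous (by have := continuous_eC; fun_prop) fun θ => smul_eC_mem h0 h1 θ

lemma summable_taylor {f : ℂ → ℂ} (hf : DifferentiableOn ℂ f unitDisk) {r : ℝ} (h0 : 0 ≤ r)
    (h1 : r < 1) : Summable fun k => ‖taylorCoeff f k‖ * r ^ k := by
  have h := (taylor_hasSum hf (z := (r : ℂ)) (by
    rw [mem_disk_iff, Complex.norm_real, Real.norm_eq_abs, abs_of_nonneg h0]; exact h1)).summable.norm
  simpa [abs_of_nonneg h0] using h

instance : IsFiniteMeasure circM := by unfold circM; infer_instance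

lemma parseval_slice {f : ℂ → ℂ} (hf : DifferentiableOn ℂ f unitDisk) {r : ℝ} (h0 : 0 ≤ r)
    (h1 : r < 1) :
    ∫⁻ θ, ‖f ((r : ℂ) * eC θ)‖ₑ ^ 2 ∂circM =
      ENNReal.ofReal (2 * Real.pi) *
        ∑' k, ENNReal.ofReal (‖taylorCoeff f k‖ ^ 2 * r ^ (2 * k)) := by
  set a := taylorCoeff f with ha
  set P : ℕ → Polynomial ℂ := fun N => ∑ k ∈ Finset.range N, Polynomial.monomial k (a k * r ^ k)
    with hP
  have hev : ∀ N (z : ℂ), (P N).eval z = ∑ k ∈ Finset.range N, a k * (r * z) ^ k := by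
    intro N z
    simp only [hP, Polynomial.eval_finsetSum, Polynomial.eval_monomial]
    refine Finset.sum_congr rfl fun k _ => by rw [mul_pow]; ring
  have hcoef : ∀ N k, (P N).coeff k = if k < N then a k * r ^ k else 0 := by
    intro N k
    simp only [hP, Polynomial.finsetSum_coeff, Polynomial.coeff_monomial]
    simp
  have hS := summable_taylor hf h0 h1
  set S := ∑' k, ‖a k‖ * r ^ k
  have hbd : ∀ N θ, ‖(P N).eval (eC θ)‖ ≤ S := by
    intro N θ
    rw [hev]
    refine (norm_sum_le _ _).trans ?_
    refine le_trans (le_of_eq ?_) (hS.sum_le_tsum (Finset.range N) fun k _ => by positivity)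
    refine Finset.sum_congr rfl fun k _ => ?_
    simp [abs_of_nonneg h0]
  have hlim : ∀ θ, Tendsto (fun N => ‖(P N).eval (eC θ)‖ₑ ^ 2) atTop
      (nhds (‖f ((r : ℂ) * eC θ)‖ₑ ^ 2)) := by
    intro θ
    have h := (taylor_hasSum hf (smul_eC_mem h0 h1 θ)).tendsto_sum_nat
    simp_rw [enorm_sq_eq]
    refine ENNReal.tendsto_ofReal ?_
    simp_rw [hev]
    exact (h.norm.pow 2)
  have h2 := tendsto_lintegral_of_dominated_convergence (μ := circM) (fun _ => ENNReal.ofReal (S ^ 2))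
    (F := fun N θ => ‖(P N).eval (eC θ)‖ₑ ^ 2) (f := fun θ => ‖f ((r : ℂ) * eC θ)‖ₑ ^ 2)
    (fun N => by
      have := (P N).continuous.comp continuous_eC
      exact (this.measurable.enorm.pow_const 2))
    (fun N => ae_of_all _ fun θ => by
      simp only [enorm_sq_eq]
      exact ENNReal.ofReal_le_ofReal (pow_le_pow_left₀ (norm_nonneg _) (hbd N θ) 2))
    (by simp [ENNReal.mul_eq_top])
    (ae_of_all _ hlim)
  simp_rw [parseval_poly] at h2
  refine tendsto_nhds_unique h2 ?_
  refine ENNReal.Tendsto.const_mul ?_ (Or.inr ENNReal.ofReal_ne_top)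
  have h3 := ENNReal.tendsto_nat_tsum fun k => ENNReal.ofReal (‖a k‖ ^ 2 * r ^ (2 * k))
  refine h3.congr fun N => ?_
  rw [← ENNReal.ofReal_sum_of_nonneg (fun _ _ => by positivity)]
  congr 1
  rw [← Finset.sum_subset (s₁ := (P N).support) (s₂ := Finset.range N)
    (f := fun k => ‖a k‖ ^ 2 * r ^ (2 * k))]
  · refine Finset.sum_congr rfl fun k hk => ?_
    have hk' : k < N := by
      by_contra h
      simp [hcoef, h] at hk
    rw [hcoef, if_pos hk']
    rw [norm_mul, norm_pow, Complex.norm_real, Real.norm_eq_abs, abs_of_nonneg h0]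
    ring
  · intro k hk
    by_contra h
    simp only [Finset.mem_range] at h
    simp [hcoef, h] at hk
  · intro k hk hk2
    have hk' : k < N := by simpa using hk
    have : (P N).coeff k = 0 := by simpa using hk2
    rw [hcoef, if_pos hk'] at this
    have h4 : ‖a k * r ^ k‖ = 0 := by rw [this]; simp
    simp only [norm_mul, norm_pow, Complex.norm_real, Real.norm_eq_abs, abs_of_nonneg h0] at h4
    rw [mul_comm 2 k, pow_mul, ← mul_pow, h4]; simp

lemma h2_slice_le {f : ℂ → ℂ} (hf : MemH2 f) {r : ℝ} (h0 : 0 ≤ r) (h1 : r < 1) :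
    ∫⁻ θ, ‖f ((r : ℂ) * eC θ)‖ₑ ^ 2 ∂circM ≤
      ENNReal.ofReal (2 * Real.pi) * ENNReal.ofReal (h2NormSq f) := by
  rw [parseval_slice hf.1 h0 h1, h2NormSq, ENNReal.ofReal_tsum_of_nonneg (fun _ => by positivity) hf.2]
  gcongr with k
  have : r ^ (2 * k) ≤ 1 := pow_le_one₀ h0 h1.le
  nlinarith [sq_nonneg ‖taylorCoeff f k‖]

lemma two_pi_ne_zero' : ENNReal.ofReal (2 * Real.pi) ≠ 0 := by
  have : (0:ℝ) < 2 * Real.pi := by positivity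
  simpa using this

/-- A function with bounded square means is in `H²`. It suffices to have this frequently. -/
lemma memH2_of_slice {f : ℂ → ℂ} (hf : DifferentiableOn ℂ f unitDisk) {C : ℝ} (hC : 0 ≤ C)
    (h : ∃ᶠ r : ℝ in nhdsWithin 1 (Iio 1), ∫⁻ θ, ‖f ((r : ℂ) * eC θ)‖ₑ ^ 2 ∂circM ≤
      ENNReal.ofReal (2 * Real.pi) * ENNReal.ofReal C) :
    MemH2 f ∧ h2NormSq f ≤ C := by
  have key : ∀ s : Finset ℕ, ∑ k ∈ s, ‖taylorCoeff f k‖ ^ 2 ≤ C := by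
    intro s
    have hc : Tendsto (fun r : ℝ => ∑ k ∈ s, ‖taylorCoeff f k‖ ^ 2 * r ^ (2 * k))
        (nhdsWithin 1 (Iio 1)) (nhds (∑ k ∈ s, ‖taylorCoeff f k‖ ^ 2 * 1 ^ (2 * k))) := by
      refine Tendsto.mono_left ?_ nhdsWithin_le_nhds
      refine Continuous.tendsto (f := fun r : ℝ => ∑ k ∈ s, ‖taylorCoeff f k‖ ^ 2 * r ^ (2 * k)) ?_ 1
      fun_prop
    simp only [one_pow, mul_one] at hc
    have hev : ∀ᶠ r : ℝ in nhdsWithin 1 (Iio 1), 0 < r ∧ r < 1 := by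
      filter_upwards [self_mem_nhdsWithin, nhdsWithin_le_nhds (lt_mem_nhds (zero_lt_one))] with r h1 h2
      exact ⟨h2, h1⟩
    refine le_of_tendsto_of_frequently hc ((h.and_eventually hev).mono ?_)
    rintro r ⟨hr, h0, h1⟩
    rw [parseval_slice hf h0.le h1,
      ENNReal.mul_le_mul_iff_right two_pi_ne_zero' ENNReal.ofReal_ne_top] at hr
    have h5 := (ENNReal.sum_le_tsum s).trans hr
    rw [← ENNReal.ofReal_sum_of_nonneg (fun _ _ => by positivity)] at h5
    exact (ENNReal.ofReal_le_ofReal_iff hC).1 h5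
  exact ⟨⟨hf, summable_of_sum_le (fun _ => by positivity) key⟩,
    Real.tsum_le_of_sum_le (fun _ => by positivity) key⟩

lemma slice_ev {p : ℝ → Prop} (h : ∀ r : ℝ, 0 ≤ r → r < 1 → p r) :
    ∀ᶠ r : ℝ in nhdsWithin 1 (Iio 1), p r := by
  filter_upwards [self_mem_nhdsWithin, nhdsWithin_le_nhds (lt_mem_nhds (zero_lt_one))] with r h1 h2
  exact h r (le_of_lt h2) h1

lemma h2_pointwise {f : ℂ → ℂ} (hf : MemH2 f) {z : ℂ} (hz : z ∈ unitDisk) :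
    ‖f z‖ ^ 2 * (1 - ‖z‖ ^ 2) ≤ h2NormSq f := by
  have hz' := mem_disk_iff.1 hz
  have hz2 : ‖z‖ ^ 2 < 1 := by nlinarith [norm_nonneg z]
  have hg : HasSum (fun k => (‖z‖ ^ 2) ^ k) (1 - ‖z‖ ^ 2)⁻¹ :=
    hasSum_geometric_of_lt_one (by positivity) hz2
  have hpos : 0 < 1 - ‖z‖ ^ 2 := by linarith
  have h := (taylor_hasSum hf.1 hz).tendsto_sum_nat
  have hle : ‖f z‖ ^ 2 ≤ h2NormSq f * (1 - ‖z‖ ^ 2)⁻¹ := by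
    refine le_of_tendsto (h.norm.pow 2) (Eventually.of_forall fun N => ?_)
    calc ‖∑ k ∈ Finset.range N, taylorCoeff f k * z ^ k‖ ^ 2
        ≤ (∑ k ∈ Finset.range N, ‖taylorCoeff f k‖ * ‖z‖ ^ k) ^ 2 := by
          refine pow_le_pow_left₀ (norm_nonneg _) ((norm_sum_le _ _).trans (le_of_eq ?_)) 2
          simp
      _ ≤ (∑ k ∈ Finset.range N, ‖taylorCoeff f k‖ ^ 2) *
          ∑ k ∈ Finset.range N, (‖z‖ ^ k) ^ 2 := Finset.sum_mul_sq_le_sq_mul_sq _ _ _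
      _ ≤ h2NormSq f * (1 - ‖z‖ ^ 2)⁻¹ := by
          refine mul_le_mul (hf.2.sum_le_tsum _ fun _ _ => by positivity) ?_ (by positivity)
            (h2NormSq_nonneg f)
          rw [← hg.tsum_eq]
          refine le_trans (le_of_eq ?_) (hg.summable.sum_le_tsum (Finset.range N) fun _ _ => by positivity)
          refine Finset.sum_congr rfl fun k _ => by rw [← pow_mul, ← pow_mul, mul_comm]
  calc ‖f z‖ ^ 2 * (1 - ‖z‖ ^ 2) ≤ h2NormSq f * (1 - ‖z‖ ^ 2)⁻¹ * (1 - ‖z‖ ^ 2) := by gcongr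
    _ = h2NormSq f := by field_simp

lemma memH2_mul_bdd {f b : ℂ → ℂ} (hf : MemH2 f) (hb : DifferentiableOn ℂ b unitDisk) {B : ℝ}
    (hB : ∀ z ∈ unitDisk, ‖b z‖ ≤ B) :
    MemH2 (fun z => b z * f z) ∧ h2NormSq (fun z => b z * f z) ≤ B ^ 2 * h2NormSq f := by
  refine memH2_of_slice (hb.mul hf.1) (mul_nonneg (sq_nonneg _) (h2NormSq_nonneg f))
    (Eventually.frequently (slice_ev fun r h0 h1 => ?_))
  calc ∫⁻ θ, ‖b ((r : ℂ) * eC θ) * f ((r : ℂ) * eC θ)‖ₑ ^ 2 ∂circM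
      ≤ ∫⁻ θ, ENNReal.ofReal (B ^ 2) * ‖f ((r : ℂ) * eC θ)‖ₑ ^ 2 ∂circM := by
        refine lintegral_mono fun θ => ?_
        have := hB _ (smul_eC_mem h0 h1 θ)
        simp only [enorm_sq_eq]
        rw [← ENNReal.ofReal_mul (by positivity), norm_mul, mul_pow]
        gcongr
    _ = ENNReal.ofReal (B ^ 2) * ∫⁻ θ, ‖f ((r : ℂ) * eC θ)‖ₑ ^ 2 ∂circM :=
        lintegral_const_mul' _ _ ENNReal.ofReal_ne_top
    _ ≤ ENNReal.ofReal (B ^ 2) * (ENNReal.ofReal (2 * Real.pi) * ENNReal.ofReal (h2NormSq f)) := by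
        gcongr; exact h2_slice_le hf h0 h1
    _ = _ := by rw [ENNReal.ofReal_mul (sq_nonneg _)]; ring

lemma memH2_one : MemH2 (fun _ => 1) ∧ h2NormSq (fun _ => 1) ≤ 1 := by
  refine memH2_of_slice (by fun_prop) zero_le_one
    (Eventually.frequently (slice_ev fun r h0 h1 => ?_))
  simp [circM]

lemma memH2_of_bdd {b : ℂ → ℂ} (hb : DifferentiableOn ℂ b unitDisk) {B : ℝ}
    (hB : ∀ z ∈ unitDisk, ‖b z‖ ≤ B) : MemH2 b := by
  have := (memH2_mul_bdd memH2_one.1 hb hB).1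
  simpa using this

lemma memH2_const_mul {f : ℂ → ℂ} (hf : MemH2 f) (c : ℂ) :
    MemH2 (fun z => c * f z) ∧ h2NormSq (fun z => c * f z) ≤ ‖c‖ ^ 2 * h2NormSq f :=
  memH2_mul_bdd (b := fun _ => c) hf (by fun_prop) (fun _ _ => le_rfl)

lemma memH2_add {f g : ℂ → ℂ} (hf : MemH2 f) (hg : MemH2 g) :
    MemH2 (fun z => f z + g z) ∧
      h2NormSq (fun z => f z + g z) ≤ 2 * (h2NormSq f + h2NormSq g) := by
  have hk : ∀ k, taylorCoeff (fun z => f z + g z) k = taylorCoeff f k + taylorCoeff g k :=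
    taylor_unique (hf.1.add hg.1) _ fun z hz => by
      simpa [add_mul] using (taylor_hasSum hf.1 hz).add (taylor_hasSum hg.1 hz)
  have hle : ∀ k, ‖taylorCoeff (fun z => f z + g z) k‖ ^ 2 ≤
      2 * (‖taylorCoeff f k‖ ^ 2 + ‖taylorCoeff g k‖ ^ 2) := by
    intro k
    rw [hk]
    have := norm_add_le (taylorCoeff f k) (taylorCoeff g k)
    have h0 := norm_nonneg (taylorCoeff f k + taylorCoeff g k)
    nlinarith [sq_nonneg (‖taylorCoeff f k‖ - ‖taylorCoeff g k‖)]
  have hs := (hf.2.add hg.2).mul_left 2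
  have hS := Summable.of_nonneg_of_le (fun _ => by positivity) hle hs
  refine ⟨⟨hf.1.add hg.1, hS⟩, ?_⟩
  unfold h2NormSq
  rw [← hf.2.tsum_add hg.2, ← tsum_mul_left]
  exact hS.tsum_le_tsum hle hs

lemma memH2_poly (P : Polynomial ℂ) : MemH2 (fun z => P.eval z) := by
  obtain ⟨B, hB⟩ := (isCompact_closedBall (0:ℂ) 1).exists_bound_of_continuousOn
    (f := fun z => P.eval z) P.continuous.continuousOn
  exact memH2_of_bdd P.differentiable.differentiableOn (B := B) fun z hz => hB z
    (Metric.ball_subset_closedBall hz)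

lemma taylorCoeff_poly (P : Polynomial ℂ) (k : ℕ) :
    taylorCoeff (fun z => P.eval z) k = P.coeff k := by
  refine taylor_unique P.differentiable.differentiableOn _ (fun z _ => ?_) k
  rw [Polynomial.eval_eq_sum]
  refine hasSum_sum_of_ne_finset_zero fun k hk => ?_
  simp [Polynomial.notMem_support_iff.1 hk]

lemma coeff_sq_le (P : Polynomial ℂ) (k : ℕ) :
    ‖P.coeff k‖ ^ 2 ≤ h2NormSq (fun z => P.eval z) := by
  rw [← taylorCoeff_poly]
  exact (memH2_poly P).2.le_tsum k fun _ _ => by positivity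

/-! ### Part 2: the Carleson embedding theorem -/

/-- The Poisson kernel on the circle. -/
def poisK (w : ℂ) (θ : ℝ) : ℝ := (1 - ‖w‖ ^ 2) / ‖eC θ - w‖ ^ 2

lemma sub_pos_of_disk {w : ℂ} (hw : ‖w‖ < 1) (θ : ℝ) : 0 < ‖eC θ - w‖ := by
  have := norm_sub_norm_le (eC θ) w
  rw [norm_eC] at this
  linarith

lemma continuous_poisK {w : ℂ} (hw : ‖w‖ < 1) : Continuous (poisK w) := by
  unfold poisK
  refine Continuous.div (by fun_prop) (by have := continuous_eC; fun_prop) fun θ => ?_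
  have := sub_pos_of_disk hw θ
  positivity

lemma poisK_nonneg {w : ℂ} (hw : ‖w‖ < 1) (θ : ℝ) : 0 ≤ poisK w θ := by
  unfold poisK
  have : ‖w‖ ^ 2 ≤ 1 := by nlinarith [norm_nonneg w]
  have : 0 ≤ 1 - ‖w‖ ^ 2 := by linarith
  positivity

lemma poisson_formula {f : ℂ → ℂ} (hf : DiffContOnCl ℂ f (Metric.ball 0 1)) {w : ℂ}
    (hw : ‖w‖ < 1) :
    f w = ((2 * Real.pi)⁻¹ : ℝ) • ∫ θ, (poisK w θ) • f (eC θ) ∂circM := by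
  have h := DiffContOnCl.circleAverage_re_herglotzRieszKernel_smul hf (w := w) (by simpa using hw)
  rw [← poissonKernel_eq_re_herglotzRieszKernel, Real.circleAverage_def,
    intervalIntegral.integral_of_le (by positivity)] at h
  rw [← h]
  congr 1
  refine integral_congr_ae (ae_of_all _ fun θ => ?_)
  simp [poissonKernel, circleMap, poisK]

lemma lint_poisK {w : ℂ} (hw : ‖w‖ < 1) :
    ∫⁻ θ, ENNReal.ofReal (poisK w θ) ∂circM = ENNReal.ofReal (2 * Real.pi) := by
  have hpi : (0:ℝ) < 2 * Real.pi := by positivity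
  rw [← ofReal_integral_eq_lintegral_ofReal]
  · congr 1
    have h := poisson_formula (f := fun _ => 1) diffContOnCl_const hw
    have e : ∀ θ, (poisK w θ) • (1:ℂ) = ((poisK w θ : ℝ) : ℂ) := fun θ => by simp
    simp_rw [e] at h
    rw [integral_complex_ofReal, Complex.real_smul] at h
    have h' : (1:ℝ) = (2 * Real.pi)⁻¹ * ∫ θ, poisK w θ ∂circM := by exact_mod_cast h
    field_simp at h'
    linarith
  · exact ((continuous_poisK hw).integrableOn_Icc (a := 0) (b := 2 * Real.pi)).mono_set
      Ioc_subset_Icc_self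
  · exact ae_of_all _ fun θ => poisK_nonneg hw θ

lemma poisson_bound {f : ℂ → ℂ} (hf : DiffContOnCl ℂ f (Metric.ball 0 1)) {w : ℂ}
    (hw : ‖w‖ < 1) :
    ENNReal.ofReal (2 * Real.pi) * ‖f w‖ₑ ≤
      ∫⁻ θ, ENNReal.ofReal (poisK w θ) * ‖f (eC θ)‖ₑ ∂circM := by
  have hpi : (0:ℝ) < 2 * Real.pi := by positivity
  have h := poisson_formula hf hw
  have h2 : ENNReal.ofReal (2 * Real.pi) * ‖f w‖ₑ = ‖∫ θ, (poisK w θ) • f (eC θ) ∂circM‖ₑ := by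
    rw [h, enorm_smul, ← mul_assoc]
    have : ENNReal.ofReal (2 * Real.pi) * ‖((2 * Real.pi)⁻¹ : ℝ)‖ₑ = 1 := by
      rw [Real.enorm_of_nonneg (by positivity), ← ENNReal.ofReal_mul hpi.le,
        mul_inv_cancel₀ hpi.ne']
      simp
    rw [this, one_mul]
  rw [h2]
  refine (enorm_integral_le_lintegral_enorm _).trans (le_of_eq ?_)
  refine lintegral_congr fun θ => ?_
  rw [enorm_smul, Real.enorm_of_nonneg (poisK_nonneg hw θ)]

lemma poisK_dyadic {w ζ : ℂ} (hw : ‖w‖ < 1) (hζ : ‖ζ‖ = 1) (hwζ : w = ‖w‖ * ζ) (θ : ℝ) :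
    ENNReal.ofReal (poisK w θ) ≤ ∑' k : ℕ, ENNReal.ofReal (32 * (4:ℝ)⁻¹ ^ k / (1 - ‖w‖)) *
      (eC ⁻¹' Metric.closedBall ζ (2 ^ k * (1 - ‖w‖))).indicator 1 θ := by
  set δ := 1 - ‖w‖ with hδ
  have hδ0 : 0 < δ := by linarith
  have hex : ∃ k : ℕ, ‖eC θ - ζ‖ ≤ 2 ^ k * δ := by
    obtain ⟨k, hk⟩ := pow_unbounded_of_one_lt (‖eC θ - ζ‖ / δ) (one_lt_two (α := ℝ))
    exact ⟨k, by rw [div_lt_iff₀ hδ0] at hk; exact hk.le⟩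
  have hk := Nat.find_spec hex
  have hmin := fun j => Nat.find_min hex (m := j)
  set k := Nat.find hex
  refine le_trans ?_ (ENNReal.le_tsum k)
  rw [indicator_of_mem (by simpa [dist_eq_norm] using hk)]
  simp only [Pi.one_apply, mul_one]
  refine ENNReal.ofReal_le_ofReal ?_
  have hd := sub_pos_of_disk hw θ
  have hwz : ‖w - ζ‖ = δ := by
    have : w - ζ = ((‖w‖ - 1 : ℝ) : ℂ) * ζ := by
      conv_lhs => rw [hwζ]
      push_cast; ring
    rw [this, norm_mul, hζ, mul_one, Complex.norm_real, Real.norm_eq_abs, abs_of_neg (by linarith)]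
    ring
  have hge : δ ≤ ‖eC θ - w‖ := by
    have := norm_sub_norm_le (eC θ) w
    rw [norm_eC] at this
    linarith
  have h1 : ‖eC θ - ζ‖ ≤ 2 * ‖eC θ - w‖ := by
    have : eC θ - ζ = (eC θ - w) + (w - ζ) := by ring
    rw [this]
    refine (norm_add_le _ _).trans ?_
    linarith
  have hnum : 1 - ‖w‖ ^ 2 ≤ 2 * δ := by nlinarith [norm_nonneg w]
  have h3 : 2 ^ k * δ ≤ 4 * ‖eC θ - w‖ := by
    rcases Nat.eq_zero_or_pos k with h0 | h0
    · rw [h0]; linarith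
    · obtain ⟨j, hj⟩ : ∃ j, k = j + 1 := ⟨k - 1, by omega⟩
      have := hmin j (by omega)
      push Not at this
      rw [hj, pow_succ]
      linarith
  unfold poisK
  rw [div_le_div_iff₀ (by positivity) hδ0]
  have h4 : (2 ^ k * δ) ^ 2 ≤ 16 * ‖eC θ - w‖ ^ 2 := by
    have := pow_le_pow_left₀ (by positivity) h3 2
    linarith
  have h5 : ((2:ℝ) ^ k) ^ 2 * (4:ℝ)⁻¹ ^ k = 1 := by
    rw [← pow_mul, mul_comm k 2, pow_mul, ← mul_pow]; norm_num
  have h6 : δ ^ 2 ≤ 16 * ‖eC θ - w‖ ^ 2 * (4:ℝ)⁻¹ ^ k := by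
    calc δ ^ 2 = (2 ^ k * δ) ^ 2 * (4:ℝ)⁻¹ ^ k := by
          rw [mul_pow]; linear_combination (- δ ^ 2) * h5
      _ ≤ _ := by gcongr
  nlinarith

/-- If all dyadic averages are small, then so is the Poisson integral. -/
lemma poisson_of_averages {w ζ : ℂ} (hw : ‖w‖ < 1) (hζ : ‖ζ‖ = 1) (hwζ : w = ‖w‖ * ζ)
    {g : ℝ → ENNReal} (hg : Measurable g) {A : ℝ} (hA : 0 ≤ A)
    (h : ∀ k : ℕ, ∫⁻ θ in eC ⁻¹' Metric.closedBall ζ (2 ^ k * (1 - ‖w‖)), g θ ∂circM ≤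
      ENNReal.ofReal (A * (2 ^ k * (1 - ‖w‖)))) :
    ∫⁻ θ, ENNReal.ofReal (poisK w θ) * g θ ∂circM ≤ ENNReal.ofReal (64 * A) := by
  have hδ0 : 0 < 1 - ‖w‖ := by linarith
  have hms : ∀ k : ℕ, MeasurableSet (eC ⁻¹' Metric.closedBall ζ (2 ^ k * (1 - ‖w‖))) := fun k =>
    continuous_eC.measurable measurableSet_closedBall
  calc ∫⁻ θ, ENNReal.ofReal (poisK w θ) * g θ ∂circM
      ≤ ∫⁻ θ, ∑' k : ℕ, ENNReal.ofReal (32 * (4:ℝ)⁻¹ ^ k / (1 - ‖w‖)) *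
        (eC ⁻¹' Metric.closedBall ζ (2 ^ k * (1 - ‖w‖))).indicator g θ ∂circM := by
        refine lintegral_mono fun θ => ?_
        refine (mul_le_mul_left (poisK_dyadic hw hζ hwζ θ) (g θ)).trans (le_of_eq ?_)
        rw [← ENNReal.tsum_mul_right]
        congr 1; funext k
        rw [mul_assoc]
        congr 1
        by_cases hm : θ ∈ eC ⁻¹' Metric.closedBall ζ (2 ^ k * (1 - ‖w‖))
        · rw [indicator_of_mem hm, indicator_of_mem hm]; simp
        · rw [indicator_of_notMem hm, indicator_of_notMem hm]; simp
    _ = ∑' k : ℕ, ENNReal.ofReal (32 * (4:ℝ)⁻¹ ^ k / (1 - ‖w‖)) *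
        ∫⁻ θ in eC ⁻¹' Metric.closedBall ζ (2 ^ k * (1 - ‖w‖)), g θ ∂circM := by
        rw [lintegral_tsum fun k => ((hg.indicator (hms k)).const_mul _).aemeasurable]
        congr 1; funext k
        rw [lintegral_const_mul _ (hg.indicator (hms k)), lintegral_indicator (hms k)]
    _ ≤ ∑' k : ℕ, ENNReal.ofReal (32 * A * (2:ℝ)⁻¹ ^ k) := by
        refine ENNReal.tsum_le_tsum fun k => ?_
        refine (mul_le_mul_right (h k) _).trans (le_of_eq ?_)
        rw [← ENNReal.ofReal_mul (by positivity)]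
        congr 1
        have : (4:ℝ)⁻¹ ^ k * 2 ^ k = (2:ℝ)⁻¹ ^ k := by rw [← mul_pow]; norm_num
        rw [← this]; field_simp
    _ = ENNReal.ofReal (64 * A) := by
        have hs : HasSum (fun k : ℕ => 32 * A * (2:ℝ)⁻¹ ^ k) (32 * A * 2) := by
          have := (hasSum_geometric_of_lt_one (r := (2:ℝ)⁻¹) (by norm_num) (by norm_num)).mul_left (32 * A)
          norm_num at this ⊢
          exact this
        rw [← ENNReal.ofReal_tsum_of_nonneg (fun k => by positivity) hs.summable, hs.tsum_eq]
        congr 1; ring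

lemma exists_dir (w : ℂ) : ∃ ζ : ℂ, ‖ζ‖ = 1 ∧ w = ‖w‖ * ζ := by
  by_cases h : w = 0
  · exact ⟨1, by simp, by simp [h]⟩
  · refine ⟨w / ‖w‖, ?_, ?_⟩
    · simp [h]
    · have : (‖w‖ : ℂ) ≠ 0 := by simpa using h
      field_simp

/-- Weak type estimate. -/
lemma weak_type {X : Type*} [MeasurableSpace X] (ν : Measure X) {ι : Type*} (Φ : ι → X → ℂ)
    (hΦ : ∀ i x, ‖Φ i x‖ < 1) {M : ℝ} (hM0 : 0 ≤ M)
    (hM : ∀ ζ : ℂ, ‖ζ‖ = 1 → ∀ h : ℝ, 0 < h →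
      ν {x | ∃ i, ‖Φ i x - ζ‖ ≤ h} ≤ ENNReal.ofReal (M * h))
    {g : ℝ → ENNReal} (hg : Measurable g) (hgi : ∫⁻ θ, g θ ∂circM ≠ ⊤) {t : ℝ} (ht : 0 < t) :
    ν {x | ∃ i, ENNReal.ofReal t < ∫⁻ θ, ENNReal.ofReal (poisK (Φ i x) θ) * g θ ∂circM} ≤
      ENNReal.ofReal (320 * M / t) * ∫⁻ θ, g θ ∂circM := by
  set E := {x | ∃ i, ENNReal.ofReal t < ∫⁻ θ, ENNReal.ofReal (poisK (Φ i x) θ) * g θ ∂circM}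
  set A := t / 64 with hA
  have hA0 : 0 < A := by positivity
  have h1 : ∀ x : X, ∃ p : ℂ × ℝ, x ∈ E → ‖p.1‖ = 1 ∧ 0 < p.2 ∧ (∃ i, ‖Φ i x - p.1‖ ≤ p.2) ∧
      ENNReal.ofReal (A * p.2) < ∫⁻ θ in eC ⁻¹' Metric.closedBall p.1 p.2, g θ ∂circM := by
    intro x
    by_cases hx : x ∈ E
    swap
    · exact ⟨(0, 0), fun h => absurd h hx⟩
    obtain ⟨i, hi⟩ := hx
    obtain ⟨ζ, hζ, hwζ⟩ := exists_dir (Φ i x)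
    have hw := hΦ i x
    have : ∃ k : ℕ, ENNReal.ofReal (A * (2 ^ k * (1 - ‖Φ i x‖))) <
        ∫⁻ θ in eC ⁻¹' Metric.closedBall ζ (2 ^ k * (1 - ‖Φ i x‖)), g θ ∂circM := by
      by_contra hcon
      push Not at hcon
      have := poisson_of_averages hw hζ hwζ hg hA0.le hcon
      rw [hA, mul_div_cancel₀ _ (by norm_num)] at this
      exact absurd (lt_of_lt_of_le hi this) (lt_irrefl _)
    obtain ⟨k, hk⟩ := this
    have hδ0 : 0 < 1 - ‖Φ i x‖ := by linarith
    refine ⟨(ζ, 2 ^ k * (1 - ‖Φ i x‖)), fun _ => ⟨hζ, by positivity, ⟨i, ?_⟩, hk⟩⟩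
    have : Φ i x - ζ = ((‖Φ i x‖ - 1 : ℝ) : ℂ) * ζ := by
      conv_lhs => rw [hwζ]
      push_cast; ring
    rw [this, norm_mul, hζ, mul_one, Complex.norm_real, Real.norm_eq_abs, abs_of_neg (by linarith)]
    have : (1:ℝ) ≤ 2 ^ k := one_le_pow₀ (by norm_num)
    simp only
    nlinarith
  choose p hp using h1
  set I := ∫⁻ θ, g θ ∂circM
  have hR : ∀ x ∈ E, (p x).2 ≤ I.toReal / A := by
    intro x hx
    have h2 := (hp x hx).2.2.2
    have h3 : ENNReal.ofReal (A * (p x).2) ≤ I := h2.le.trans (setLIntegral_le_lintegral _ _)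
    rw [ENNReal.ofReal_le_iff_le_toReal hgi] at h3
    rw [le_div_iff₀ hA0]; linarith
  obtain ⟨u, huE, hdis, hcov⟩ := Vitali.exists_disjoint_subfamily_covering_enlargement_closedBall
    E (fun x => (p x).1) (fun x => (p x).2) (I.toReal / A) hR 5 (by norm_num)
  have hcount : u.Countable := hdis.countable_of_nonempty_interior fun x hx => by
    refine Set.Nonempty.mono Metric.ball_subset_interior_closedBall ?_
    exact ⟨(p x).1, Metric.mem_ball_self (hp x (huE hx)).2.1⟩
  have hsub : E ⊆ ⋃ b ∈ u, {x | ∃ i, ‖Φ i x - (p b).1‖ ≤ 5 * (p b).2} := by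
    intro x hx
    obtain ⟨b, hb, hsubb⟩ := hcov x hx
    obtain ⟨i, hi⟩ := (hp x hx).2.2.1
    refine mem_iUnion₂.2 ⟨b, hb, i, ?_⟩
    have : Φ i x ∈ Metric.closedBall (p x).1 (p x).2 := by simpa [dist_eq_norm] using hi
    simpa [dist_eq_norm] using hsubb this
  have hms : ∀ b : X, MeasurableSet (eC ⁻¹' Metric.closedBall (p b).1 (p b).2) := fun b =>
    continuous_eC.measurable measurableSet_closedBall
  have := hcount.to_subtype
  calc ν E ≤ ν (⋃ b ∈ u, {x | ∃ i, ‖Φ i x - (p b).1‖ ≤ 5 * (p b).2}) := measure_mono hsub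
    _ ≤ ∑' b : u, ν {x | ∃ i, ‖Φ i x - (p b).1‖ ≤ 5 * (p b).2} := measure_biUnion_le _ hcount _
    _ ≤ ∑' b : u, ENNReal.ofReal (320 * M / t) *
        ∫⁻ θ in eC ⁻¹' Metric.closedBall (p b).1 (p b).2, g θ ∂circM := by
        refine ENNReal.tsum_le_tsum fun b => ?_
        obtain ⟨q1, q2, -, q4⟩ := hp b (huE b.2)
        refine (hM _ q1 _ (by positivity)).trans ?_
        refine le_trans (le_of_eq ?_) (mul_le_mul_right q4.le _)
        rw [← ENNReal.ofReal_mul (by positivity)]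
        congr 1
        rw [hA]; field_simp; ring
    _ = ENNReal.ofReal (320 * M / t) *
        ∫⁻ θ in ⋃ b : u, eC ⁻¹' Metric.closedBall (p b).1 (p b).2, g θ ∂circM := by
        rw [ENNReal.tsum_mul_left, lintegral_iUnion (s := fun b : u => eC ⁻¹' Metric.closedBall (p b).1 (p b).2) (fun b => hms b)]
        intro a b hab
        exact (hdis a.2 b.2 (fun h => hab (Subtype.ext h))).preimage _
    _ ≤ _ := mul_le_mul_right (setLIntegral_le_lintegral _ _) _

/-- The Carleson embedding theorem, in a maximal form. -/
theorem carleson_embedding {X : Type*} [MeasurableSpace X] (ν : Measure X) {ι : Type*}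
    (Φ : ι → X → ℂ) (hΦ : ∀ i x, ‖Φ i x‖ < 1) {M : ℝ} (hM0 : 0 ≤ M)
    (hM : ∀ ζ : ℂ, ‖ζ‖ = 1 → ∀ h : ℝ, 0 < h →
      ν {x | ∃ i, ‖Φ i x - ζ‖ ≤ h} ≤ ENNReal.ofReal (M * h))
    {f : ℂ → ℂ} (hf : DiffContOnCl ℂ f (Metric.ball 0 1)) {F : X → ℝ} (hF0 : ∀ x, 0 ≤ F x)
    (hFm : AEMeasurable F ν) (hF : ∀ x t, 0 < t → t < F x → ∃ i, t < ‖f (Φ i x)‖) :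
    ∫⁻ x, ENNReal.ofReal (F x ^ 2) ∂ν ≤
      ENNReal.ofReal (2560 * M) * ∫⁻ θ, ‖f (eC θ)‖ₑ ^ 2 ∂circM := by
  have hpi : (3:ℝ) < Real.pi := Real.pi_gt_three
  have hgc : Continuous fun θ => f (eC θ) := by
    have h := hf.continuousOn
    rw [closure_ball _ one_ne_zero] at h
    exact h.comp_continuous continuous_eC fun θ => by simp
  set g : ℝ → ℝ := fun θ => ‖f (eC θ)‖ with hg
  have hgm : Measurable g := hgc.norm.measurable
  have hjm : Measurable fun q : ℝ × ℝ => (({q : ℝ × ℝ | q.1 / 2 < g q.2}).indicator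
      (fun q => ENNReal.ofReal (g q.2))) q :=
    (hgm.comp measurable_snd).ennreal_ofReal.indicator
      (measurableSet_lt (by fun_prop) (hgm.comp measurable_snd))
  have hgi : ∫⁻ θ, ENNReal.ofReal (g θ) ∂circM ≠ ⊤ := by
    have : Integrable g circM := (hgc.norm.integrableOn_Icc (a := 0) (b := 2 * Real.pi)).mono_set
      Ioc_subset_Icc_self
    exact this.lintegral_lt_top.ne
  have key : ∀ t : ℝ, 0 < t → ν {x | t < F x} * ENNReal.ofReal t ≤
      ENNReal.ofReal (640 * M) *
        ∫⁻ θ, ({q : ℝ × ℝ | q.1 / 2 < g q.2}).indicator (fun q => ENNReal.ofReal (g q.2)) (t, θ)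
          ∂circM := by
    intro t ht
    set G : ℝ → ENNReal := fun θ =>
      ({q : ℝ × ℝ | q.1 / 2 < g q.2}).indicator (fun q => ENNReal.ofReal (g q.2)) (t, θ) with hG
    have hGm : Measurable G := hjm.comp measurable_prodMk_left
    have hGle : ∀ θ, G θ ≤ ENNReal.ofReal (g θ) := fun θ => by
      simp only [hG]; exact indicator_le_self _ (fun q : ℝ × ℝ => ENNReal.ofReal (g q.2)) (t, θ)
    have hGi : ∫⁻ θ, G θ ∂circM ≠ ⊤ := ne_top_of_le_ne_top hgi (lintegral_mono hGle)
    have hgG : ∀ θ, ENNReal.ofReal (g θ) ≤ ENNReal.ofReal (t / 2) + G θ := by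
      intro θ
      by_cases hc : t / 2 < g θ
      · refine le_trans (le_of_eq ?_) le_add_self
        simp only [hG]
        rw [indicator_of_mem (by simpa using hc)]
      · exact (ENNReal.ofReal_le_ofReal (not_lt.1 hc)).trans le_self_add
    have hsub : {x | t < F x} ⊆
        {x | ∃ i, ENNReal.ofReal t < ∫⁻ θ, ENNReal.ofReal (poisK (Φ i x) θ) * G θ ∂circM} := by
      intro x hx
      obtain ⟨i, hi⟩ := hF x t ht hx
      refine ⟨i, ?_⟩
      by_contra hcon
      have hcon := not_lt.1 hcon
      have hw := hΦ i x
      have hb := poisson_bound hf hw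
      have h2 : ∫⁻ θ, ENNReal.ofReal (poisK (Φ i x) θ) * ‖f (eC θ)‖ₑ ∂circM ≤
          ENNReal.ofReal (t / 2) * ENNReal.ofReal (2 * Real.pi) + ENNReal.ofReal t := by
        calc ∫⁻ θ, ENNReal.ofReal (poisK (Φ i x) θ) * ‖f (eC θ)‖ₑ ∂circM
            ≤ ∫⁻ θ, (ENNReal.ofReal (t / 2) * ENNReal.ofReal (poisK (Φ i x) θ) +
              ENNReal.ofReal (poisK (Φ i x) θ) * G θ) ∂circM := by
              refine lintegral_mono fun θ => ?_
              rw [← ofReal_norm]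
              refine (mul_le_mul_right (hgG θ) _).trans (le_of_eq ?_)
              rw [mul_add, mul_comm (ENNReal.ofReal (t / 2))]
          _ = ENNReal.ofReal (t / 2) * ENNReal.ofReal (2 * Real.pi) +
              ∫⁻ θ, ENNReal.ofReal (poisK (Φ i x) θ) * G θ ∂circM := by
              rw [lintegral_add_left, lintegral_const_mul, lint_poisK hw]
              · exact (continuous_poisK hw).measurable.ennreal_ofReal
              · exact (continuous_poisK hw).measurable.ennreal_ofReal.const_mul _
          _ ≤ _ := by gcongr
      have h3 := hb.trans h2
      rw [← ofReal_norm, ← ENNReal.ofReal_mul (by positivity), ← ENNReal.ofReal_mul (by positivity),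
        ← ENNReal.ofReal_add (by positivity) (by positivity),
        ENNReal.ofReal_le_ofReal_iff (by positivity)] at h3
      nlinarith
    have hwt := weak_type ν Φ hΦ hM0 hM hGm hGi ht
    calc ν {x | t < F x} * ENNReal.ofReal t
        ≤ (ENNReal.ofReal (320 * M / t) * ∫⁻ θ, G θ ∂circM) * ENNReal.ofReal t := by
          gcongr; exact (measure_mono hsub).trans hwt
      _ = ENNReal.ofReal (320 * M) * ∫⁻ θ, G θ ∂circM := by
          rw [mul_right_comm, ← ENNReal.ofReal_mul (by positivity), div_mul_cancel₀ _ ht.ne']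
      _ ≤ _ := by gcongr; norm_num
  have hlc := lintegral_rpow_eq_lintegral_meas_lt_mul ν (ae_of_all _ hF0) hFm (p := 2) (by norm_num)
  have e1 : ∀ x, F x ^ (2:ℝ) = F x ^ 2 := fun x => by norm_cast
  have e2 : ∀ t : ℝ, t ^ ((2:ℝ) - 1) = t := fun t => by norm_num
  simp_rw [e1, e2] at hlc
  rw [hlc]
  have hin : ∀ θ, ∫⁻ t in Ioi (0:ℝ), ({q : ℝ × ℝ | q.1 / 2 < g q.2}).indicator
      (fun q => ENNReal.ofReal (g q.2)) (t, θ) = 2 * ‖f (eC θ)‖ₑ ^ 2 := by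
    intro θ
    have : (fun t : ℝ => ({q : ℝ × ℝ | q.1 / 2 < g q.2}).indicator
        (fun q => ENNReal.ofReal (g q.2)) (t, θ)) =
        (Iio (2 * g θ)).indicator (fun _ => ENNReal.ofReal (g θ)) := by
      funext t
      by_cases hc : t / 2 < g θ
      · rw [indicator_of_mem (by simpa using hc), indicator_of_mem (by simp; linarith)]
      · rw [indicator_of_notMem (by simpa using hc), indicator_of_notMem (by simp; linarith)]
    rw [this, lintegral_indicator measurableSet_Iio, lintegral_const,
      Measure.restrict_restrict measurableSet_Iio, Measure.restrict_apply_univ]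
    rw [inter_comm, Ioi_inter_Iio, Real.volume_Ioo, enorm_sq_eq, sub_zero,
      ← ENNReal.ofReal_mul (norm_nonneg _)]
    rw [show (2:ENNReal) = ENNReal.ofReal 2 by simp, ← ENNReal.ofReal_mul (by norm_num)]
    congr 1; simp only [hg]; ring
  calc ENNReal.ofReal 2 * ∫⁻ t in Ioi (0:ℝ), ν {x | t < F x} * ENNReal.ofReal t
      ≤ ENNReal.ofReal 2 * ∫⁻ t in Ioi (0:ℝ), ENNReal.ofReal (640 * M) *
        ∫⁻ θ, ({q : ℝ × ℝ | q.1 / 2 < g q.2}).indicator (fun q => ENNReal.ofReal (g q.2)) (t, θ)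
          ∂circM := by
        exact mul_le_mul_right (setLIntegral_mono' measurableSet_Ioi fun t ht => key t ht) _
    _ = ENNReal.ofReal 2 * (ENNReal.ofReal (640 * M) * ∫⁻ θ, ∫⁻ t in Ioi (0:ℝ),
        ({q : ℝ × ℝ | q.1 / 2 < g q.2}).indicator (fun q => ENNReal.ofReal (g q.2)) (t, θ)
          ∂volume ∂circM) := by
        rw [lintegral_const_mul' _ _ ENNReal.ofReal_ne_top, lintegral_lintegral_swap]
        exact hjm.aemeasurable
    _ = _ := by
        simp_rw [hin]
        rw [lintegral_const_mul' _ _ (by norm_num), ← mul_assoc, ← mul_assoc,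
          ← ENNReal.ofReal_mul (by norm_num)]
        rw [show (2:ENNReal) = ENNReal.ofReal 2 by simp, ← ENNReal.ofReal_mul (by positivity)]
        congr 2; ring

/-! ### Part 3: maximal inequality and boundary values -/

lemma arc_measure {ζ : ℂ} (hζ : ‖ζ‖ = 1) {h : ℝ} (hh : 0 < h) :
    circM {θ | ‖eC θ - ζ‖ ≤ h} ≤ ENNReal.ofReal (8 * Real.pi * h) := by
  have hpi : (3:ℝ) < Real.pi := Real.pi_gt_three
  rcases le_or_gt 1 h with h1 | h1
  · refine (measure_mono (subset_univ _)).trans ?_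
    simp only [circM, Measure.restrict_apply_univ, Real.volume_Ioc]
    refine ENNReal.ofReal_le_ofReal ?_
    nlinarith
  · set w : ℂ := ((1 - h : ℝ) : ℂ) * ζ with hw
    have hwn : ‖w‖ = 1 - h := by
      rw [hw, norm_mul, hζ, mul_one, Complex.norm_real, Real.norm_eq_abs, abs_of_pos (by linarith)]
    have hw1 : ‖w‖ < 1 := by linarith
    have key : ∀ θ ∈ {θ | ‖eC θ - ζ‖ ≤ h}, ENNReal.ofReal (1 / (4 * h)) ≤ ENNReal.ofReal (poisK w θ) := by
      intro θ hθ
      refine ENNReal.ofReal_le_ofReal ?_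
      have hd := sub_pos_of_disk hw1 θ
      have h2 : ‖eC θ - w‖ ≤ 2 * h := by
        have e : eC θ - w = (eC θ - ζ) + (h : ℂ) * ζ := by rw [hw]; push_cast; ring
        rw [e]
        refine (norm_add_le _ _).trans ?_
        rw [norm_mul, hζ, mul_one, Complex.norm_real, Real.norm_eq_abs, abs_of_pos hh]
        have : ‖eC θ - ζ‖ ≤ h := hθ
        linarith
      unfold poisK
      rw [div_le_div_iff₀ (by positivity) (by positivity), hwn]
      have h3 : ‖eC θ - w‖ ^ 2 ≤ (2 * h) ^ 2 := pow_le_pow_left₀ hd.le h2 2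
      nlinarith
    have hms : MeasurableSet {θ | ‖eC θ - ζ‖ ≤ h} := by
      have := continuous_eC
      exact measurableSet_le (by fun_prop) measurable_const
    have h4 : ENNReal.ofReal (1 / (4 * h)) * circM {θ | ‖eC θ - ζ‖ ≤ h} ≤
        ENNReal.ofReal (2 * Real.pi) := by
      rw [← lint_poisK hw1]
      rw [← setLIntegral_const]
      exact (setLIntegral_mono' hms key).trans (setLIntegral_le_lintegral _ _)
    calc circM {θ | ‖eC θ - ζ‖ ≤ h} = ENNReal.ofReal (4 * h) *
          (ENNReal.ofReal (1 / (4 * h)) * circM {θ | ‖eC θ - ζ‖ ≤ h}) := by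
          rw [← mul_assoc, ← ENNReal.ofReal_mul (by positivity), mul_one_div_cancel (by positivity)]
          simp
      _ ≤ ENNReal.ofReal (4 * h) * ENNReal.ofReal (2 * Real.pi) := by gcongr
      _ = _ := by rw [← ENNReal.ofReal_mul (by positivity)]; congr 1; ring

/-- Rationals in `[0,1)`. -/
abbrev Q01 : Type := {q : ℚ // 0 ≤ q ∧ q < 1}

lemma Q01.nonneg (q : Q01) : (0:ℝ) ≤ ((q : ℚ) : ℝ) := by exact_mod_cast q.2.1
lemma Q01.lt_one (q : Q01) : ((q : ℚ) : ℝ) < 1 := by exact_mod_cast q.2.2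

/-- The radial maximal function. -/
def radMax (f : ℂ → ℂ) (θ : ℝ) : ENNReal := ⨆ q : Q01, ‖f ((((q : ℚ) : ℝ) : ℂ) * eC θ)‖ₑ

lemma measurable_radMax {f : ℂ → ℂ} (hf : DifferentiableOn ℂ f unitDisk) : Measurable (radMax f) := by
  unfold radMax
  refine Measurable.iSup fun q => ?_
  exact (cont_slice hf q.nonneg q.lt_one).measurable.enorm

lemma cont_rad {f : ℂ → ℂ} (hf : DifferentiableOn ℂ f unitDisk) (θ : ℝ) :
    ContinuousOn (fun r : ℝ => f ((r : ℂ) * eC θ)) (Ioo (-1) 1) := by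
  refine hf.continuousOn.comp (by fun_prop) fun r hr => ?_
  rw [mem_disk_iff, norm_mul, norm_eC, mul_one, Complex.norm_real, Real.norm_eq_abs]
  exact abs_lt.2 hr

lemma le_radMax {f : ℂ → ℂ} (hf : DifferentiableOn ℂ f unitDisk) {r : ℝ} (h0 : 0 ≤ r) (h1 : r < 1)
    (θ : ℝ) : ‖f ((r : ℂ) * eC θ)‖ₑ ≤ radMax f θ := by
  by_contra hcon
  push Not at hcon
  have hc : ContinuousAt (fun r : ℝ => ‖f ((r : ℂ) * eC θ)‖ₑ) r :=
    ((cont_rad hf θ).continuousAt (Ioo_mem_nhds (by linarith) h1)).enorm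
  have hev := hc.eventually (lt_mem_nhds hcon)
  obtain ⟨ε, hε, hball⟩ := Metric.eventually_nhds_iff.1 hev
  obtain ⟨q, hq1, hq2⟩ := exists_rat_btwn (show r < min 1 (r + ε) by
    rw [lt_min_iff]; exact ⟨h1, by linarith⟩)
  rw [lt_min_iff] at hq2
  have h := hball (y := (q:ℝ)) (by rw [Real.dist_eq, abs_of_pos (by linarith)]; linarith)
  have h3 : ‖f ((((q : ℚ) : ℝ) : ℂ) * eC θ)‖ₑ ≤ radMax f θ :=
    le_iSup (fun q : Q01 => ‖f ((((q : ℚ) : ℝ) : ℂ) * eC θ)‖ₑ)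
      ⟨q, by exact_mod_cast h0.trans hq1.le, by exact_mod_cast hq2.1⟩
  exact absurd (lt_of_lt_of_le h h3) (lt_irrefl _)

lemma arc_window {ζ : ℂ} (hζ : ‖ζ‖ = 1) {h : ℝ} (hh : 0 < h) :
    circM {θ | ∃ q : Q01, ‖(((q : ℚ) : ℝ) : ℂ) * eC θ - ζ‖ ≤ h} ≤
      ENNReal.ofReal (16 * Real.pi * h) := by
  refine (measure_mono ?_).trans ((arc_measure hζ (h := 2 * h) (by linarith)).trans
    (le_of_eq (by congr 1; ring)))
  rintro θ ⟨q, hq⟩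
  have hn : ‖(((q : ℚ) : ℝ) : ℂ) * eC θ‖ = ((q : ℚ) : ℝ) := by
    rw [norm_mul, norm_eC, mul_one, Complex.norm_real, Real.norm_eq_abs, abs_of_nonneg q.nonneg]
  have h1 : 1 - ((q : ℚ) : ℝ) ≤ h := by
    have := norm_sub_norm_le ζ ((((q : ℚ) : ℝ) : ℂ) * eC θ)
    rw [hn, hζ, norm_sub_rev] at this
    linarith
  have e : eC θ - ζ = ((1 - ((q : ℚ) : ℝ) : ℝ) : ℂ) * eC θ + ((((q : ℚ) : ℝ) : ℂ) * eC θ - ζ) := by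
    push_cast; ring
  show ‖eC θ - ζ‖ ≤ 2 * h
  rw [e]
  refine (norm_add_le _ _).trans ?_
  rw [norm_mul, norm_eC, mul_one, Complex.norm_real, Real.norm_eq_abs,
    abs_of_nonneg (by linarith [q.lt_one])]
  linarith

lemma dilate_mem {s : ℝ} (h0 : 0 ≤ s) (h1 : s < 1) {z : ℂ} (hz : ‖z‖ ≤ 1) :
    (s : ℂ) * z ∈ unitDisk := by
  rw [mem_disk_iff, norm_mul, Complex.norm_real, Real.norm_eq_abs, abs_of_nonneg h0]
  nlinarith [norm_nonneg z]

lemma dilate_dcoc {f : ℂ → ℂ} (hf : DifferentiableOn ℂ f unitDisk) {s : ℝ} (h0 : 0 ≤ s)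
    (h1 : s < 1) : DiffContOnCl ℂ (fun z => f ((s : ℂ) * z)) (Metric.ball 0 1) := by
  have hd : ∀ z ∈ Metric.closedBall (0:ℂ) 1, DifferentiableAt ℂ (fun z => f ((s : ℂ) * z)) z := by
    intro z hz
    have hm : (s : ℂ) * z ∈ unitDisk := dilate_mem h0 h1 (by simpa using hz)
    exact DifferentiableAt.comp z (g := f) ((hf.differentiableAt (isOpen_unitDisk.mem_nhds hm)))
      (by fun_prop)
  refine ⟨fun z hz => (hd z (Metric.ball_subset_closedBall hz)).differentiableWithinAt, ?_⟩
  rw [closure_ball _ one_ne_zero]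
  exact fun z hz => (hd z hz).continuousAt.continuousWithinAt

lemma max_ineq {f : ℂ → ℂ} (hf : MemH2 f) :
    ∫⁻ θ, radMax f θ ^ 2 ∂circM ≤
      ENNReal.ofReal (2560 * (16 * Real.pi)) * (ENNReal.ofReal (2 * Real.pi) *
        ENNReal.ofReal (h2NormSq f)) := by
  have hpi : (0:ℝ) < Real.pi := Real.pi_pos
  -- dilations
  set s : ℕ → ℝ := fun k => 1 - 1 / ((k:ℝ) + 1) with hs
  have hs0 : ∀ k, 0 ≤ s k := fun k => by
    simp only [hs]
    have : 1 / ((k:ℝ) + 1) ≤ 1 := by rw [div_le_one (by positivity)]; linarith [k.cast_nonneg (α := ℝ)]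
    linarith
  have hs1 : ∀ k, s k < 1 := fun k => by
    simp only [hs]
    have : 0 < 1 / ((k:ℝ) + 1) := by positivity
    linarith
  have hst : Tendsto s atTop (nhds 1) := by
    have := tendsto_one_div_add_atTop_nhds_zero_nat (𝕜 := ℝ)
    simpa [hs] using this.const_sub 1
  have hdil : ∀ k, DifferentiableOn ℂ (fun z => f ((s k : ℂ) * z)) unitDisk := fun k =>
    (dilate_dcoc hf.1 (hs0 k) (hs1 k)).differentiableOn
  have hfin : ∀ k θ, radMax (fun z => f ((s k : ℂ) * z)) θ ≠ ⊤ := by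
    intro k θ
    have hcont := (dilate_dcoc hf.1 (hs0 k) (hs1 k)).continuousOn
    rw [closure_ball _ one_ne_zero] at hcont
    obtain ⟨B, hB⟩ := (isCompact_closedBall (0:ℂ) 1).exists_bound_of_continuousOn hcont
    refine ne_top_of_le_ne_top (ENNReal.ofReal_ne_top (r := B)) (iSup_le fun q => ?_)
    rw [← ofReal_norm]
    refine ENNReal.ofReal_le_ofReal (hB _ ?_)
    exact Metric.ball_subset_closedBall (smul_eC_mem q.nonneg q.lt_one θ)
  have hk : ∀ k, ∫⁻ θ, radMax (fun z => f ((s k : ℂ) * z)) θ ^ 2 ∂circM ≤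
      ENNReal.ofReal (2560 * (16 * Real.pi)) * (ENNReal.ofReal (2 * Real.pi) *
        ENNReal.ofReal (h2NormSq f)) := by
    intro k
    have h := carleson_embedding circM (fun (q : Q01) θ => (((q : ℚ) : ℝ) : ℂ) * eC θ)
      (fun q θ => mem_disk_iff.1 (smul_eC_mem q.nonneg q.lt_one θ)) (M := 16 * Real.pi)
      (by positivity) (fun ζ hζ h hh => arc_window hζ hh) (dilate_dcoc hf.1 (hs0 k) (hs1 k))
      (F := fun θ => (radMax (fun z => f ((s k : ℂ) * z)) θ).toReal) (fun θ => ENNReal.toReal_nonneg)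
      (measurable_radMax (hdil k)).ennreal_toReal.aemeasurable
      (fun θ t ht h => by
        rw [← ENNReal.ofReal_lt_iff_lt_toReal ht.le (hfin k θ)] at h
        obtain ⟨q, hq⟩ := lt_iSup_iff.1 h
        refine ⟨q, ?_⟩
        rw [← ofReal_norm] at hq
        exact (ENNReal.ofReal_lt_ofReal_iff_of_nonneg ht.le).1 hq)
    refine le_trans (le_of_eq ?_) (h.trans ?_)
    · refine lintegral_congr fun θ => ?_
      rw [ENNReal.ofReal_pow ENNReal.toReal_nonneg, ENNReal.ofReal_toReal (hfin k θ)]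
    · gcongr
      exact h2_slice_le hf (hs0 k) (hs1 k)
  have hle : ∀ θ, radMax f θ ^ 2 ≤
      liminf (fun k => radMax (fun z => f ((s k : ℂ) * z)) θ ^ 2) atTop := by
    intro θ
    have h1 : ∀ q : Q01, ‖f ((((q : ℚ) : ℝ) : ℂ) * eC θ)‖ₑ ^ 2 ≤
        liminf (fun k => radMax (fun z => f ((s k : ℂ) * z)) θ ^ 2) atTop := by
      intro q
      have hc : ContinuousAt (fun r : ℝ => ‖f ((r : ℂ) * eC θ)‖ₑ) ((q : ℚ) : ℝ) :=
        ((cont_rad hf.1 θ).continuousAt (Ioo_mem_nhds (by linarith [q.nonneg]) q.lt_one)).enorm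
      have ht : Tendsto (fun k => s k * ((q : ℚ) : ℝ)) atTop (nhds ((q : ℚ) : ℝ)) := by
        simpa using hst.mul_const ((q : ℚ) : ℝ)
      have h2 := ((ENNReal.continuous_pow 2).tendsto _).comp (hc.tendsto.comp ht)
      rw [show ‖f ((((q : ℚ) : ℝ) : ℂ) * eC θ)‖ₑ ^ 2 = _ from h2.liminf_eq.symm]
      refine liminf_le_liminf (Eventually.of_forall fun k => ?_)
      have h3 : ‖f ((s k : ℂ) * ((((q : ℚ) : ℝ) : ℂ) * eC θ))‖ₑ ≤
          radMax (fun z => f ((s k : ℂ) * z)) θ :=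
        le_iSup (fun q : Q01 => ‖f ((s k : ℂ) * ((((q : ℚ) : ℝ) : ℂ) * eC θ))‖ₑ) q
      have h4 : ((s k * ((q : ℚ) : ℝ) : ℝ) : ℂ) * eC θ = (s k : ℂ) * ((((q : ℚ) : ℝ) : ℂ) * eC θ) := by
        push_cast; ring
      simp only [Function.comp]
      rw [h4]
      gcongr
    unfold radMax
    have : Nonempty Q01 := ⟨⟨0, le_rfl, zero_lt_one⟩⟩
    rw [ENNReal.iSup_pow]
    exact iSup_le h1
  calc ∫⁻ θ, radMax f θ ^ 2 ∂circM
      ≤ ∫⁻ θ, liminf (fun k => radMax (fun z => f ((s k : ℂ) * z)) θ ^ 2) atTop ∂circM :=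
        lintegral_mono hle
    _ ≤ liminf (fun k => ∫⁻ θ, radMax (fun z => f ((s k : ℂ) * z)) θ ^ 2 ∂circM) atTop :=
        lintegral_liminf_le fun k => (measurable_radMax (hdil k)).pow_const 2
    _ ≤ _ := by
        refine liminf_le_of_le (by isBoundedDefault) fun b hb => ?_
        obtain ⟨k, hk'⟩ := hb.exists
        exact hk'.trans (hk k)

/-- Taylor polynomials. -/
def tayP (f : ℂ → ℂ) (N : ℕ) : Polynomial ℂ :=
  ∑ k ∈ Finset.range N, Polynomial.monomial k (taylorCoeff f k)

lemma tayP_coeff (f : ℂ → ℂ) (N k : ℕ) :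
    (tayP f N).coeff k = if k < N then taylorCoeff f k else 0 := by
  simp [tayP, Polynomial.coeff_monomial]

lemma tayP_tendsto {f : ℂ → ℂ} (hf : DifferentiableOn ℂ f unitDisk) {z : ℂ} (hz : z ∈ unitDisk) :
    Tendsto (fun N => (tayP f N).eval z) atTop (nhds (f z)) := by
  have h := (taylor_hasSum hf hz).tendsto_sum_nat
  refine h.congr fun N => ?_
  simp [tayP, Polynomial.eval_finsetSum]

lemma tayP_norm {f : ℂ → ℂ} (hf : MemH2 f) (N : ℕ) :
    h2NormSq (fun z => (tayP f N).eval z) ≤ h2NormSq f := by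
  unfold h2NormSq
  refine Summable.tsum_le_tsum (fun k => ?_) (memH2_poly _).2 hf.2
  rw [taylorCoeff_poly, tayP_coeff]
  split_ifs
  · exact le_rfl
  · simp

lemma tayP_sub {f : ℂ → ℂ} (hf : MemH2 f) (N : ℕ) :
    MemH2 (fun z => f z - (tayP f N).eval z) ∧
      h2NormSq (fun z => f z - (tayP f N).eval z) = ∑' k, ‖taylorCoeff f (k + N)‖ ^ 2 := by
  have hd : DifferentiableOn ℂ (fun z => f z - (tayP f N).eval z) unitDisk :=
    hf.1.sub (tayP f N).differentiable.differentiableOn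
  have hk : ∀ k, taylorCoeff (fun z => f z - (tayP f N).eval z) k =
      if k < N then 0 else taylorCoeff f k := by
    intro k
    rw [taylor_unique hd (fun k => taylorCoeff f k - (tayP f N).coeff k)]
    · rw [tayP_coeff]; split_ifs <;> simp
    · intro z hz
      have h1 := (taylor_hasSum hf.1 hz)
      have h2 := taylor_hasSum (memH2_poly (tayP f N)).1 hz
      simp only [taylorCoeff_poly] at h2
      simpa [sub_mul] using h1.sub h2
  have hsum : Summable fun k => ‖taylorCoeff (fun z => f z - (tayP f N).eval z) k‖ ^ 2 := by
    refine Summable.of_nonneg_of_le (fun _ => by positivity) (fun k => ?_) hf.2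
    rw [hk]; split_ifs
    · simp
    · exact le_rfl
  refine ⟨⟨hd, hsum⟩, ?_⟩
  unfold h2NormSq
  rw [← hsum.sum_add_tsum_nat_add N, Finset.sum_eq_zero, zero_add]
  · congr 1; funext k; rw [hk, if_neg (by omega)]
  · intro k hkk; rw [hk, if_pos (Finset.mem_range.1 hkk)]; simp

lemma radial_limit_exists {f : ℂ → ℂ} (hf : MemH2 f) :
    ∀ᵐ θ ∂circM, ∃ L, Tendsto (fun r : ℝ => f ((r : ℂ) * eC θ)) (nhdsWithin 1 (Iio 1)) (nhds L) := by
  set g : ℕ → ℂ → ℂ := fun N z => f z - (tayP f N).eval z with hg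
  have hgm : ∀ N, Measurable (radMax (g N)) := fun N => measurable_radMax (tayP_sub hf N).1.1
  have h0 : Tendsto (fun N => h2NormSq (g N)) atTop (nhds 0) := by
    have e : (fun N => h2NormSq (g N)) = fun N => ∑' k, ‖taylorCoeff f (k + N)‖ ^ 2 := by
      funext N; exact (tayP_sub hf N).2
    rw [e]
    exact tendsto_sum_nat_add fun k => ‖taylorCoeff f k‖ ^ 2
  have h1 : ∫⁻ θ, liminf (fun N => radMax (g N) θ ^ 2) atTop ∂circM = 0 := by
    refine le_antisymm ?_ zero_le
    refine (lintegral_liminf_le fun N => (hgm N).pow_const 2).trans ?_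
    have h2 : Tendsto (fun N => ENNReal.ofReal (2560 * (16 * Real.pi)) *
        (ENNReal.ofReal (2 * Real.pi) * ENNReal.ofReal (h2NormSq (g N)))) atTop (nhds 0) := by
      have h3 : Tendsto (fun N => ENNReal.ofReal (h2NormSq (g N))) atTop (nhds 0) := by
        simpa using ENNReal.tendsto_ofReal h0
      have h4 := ENNReal.Tendsto.const_mul (a := ENNReal.ofReal (2 * Real.pi)) h3
        (Or.inr ENNReal.ofReal_ne_top)
      have h5 := ENNReal.Tendsto.const_mul (a := ENNReal.ofReal (2560 * (16 * Real.pi))) h4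
        (Or.inr ENNReal.ofReal_ne_top)
      simpa using h5
    rw [← h2.liminf_eq]
    exact liminf_le_liminf (Eventually.of_forall fun N => max_ineq (tayP_sub hf N).1)
  rw [lintegral_eq_zero_iff (Measurable.liminf fun N => (hgm N).pow_const 2)] at h1
  filter_upwards [h1] with θ hθ
  have hex : ∀ ε : ℝ, 0 < ε → ∃ N, radMax (g N) θ < ENNReal.ofReal ε := by
    intro ε hε
    have hθ' : liminf (fun N => radMax (g N) θ ^ 2) atTop < ENNReal.ofReal ε ^ 2 := by
      rw [hθ]; exact ENNReal.pow_pos (ENNReal.ofReal_pos.2 hε) 2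
    have hfr : ∃ᶠ N in atTop, radMax (g N) θ ^ 2 < ENNReal.ofReal ε ^ 2 :=
      frequently_lt_of_liminf_lt (by isBoundedDefault) hθ'
    obtain ⟨N, hN⟩ := hfr.exists
    refine ⟨N, ?_⟩
    by_contra hc
    exact absurd hN (not_lt.2 (pow_le_pow_left' (not_lt.1 hc) 2))
  have hcau : Cauchy (Filter.map (fun r : ℝ => f ((r : ℂ) * eC θ)) (nhdsWithin 1 (Iio 1))) := by
    rw [Metric.cauchy_iff]
    refine ⟨inferInstance, fun ε hε => ?_⟩
    obtain ⟨N, hN⟩ := hex (ε / 4) (by positivity)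
    have hpc : Tendsto (fun r : ℝ => (tayP f N).eval ((r : ℂ) * eC θ)) (nhdsWithin 1 (Iio 1))
        (nhds ((tayP f N).eval (((1:ℝ) : ℂ) * eC θ))) := by
      have : Continuous (fun r : ℝ => (tayP f N).eval ((r : ℂ) * eC θ)) :=
        (tayP f N).continuous.comp (by fun_prop)
      exact (this.tendsto 1).mono_left nhdsWithin_le_nhds
    set L := (tayP f N).eval (((1:ℝ) : ℂ) * eC θ)
    have hev : ∀ᶠ r : ℝ in nhdsWithin 1 (Iio 1), ‖f ((r : ℂ) * eC θ) - L‖ < ε / 2 := by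
      filter_upwards [hpc (Metric.ball_mem_nhds L (show 0 < ε / 4 by positivity)),
        slice_ev (p := fun r => 0 ≤ r ∧ r < 1) fun r a b => ⟨a, b⟩] with r hr hr2
      have h6 : ‖g N ((r : ℂ) * eC θ)‖ₑ < ENNReal.ofReal (ε / 4) :=
        lt_of_le_of_lt (le_radMax (tayP_sub hf N).1.1 hr2.1 hr2.2 θ) hN
      rw [← ofReal_norm, ENNReal.ofReal_lt_ofReal_iff (by positivity)] at h6
      have h7 : ‖(tayP f N).eval ((r : ℂ) * eC θ) - L‖ < ε / 4 := by
        simpa [dist_eq_norm] using hr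
      have h8 : f ((r : ℂ) * eC θ) - L = g N ((r : ℂ) * eC θ) +
          ((tayP f N).eval ((r : ℂ) * eC θ) - L) := by simp only [hg]; ring
      rw [h8]
      refine lt_of_le_of_lt (norm_add_le _ _) (by linarith)
    refine ⟨_, image_mem_map hev, ?_⟩
    rintro x ⟨r, hr, rfl⟩ y ⟨r', hr', rfl⟩
    have hr : ‖f ((r : ℂ) * eC θ) - L‖ < ε / 2 := hr
    have hr' : ‖f ((r' : ℂ) * eC θ) - L‖ < ε / 2 := hr'
    have := dist_triangle_right (f ((r : ℂ) * eC θ)) (f ((r' : ℂ) * eC θ)) L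
    rw [dist_eq_norm _ L, dist_eq_norm _ L] at this
    linarith
  exact CompleteSpace.complete hcau

lemma bdryVal_eq {f : ℂ → ℂ} {ζ L : ℂ}
    (h : Tendsto (fun r : ℝ => f ((r : ℂ) * ζ)) (nhdsWithin 1 (Iio 1)) (nhds L)) :
    bdryVal f ζ = L := h.limUnder_eq

/-- Radial convergence at a point. -/
def RadAt (f : ℂ → ℂ) (ζ : ℂ) : Prop :=
  Tendsto (fun r : ℝ => f ((r : ℂ) * ζ)) (nhdsWithin 1 (Iio 1)) (nhds (bdryVal f ζ))

lemma h2_radial {f : ℂ → ℂ} (hf : MemH2 f) : ∀ᵐ θ ∂circM, RadAt f (eC θ) := by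
  filter_upwards [radial_limit_exists hf] with θ ⟨L, hL⟩
  unfold RadAt
  rwa [bdryVal_eq hL]

/-- A sequence of radii increasing to one. -/
def rseq (k : ℕ) : ℝ := 1 - 1 / ((k:ℝ) + 1)

lemma rseq_nonneg (k : ℕ) : 0 ≤ rseq k := by
  unfold rseq
  have : 1 / ((k:ℝ) + 1) ≤ 1 := by rw [div_le_one (by positivity)]; linarith [k.cast_nonneg (α := ℝ)]
  linarith

lemma rseq_lt (k : ℕ) : rseq k < 1 := by
  unfold rseq
  have : 0 < 1 / ((k:ℝ) + 1) := by positivity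
  linarith

lemma rseq_tendsto : Tendsto rseq atTop (nhdsWithin 1 (Iio 1)) := by
  refine tendsto_nhdsWithin_iff.2 ⟨?_, Eventually.of_forall fun k => rseq_lt k⟩
  have := tendsto_one_div_add_atTop_nhds_zero_nat (𝕜 := ℝ)
  have h2 := this.const_sub (1:ℝ)
  rw [sub_zero] at h2
  exact h2

lemma aemeas_bdry {f : ℂ → ℂ} (hf : DifferentiableOn ℂ f unitDisk)
    (hr : ∀ᵐ θ ∂circM, RadAt f (eC θ)) : AEMeasurable (fun θ => bdryVal f (eC θ)) circM := by
  refine aemeasurable_of_tendsto_metrizable_ae (f := fun k θ => f ((rseq k : ℂ) * eC θ)) atTop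
    (fun k => (cont_slice hf (rseq_nonneg k) (rseq_lt k)).measurable.aemeasurable) ?_
  filter_upwards [hr] with θ hθ
  exact hθ.comp rseq_tendsto

lemma bdry_le {f : ℂ → ℂ} (hf : MemH2 f) :
    ∫⁻ θ, ‖bdryVal f (eC θ)‖ₑ ^ 2 ∂circM ≤
      ENNReal.ofReal (2 * Real.pi) * ENNReal.ofReal (h2NormSq f) := by
  have h1 : ∫⁻ θ, ‖bdryVal f (eC θ)‖ₑ ^ 2 ∂circM =
      ∫⁻ θ, liminf (fun k => ‖f ((rseq k : ℂ) * eC θ)‖ₑ ^ 2) atTop ∂circM := by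
    refine lintegral_congr_ae ?_
    filter_upwards [h2_radial hf] with θ hθ
    have := ((ENNReal.continuous_pow 2).tendsto _).comp (hθ.comp rseq_tendsto).enorm
    exact this.liminf_eq.symm
  rw [h1]
  refine (lintegral_liminf_le fun k =>
    (cont_slice hf.1 (rseq_nonneg k) (rseq_lt k)).measurable.enorm.pow_const 2).trans ?_
  refine liminf_le_of_le (by isBoundedDefault) fun b hb => ?_
  obtain ⟨k, hk'⟩ := hb.exists
  exact hk'.trans (h2_slice_le hf (rseq_nonneg k) (rseq_lt k))

lemma bdry_ge {f : ℂ → ℂ} (hf : MemH2 f) {C : ℝ} (hC : 0 ≤ C)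
    (h : ∫⁻ θ, ‖bdryVal f (eC θ)‖ₑ ^ 2 ∂circM ≤
      ENNReal.ofReal (2 * Real.pi) * ENNReal.ofReal C) : h2NormSq f ≤ C := by
  have hlim : Tendsto (fun k => ∫⁻ θ, ‖f ((rseq k : ℂ) * eC θ)‖ₑ ^ 2 ∂circM) atTop
      (nhds (∫⁻ θ, ‖bdryVal f (eC θ)‖ₑ ^ 2 ∂circM)) := by
    refine tendsto_lintegral_of_dominated_convergence (fun θ => radMax f θ ^ 2)
      (fun k => (cont_slice hf.1 (rseq_nonneg k) (rseq_lt k)).measurable.enorm.pow_const 2)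
      (fun k => ae_of_all _ fun θ => ?_) ?_ ?_
    · exact pow_le_pow_left' (le_radMax hf.1 (rseq_nonneg k) (rseq_lt k) θ) 2
    · refine ne_top_of_le_ne_top ?_ (max_ineq hf)
      finiteness
    · filter_upwards [h2_radial hf] with θ hθ
      exact ((ENNReal.continuous_pow 2).tendsto _).comp (hθ.comp rseq_tendsto).enorm
  refine le_of_forall_pos_le_add fun ε hε => ?_
  refine (memH2_of_slice hf.1 (C := C + ε) (by positivity) ?_).2
  have hlt : ∫⁻ θ, ‖bdryVal f (eC θ)‖ₑ ^ 2 ∂circM <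
      ENNReal.ofReal (2 * Real.pi) * ENNReal.ofReal (C + ε) := by
    refine lt_of_le_of_lt h ?_
    rw [← ENNReal.ofReal_mul (by positivity), ← ENNReal.ofReal_mul (by positivity)]
    have : 0 < 2 * Real.pi := by positivity
    exact (ENNReal.ofReal_lt_ofReal_iff (by positivity)).2 (by nlinarith)
  have hev := hlim.eventually (gt_mem_nhds hlt)
  refine rseq_tendsto.frequently ?_
  exact (hev.mono fun k hk => hk.le).frequently

/-! ### Part 4: growth, divisibility, uniqueness of the decomposition -/

/-- The polynomial `a₁`. -/
def a1P {n : ℕ} (ξ : Fin n → ℂ) (m : Fin n → ℕ) : Polynomial ℂ :=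
  ∏ j, (Polynomial.X - Polynomial.C (ξ j)) ^ (m j)

lemma a1P_eval {n : ℕ} (ξ : Fin n → ℂ) (m : Fin n → ℕ) (z : ℂ) :
    (a1P ξ m).eval z = a1fun ξ m z := by
  simp [a1P, a1fun, Polynomial.eval_prod]

lemma a1P_monic {n : ℕ} (ξ : Fin n → ℂ) (m : Fin n → ℕ) : (a1P ξ m).Monic :=
  Polynomial.monic_prod_of_monic _ _ fun j _ => (Polynomial.monic_X_sub_C _).pow _

lemma a1P_natDegree {n : ℕ} (ξ : Fin n → ℂ) (m : Fin n → ℕ) :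
    (a1P ξ m).natDegree = ∑ j, m j := by
  unfold a1P
  rw [Polynomial.natDegree_prod_of_monic _ _ fun _ _ => (Polynomial.monic_X_sub_C _).pow _]
  simp

lemma a1P_degree {n : ℕ} (ξ : Fin n → ℂ) (m : Fin n → ℕ) :
    (a1P ξ m).degree = ((∑ j, m j : ℕ) : WithBot ℕ) := by
  rw [Polynomial.degree_eq_natDegree (a1P_monic ξ m).ne_zero, a1P_natDegree]

lemma a1P_dvd {n : ℕ} {ξ : Fin n → ℂ} {m : Fin n → ℕ} (hinj : Function.Injective ξ)
    {q : Polynomial ℂ} (h : ∀ j, (Polynomial.X - Polynomial.C (ξ j)) ^ (m j) ∣ q) : a1P ξ m ∣ q := by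
  refine Finset.prod_dvd_of_coprime (fun i _ j _ hij => ?_) fun j _ => h j
  exact (Polynomial.isCoprime_X_sub_C_of_isUnit_sub
    ((sub_ne_zero.2 fun h => hij (hinj h)).isUnit)).pow

lemma poly_bdd (P : Polynomial ℂ) : ∃ B : ℝ, 0 ≤ B ∧ ∀ z : ℂ, ‖z‖ ≤ 1 → ‖P.eval z‖ ≤ B := by
  obtain ⟨B, hB⟩ := (isCompact_closedBall (0:ℂ) 1).exists_bound_of_continuousOn
    (f := fun z => P.eval z) P.continuous.continuousOn
  refine ⟨max B 0, le_max_right _ _, fun z hz => (hB z (by simpa using hz)).trans (le_max_left _ _)⟩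

lemma norm_rad {ξ : ℂ} (hξ : ‖ξ‖ = 1) {t : ℝ} (h0 : 0 ≤ t) : ‖(t : ℂ) * ξ‖ = t := by
  rw [norm_mul, hξ, mul_one, Complex.norm_real, Real.norm_eq_abs, abs_of_nonneg h0]

lemma rad_mem {ξ : ℂ} (hξ : ‖ξ‖ = 1) {t : ℝ} (h0 : 0 ≤ t) (h1 : t < 1) : (t : ℂ) * ξ ∈ unitDisk := by
  rw [mem_disk_iff, norm_rad hξ h0]; exact h1

lemma norm_rad_sub {ξ : ℂ} (hξ : ‖ξ‖ = 1) {t : ℝ} (h1 : t < 1) : ‖(t : ℂ) * ξ - ξ‖ = 1 - t := by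
  have : (t : ℂ) * ξ - ξ = ((t - 1 : ℝ) : ℂ) * ξ := by push_cast; ring
  rw [this, norm_mul, hξ, mul_one, Complex.norm_real, Real.norm_eq_abs, abs_of_neg (by linarith)]
  ring

/-- Radial growth. -/
def Gr (F : ℂ → ℂ) (ξ : ℂ) (m : ℕ) : Prop :=
  ∃ C : ℝ, ∀ t : ℝ, 0 ≤ t → t < 1 → ‖F ((t : ℂ) * ξ)‖ ^ 2 * (1 - t) ≤ C * (1 - t) ^ (2 * m)

lemma Gr.sub {F G : ℂ → ℂ} {ξ : ℂ} {m : ℕ} (hF : Gr F ξ m) (hG : Gr G ξ m) :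
    Gr (fun z => F z - G z) ξ m := by
  obtain ⟨C, hC⟩ := hF
  obtain ⟨D, hD⟩ := hG
  refine ⟨2 * (C + D), fun t h0 h1 => ?_⟩
  have h2 := hC t h0 h1
  have h3 := hD t h0 h1
  have h4 := norm_sub_le (F ((t : ℂ) * ξ)) (G ((t : ℂ) * ξ))
  have h5 : ‖F ((t : ℂ) * ξ) - G ((t : ℂ) * ξ)‖ ^ 2 ≤
      2 * (‖F ((t : ℂ) * ξ)‖ ^ 2 + ‖G ((t : ℂ) * ξ)‖ ^ 2) := by
    have := pow_le_pow_left₀ (norm_nonneg _) h4 2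
    nlinarith [sq_nonneg (‖F ((t : ℂ) * ξ)‖ - ‖G ((t : ℂ) * ξ)‖)]
  have h6 : 0 ≤ 1 - t := by linarith
  have := mul_le_mul_of_nonneg_right h5 h6
  simp only
  nlinarith

lemma Gr.congr {F G : ℂ → ℂ} {ξ : ℂ} (hξ : ‖ξ‖ = 1) {m : ℕ} (hF : Gr F ξ m)
    (h : ∀ z ∈ unitDisk, F z = G z) : Gr G ξ m := by
  obtain ⟨C, hC⟩ := hF
  exact ⟨C, fun t h0 h1 => by rw [← h _ (rad_mem hξ h0 h1)]; exact hC t h0 h1⟩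

lemma Gr.mono {F : ℂ → ℂ} {ξ : ℂ} {m l : ℕ} (hF : Gr F ξ m) (hl : l ≤ m) : Gr F ξ l := by
  obtain ⟨C, hC⟩ := hF
  refine ⟨|C|, fun t h0 h1 => (hC t h0 h1).trans ?_⟩
  have h2 : (1 - t) ^ (2 * m) ≤ (1 - t) ^ (2 * l) :=
    pow_le_pow_of_le_one (by linarith) (by linarith) (by omega)
  have h3 : 0 ≤ (1 - t) ^ (2 * m) := pow_nonneg (by linarith) _
  calc C * (1 - t) ^ (2 * m) ≤ |C| * (1 - t) ^ (2 * m) := by gcongr; exact le_abs_self C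
    _ ≤ _ := by gcongr

lemma gr_dvd {ξ : ℂ} (hξ : ‖ξ‖ = 1) {m : ℕ} {q : Polynomial ℂ} (h : Gr (fun z => q.eval z) ξ m) :
    (Polynomial.X - Polynomial.C ξ) ^ m ∣ q := by
  by_cases hq : q = 0
  · rw [hq]; exact dvd_zero _
  obtain ⟨q', hq', hnd⟩ := Polynomial.exists_eq_pow_rootMultiplicity_mul_and_not_dvd q hq ξ
  set l := q.rootMultiplicity ξ
  by_cases hl : m ≤ l
  · exact (pow_dvd_pow _ hl).trans ⟨q', hq'⟩
  exfalso
  push Not at hl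
  rw [Polynomial.dvd_iff_isRoot] at hnd
  apply hnd
  obtain ⟨C, hC⟩ := h
  have hb : ∀ᶠ t : ℝ in nhdsWithin 1 (Iio 1), ‖q'.eval ((t : ℂ) * ξ)‖ ^ 2 ≤ |C| * (1 - t) := by
    refine slice_ev fun t h0 h1 => ?_
    have h2 := hC t h0 h1
    have hp : 0 < 1 - t := by linarith
    rw [hq'] at h2
    simp only [Polynomial.eval_mul, Polynomial.eval_pow, Polynomial.eval_sub, Polynomial.eval_X,
      Polynomial.eval_C, norm_mul, norm_pow] at h2
    rw [norm_rad_sub hξ h1] at h2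
    have h3 : C * (1 - t) ^ (2 * m) ≤ |C| * (1 - t) ^ (2 * l + 2) := by
      have a1 : (1 - t) ^ (2 * m) ≤ (1 - t) ^ (2 * l + 2) :=
        pow_le_pow_of_le_one (by linarith) (by linarith) (by omega)
      have a2 : 0 ≤ (1 - t) ^ (2 * m) := by positivity
      calc C * (1 - t) ^ (2 * m) ≤ |C| * (1 - t) ^ (2 * m) := by gcongr; exact le_abs_self C
        _ ≤ _ := by gcongr
    have h4 := h2.trans h3
    have h5 : (0:ℝ) < (1 - t) ^ (2 * l + 1) := by positivity
    refine le_of_mul_le_mul_left ?_ h5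
    calc (1 - t) ^ (2 * l + 1) * ‖q'.eval ((t : ℂ) * ξ)‖ ^ 2
        = ((1 - t) ^ l * ‖q'.eval ((t : ℂ) * ξ)‖) ^ 2 * (1 - t) := by ring
      _ ≤ |C| * (1 - t) ^ (2 * l + 2) := h4
      _ = _ := by ring
  have ht1 : Tendsto (fun t : ℝ => ‖q'.eval ((t : ℂ) * ξ)‖ ^ 2) (nhdsWithin 1 (Iio 1))
      (nhds (‖q'.eval (((1:ℝ) : ℂ) * ξ)‖ ^ 2)) := by
    have : Continuous (fun t : ℝ => ‖q'.eval ((t : ℂ) * ξ)‖ ^ 2) :=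
      ((q'.continuous.comp (by fun_prop)).norm.pow 2)
    exact (this.tendsto 1).mono_left nhdsWithin_le_nhds
  have ht2 : Tendsto (fun t : ℝ => |C| * (1 - t)) (nhdsWithin 1 (Iio 1)) (nhds 0) := by
    have : Continuous (fun t : ℝ => |C| * (1 - t)) := by fun_prop
    have h := this.tendsto 1
    simp only [sub_self, mul_zero] at h
    exact h.mono_left nhdsWithin_le_nhds
  have h6 := le_of_tendsto_of_tendsto ht1 ht2 hb
  have h7 : ‖q'.eval (((1:ℝ) : ℂ) * ξ)‖ ^ 2 = 0 := le_antisymm h6 (by positivity)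
  simpa using h7

lemma h2_gr {k : ℂ → ℂ} (hk : MemH2 k) {ξ : ℂ} (hξ : ‖ξ‖ = 1) {t : ℝ} (h0 : 0 ≤ t) (h1 : t < 1) :
    ‖k ((t : ℂ) * ξ)‖ ^ 2 * (1 - t) ≤ h2NormSq k := by
  refine le_trans ?_ (h2_pointwise hk (rad_mem hξ h0 h1))
  rw [norm_rad hξ h0]
  gcongr
  nlinarith

lemma gr_dvd_mul {k : ℂ → ℂ} (hk : MemH2 k) {ξ : ℂ} (hξ : ‖ξ‖ = 1) {P : Polynomial ℂ} {m : ℕ}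
    (hP : (Polynomial.X - Polynomial.C ξ) ^ m ∣ P) : Gr (fun z => P.eval z * k z) ξ m := by
  obtain ⟨P', rfl⟩ := hP
  obtain ⟨B, hB0, hB⟩ := poly_bdd P'
  refine ⟨B ^ 2 * h2NormSq k, fun t h0 h1 => ?_⟩
  have h2 := h2_gr hk hξ h0 h1
  have h3 := hB ((t : ℂ) * ξ) (by rw [norm_rad hξ h0]; exact h1.le)
  have hp : 0 < 1 - t := by linarith
  simp only [Polynomial.eval_mul, Polynomial.eval_pow, Polynomial.eval_sub, Polynomial.eval_X,
      Polynomial.eval_C, norm_mul, norm_pow]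
  rw [norm_rad_sub hξ h1]
  calc ((1 - t) ^ m * ‖P'.eval ((t : ℂ) * ξ)‖ * ‖k ((t : ℂ) * ξ)‖) ^ 2 * (1 - t)
      = (1 - t) ^ (2 * m) * (‖P'.eval ((t : ℂ) * ξ)‖ ^ 2 * (‖k ((t : ℂ) * ξ)‖ ^ 2 * (1 - t))) := by
        ring
    _ ≤ (1 - t) ^ (2 * m) * (B ^ 2 * h2NormSq k) := by gcongr
    _ = _ := by ring

lemma fac_dvd_a1P {n : ℕ} (ξ : Fin n → ℂ) (m : Fin n → ℕ) (j : Fin n) :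
    (Polynomial.X - Polynomial.C (ξ j)) ^ (m j) ∣ a1P ξ m :=
  Finset.dvd_prod_of_mem _ (Finset.mem_univ j)

lemma gr_a1 {n : ℕ} {ξ : Fin n → ℂ} {m : Fin n → ℕ} (hξ : ∀ j, ‖ξ j‖ = 1) {k : ℂ → ℂ}
    (hk : MemH2 k) (j : Fin n) : Gr (fun z => a1fun ξ m z * k z) (ξ j) (m j) := by
  have := gr_dvd_mul hk (hξ j) (fac_dvd_a1P ξ m j)
  simpa only [a1P_eval] using this

lemma a1_ne_zero {n : ℕ} {ξ : Fin n → ℂ} {m : Fin n → ℕ} {z : ℂ}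
    (hz : ∀ j, z ≠ ξ j) : a1fun ξ m z ≠ 0 := by
  unfold a1fun
  refine Finset.prod_ne_zero_iff.2 fun j _ => pow_ne_zero _ (sub_ne_zero.2 (hz j))

lemma a1_ne_zero_disk {n : ℕ} {ξ : Fin n → ℂ} {m : Fin n → ℕ} (hξ : ∀ j, ‖ξ j‖ = 1) {z : ℂ}
    (hz : z ∈ unitDisk) : a1fun ξ m z ≠ 0 :=
  a1_ne_zero fun j h => by
    rw [mem_disk_iff, h, hξ j] at hz
    exact lt_irrefl _ hz

lemma hb_unique {n : ℕ} {ξ : Fin n → ℂ} {m : Fin n → ℕ} (hξ : ∀ j, ‖ξ j‖ = 1)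
    (hinj : Function.Injective ξ) {f g g' : ℂ → ℂ} {q q' : Polynomial ℂ}
    (h : HbDecompOf ξ m f g q) (h' : HbDecompOf ξ m f g' q') :
    q = q' ∧ ∀ z ∈ unitDisk, g z = g' z := by
  have hdvd : a1P ξ m ∣ q - q' := by
    refine a1P_dvd hinj fun j => gr_dvd (hξ j) ?_
    refine ((gr_a1 hξ h'.1 j).sub (gr_a1 hξ h.1 j)).congr (hξ j) fun z hz => ?_
    have e1 := h.2.2 z hz
    have e2 := h'.2.2 z hz
    rw [Polynomial.eval_sub]
    linear_combination e1 - e2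
  have hq : q = q' := by
    rw [← sub_eq_zero]
    refine Polynomial.eq_zero_of_dvd_of_degree_lt hdvd ?_
    rw [a1P_degree]
    exact (Polynomial.degree_sub_le _ _).trans_lt (max_lt h.2.1 h'.2.1)
  refine ⟨hq, fun z hz => ?_⟩
  have e1 := h.2.2 z hz
  have e2 := h'.2.2 z hz
  rw [← hq] at e2
  refine mul_left_cancel₀ (a1_ne_zero_disk hξ hz) (b := g z) (c := g' z) (a := a1fun ξ m z) ?_
  linear_combination e2 - e1

lemma hbNormSq_eq {n : ℕ} {ξ : Fin n → ℂ} {m : Fin n → ℕ} (hξ : ∀ j, ‖ξ j‖ = 1)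
    (hinj : Function.Injective ξ) {f g : ℂ → ℂ} {q : Polynomial ℂ} (h : HbDecompOf ξ m f g q) :
    hbNormSq ξ m f = h2NormSq g + h2NormSq (fun z => q.eval z) := by
  have hm : MemHb ξ m f := ⟨(g, q), h⟩
  have hd : hbDecomp ξ m f = hm.choose := by unfold hbDecomp; rw [dif_pos hm]
  obtain ⟨e1, e2⟩ := hb_unique hξ hinj hm.choose_spec h
  unfold hbNormSq
  rw [hd, e1, h2NormSq_congr e2]

lemma radial_of_NT {f : ℂ → ℂ} {ξ L : ℂ} (hξ : ‖ξ‖ = 1) (h : NTLimit f ξ L) :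
    Tendsto (fun t : ℝ => f ((t : ℂ) * ξ)) (nhdsWithin 1 (Iio 1)) (nhds L) := by
  refine (h 2 (by norm_num)).comp (tendsto_nhdsWithin_iff.2 ⟨?_, ?_⟩)
  · have : Continuous (fun t : ℝ => (t : ℂ) * ξ) := by fun_prop
    have h := this.tendsto 1
    simp only [Complex.ofReal_one, one_mul] at h
    exact h.mono_left nhdsWithin_le_nhds
  · refine slice_ev fun t h0 h1 => ⟨rad_mem hξ h0 h1, ?_⟩
    rw [norm_rad_sub hξ h1, norm_rad hξ h0]
    linarith

lemma gr_tendsto {F : ℂ → ℂ} {ξ : ℂ} {m : ℕ} (hF : Gr F ξ m) (hm : 0 < m) :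
    Tendsto (fun t : ℝ => F ((t : ℂ) * ξ)) (nhdsWithin 1 (Iio 1)) (nhds 0) := by
  obtain ⟨C, hC⟩ := hF.mono (l := 1) hm
  have h1 : Tendsto (fun t : ℝ => ‖F ((t : ℂ) * ξ)‖ ^ 2) (nhdsWithin 1 (Iio 1)) (nhds 0) := by
    have ht2 : Tendsto (fun t : ℝ => C * (1 - t)) (nhdsWithin 1 (Iio 1)) (nhds 0) := by
      have : Continuous (fun t : ℝ => C * (1 - t)) := by fun_prop
      have h := this.tendsto 1
      simp only [sub_self, mul_zero] at h
      exact h.mono_left nhdsWithin_le_nhds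
    refine tendsto_of_tendsto_of_tendsto_of_le_of_le' tendsto_const_nhds ht2
      (Eventually.of_forall fun t => by positivity) (slice_ev fun t h0 h1 => ?_)
    have hp : 0 < 1 - t := by linarith
    refine le_of_mul_le_mul_right (a := 1 - t) ?_ hp
    have := hC t h0 h1
    rw [mul_one] at this
    linarith [this, sq (1 - t), mul_assoc C (1 - t) (1 - t), congrArg (C * ·) (sq (1 - t))]
  rw [tendsto_zero_iff_norm_tendsto_zero]
  have h2 := h1.sqrt
  simpa using h2

lemma r_eval {n : ℕ} {ξ : Fin n → ℂ} {m : Fin n → ℕ} (hξ : ∀ j, ‖ξ j‖ = 1) (hm : ∀ j, 0 < m j)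
    {φ h : ℂ → ℂ} {r : Polynomial ℂ} (hd : HbDecompOf ξ m φ h r) {j : Fin n} {L : ℂ}
    (hL : NTLimit φ (ξ j) L) : r.eval (ξ j) = L := by
  have h1 := radial_of_NT (hξ j) hL
  have h2 := gr_tendsto (gr_a1 hξ hd.1 j) (hm j)
  have h3 := h1.sub h2
  rw [sub_zero] at h3
  have h4 : Tendsto (fun t : ℝ => r.eval ((t : ℂ) * ξ j)) (nhdsWithin 1 (Iio 1))
      (nhds (r.eval (((1:ℝ) : ℂ) * ξ j))) := by
    have : Continuous (fun t : ℝ => r.eval ((t : ℂ) * ξ j)) := r.continuous.comp (by fun_prop)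
    exact (this.tendsto 1).mono_left nhdsWithin_le_nhds
  rw [Complex.ofReal_one, one_mul] at h4
  refine tendsto_nhds_unique_of_eventuallyEq h4 h3 (slice_ev fun t h0 h1 => ?_)
  have := hd.2.2 _ (rad_mem (hξ j) h0 h1)
  simp only
  rw [this]; ring

lemma MemHinf.add {f g : ℂ → ℂ} (hf : MemHinf f) (hg : MemHinf g) : MemHinf (fun z => f z + g z) := by
  obtain ⟨h1, C, hC⟩ := hf
  obtain ⟨h2, D, hD⟩ := hg
  exact ⟨h1.add h2, C + D, fun z hz => (norm_add_le _ _).trans (add_le_add (hC z hz) (hD z hz))⟩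

lemma MemHinf.mul {f g : ℂ → ℂ} (hf : MemHinf f) (hg : MemHinf g) : MemHinf (fun z => f z * g z) := by
  obtain ⟨h1, C, hC⟩ := hf
  obtain ⟨h2, D, hD⟩ := hg
  refine ⟨h1.mul h2, C * D, fun z hz => ?_⟩
  rw [norm_mul]
  exact mul_le_mul (hC z hz) (hD z hz) (norm_nonneg _) ((norm_nonneg _).trans (hC z hz))

lemma memHinf_const (c : ℂ) : MemHinf (fun _ => c) := ⟨by fun_prop, ‖c‖, fun _ _ => le_rfl⟩

lemma memHinf_poly (P : Polynomial ℂ) : MemHinf (fun z => P.eval z) := by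
  obtain ⟨B, _, hB⟩ := poly_bdd P
  exact ⟨P.differentiable.differentiableOn, B, fun z hz => hB z (mem_disk_iff.1 hz).le⟩

lemma MemHinf.mulH2 {f g : ℂ → ℂ} (hf : MemHinf f) (hg : MemH2 g) : MemH2 (fun z => f z * g z) := by
  obtain ⟨h1, C, hC⟩ := hf
  exact (memH2_mul_bdd hg h1 hC).1

lemma poly_diff {φ : ℂ → ℂ} (hφ : MemHinf φ) (r P : Polynomial ℂ) :
    ∃ B : ℂ → ℂ, MemHinf B ∧ ∀ z, P.eval (φ z) - P.eval (r.eval z) = (φ z - r.eval z) * B z := by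
  induction P using Polynomial.induction_on with
  | C a => exact ⟨fun _ => 0, memHinf_const 0, fun z => by simp⟩
  | add p q hp hq =>
    obtain ⟨B, hB, e⟩ := hp
    obtain ⟨D, hD, e'⟩ := hq
    refine ⟨_, hB.add hD, fun z => ?_⟩
    simp only [Polynomial.eval_add]
    linear_combination e z + e' z
  | monomial k a ih =>
    obtain ⟨B, hB, e⟩ := ih
    refine ⟨_, (hφ.mul hB).add (memHinf_poly (Polynomial.C a * r ^ k)), fun z => ?_⟩
    have := e z
    simp only [Polynomial.eval_mul, Polynomial.eval_C, Polynomial.eval_pow, Polynomial.eval_X] at this ⊢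
    linear_combination (φ z) * this

/-- Polynomials of `φ` belong to `H(b)`. -/
lemma poly_comp_hb {n : ℕ} {ξ : Fin n → ℂ} {m : Fin n → ℕ} {φ h : ℂ → ℂ} {r : Polynomial ℂ}
    (hφ : MemHinf φ) (hd : HbDecompOf ξ m φ h r) (P : Polynomial ℂ) :
    ∃ k, HbDecompOf ξ m (fun z => P.eval (φ z)) k ((P.comp r) %ₘ (a1P ξ m)) := by
  obtain ⟨B, hB, e⟩ := poly_diff hφ r P
  refine ⟨fun z => B z * h z + ((P.comp r) /ₘ (a1P ξ m)).eval z,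
    (memH2_add (hB.mulH2 hd.1) (memH2_poly _)).1, ?_, fun z hz => ?_⟩
  · rw [← a1P_degree ξ m]
    exact Polynomial.degree_modByMonic_lt _ (a1P_monic ξ m)
  · have h1 := congrArg (Polynomial.eval z) (Polynomial.modByMonic_add_div (P.comp r) (a1P ξ m))
    simp only [Polynomial.eval_add, Polynomial.eval_mul, a1P_eval, Polynomial.eval_comp] at h1
    have h2 := hd.2.2 z hz
    have h3 := e z
    simp only
    linear_combination h3 - h1 + B z * h2

/-! ### Part 5: from boundedness to the kernel condition -/

/-- The data of the problem. -/
structure Stp {n : ℕ} (p : ℕ) (ξ : Fin n → ℂ) (m : Fin n → ℕ) (Λ : Fin n → ℂ) (φ h : ℂ → ℂ)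
    (r : Polynomial ℂ) : Prop where
  hξ : ∀ j, ‖ξ j‖ = 1
  hinj : Function.Injective ξ
  hm : ∀ j, 0 < m j
  hφd : DifferentiableOn ℂ φ unitDisk
  hφ : ∀ z ∈ unitDisk, ‖φ z‖ < 1
  hd : HbDecompOf ξ m φ h r
  hr : ∀ j, r.eval (ξ j) = Λ j
  rad : ∀ j, Tendsto (fun t : ℝ => φ ((t : ℂ) * ξ j)) (nhdsWithin 1 (Iio 1)) (nhds (Λ j))
  hcirc : ∀ j : Fin n, (j : ℕ) < p → ∃ i, Λ j = ξ i
  hdisk : ∀ j : Fin n, p ≤ (j : ℕ) → ‖Λ j‖ < 1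

/-- The polynomial `G`. -/
def Gp {n : ℕ} (p : ℕ) (m : Fin n → ℕ) (Λ : Fin n → ℂ) : Polynomial ℂ :=
  ∏ j ∈ Finset.univ.filter fun j : Fin n => p ≤ (j : ℕ),
    (Polynomial.X - Polynomial.C (Λ j)) ^ (m j)

lemma ufun_eq {n : ℕ} (p : ℕ) (ξ : Fin n → ℂ) (m : Fin n → ℕ) (Λ : Fin n → ℂ) (φ : ℂ → ℂ) (z : ℂ) :
    ufun p ξ m Λ φ z = (a1P ξ m * Gp p m Λ).eval (φ z) / a1fun ξ m z := by
  unfold ufun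
  rw [Polynomial.eval_mul, a1P_eval]
  simp [Gp, Polynomial.eval_prod]

lemma memHinf_phi {φ : ℂ → ℂ} (hφd : DifferentiableOn ℂ φ unitDisk)
    (hφ : ∀ z ∈ unitDisk, ‖φ z‖ < 1) : MemHinf φ := ⟨hφd, 1, fun z hz => (hφ z hz).le⟩

lemma comp_diff {φ g : ℂ → ℂ} (hφd : DifferentiableOn ℂ φ unitDisk)
    (hφ : ∀ z ∈ unitDisk, ‖φ z‖ < 1) (hg : DifferentiableOn ℂ g unitDisk) :
    DifferentiableOn ℂ (fun z => g (φ z)) unitDisk :=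
  DifferentiableOn.comp (g := g) hg hφd fun z hz => mem_disk_iff.2 (hφ z hz)

/-- The remainder polynomial. -/
def Rp {n : ℕ} (p : ℕ) (ξ : Fin n → ℂ) (m : Fin n → ℕ) (Λ : Fin n → ℂ) (r : Polynomial ℂ) :
    Polynomial ℂ := ((a1P ξ m * Gp p m Λ).comp r) %ₘ (a1P ξ m)

lemma Rp_dvd {n : ℕ} {p : ℕ} {ξ : Fin n → ℂ} {m : Fin n → ℕ} {Λ : Fin n → ℂ} {φ h : ℂ → ℂ}
    {r : Polynomial ℂ} (S : Stp p ξ m Λ φ h r) {j : Fin n} (hj : p ≤ (j : ℕ)) :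
    (Polynomial.X - Polynomial.C (ξ j)) ^ (m j) ∣ Rp p ξ m Λ r := by
  have h1 : (Polynomial.X - Polynomial.C (ξ j)) ^ (m j) ∣ (a1P ξ m * Gp p m Λ).comp r := by
    rw [Polynomial.mul_comp]
    refine Dvd.dvd.mul_left ?_ _
    unfold Gp
    rw [Polynomial.prod_comp]
    refine Dvd.dvd.trans ?_ (Finset.dvd_prod_of_mem _ (Finset.mem_filter.2 ⟨Finset.mem_univ j, hj⟩))
    rw [Polynomial.pow_comp]
    refine pow_dvd_pow_of_dvd ?_ _
    rw [Polynomial.dvd_iff_isRoot]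
    simp [S.hr j]
  have h2 := Polynomial.modByMonic_add_div ((a1P ξ m * Gp p m Λ).comp r) (a1P ξ m)
  have h3 : Rp p ξ m Λ r = (a1P ξ m * Gp p m Λ).comp r -
      a1P ξ m * (((a1P ξ m * Gp p m Λ).comp r) /ₘ (a1P ξ m)) := by
    unfold Rp; linear_combination h2
  rw [h3]
  exact dvd_sub h1 (Dvd.dvd.mul_right (fac_dvd_a1P ξ m j) _)

/-- A consequence of the Schwarz-Pick lemma. -/
lemma schwarz_pick {φ : ℂ → ℂ} (hφd : DifferentiableOn ℂ φ unitDisk)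
    (hφ : ∀ z ∈ unitDisk, ‖φ z‖ < 1) :
    ∃ c : ℝ, 0 < c ∧ ∀ z ∈ unitDisk, c * (1 - ‖z‖) ≤ 1 - ‖φ z‖ ^ 2 := by
  set a := φ 0 with ha
  have h0 : (0:ℂ) ∈ unitDisk := by simp [unitDisk]
  have ha1 : ‖a‖ < 1 := hφ 0 h0
  have hne : ∀ z ∈ unitDisk, 1 - ‖a‖ ≤ ‖1 - (starRingEnd ℂ) a * φ z‖ := by
    intro z hz
    have h1 := norm_sub_norm_le (1:ℂ) ((starRingEnd ℂ) a * φ z)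
    rw [norm_one, norm_mul, RCLike.norm_conj] at h1
    have := hφ z hz
    nlinarith [norm_nonneg a, norm_nonneg (φ z)]
  have hid : ∀ w : ℂ, ‖1 - (starRingEnd ℂ) a * w‖ ^ 2 - ‖w - a‖ ^ 2 =
      (1 - ‖a‖ ^ 2) * (1 - ‖w‖ ^ 2) := by
    intro w
    simp only [← Complex.normSq_eq_norm_sq, Complex.normSq_apply, Complex.sub_re, Complex.sub_im,
      Complex.mul_re, Complex.mul_im, Complex.conj_re, Complex.conj_im, Complex.one_re,
      Complex.one_im]
    ring
  set ψ : ℂ → ℂ := fun z => (φ z - a) / (1 - (starRingEnd ℂ) a * φ z) with hψ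
  have hne' : ∀ z ∈ unitDisk, 1 - (starRingEnd ℂ) a * φ z ≠ 0 := fun z hz => by
    have := hne z hz
    rw [← norm_pos_iff]; linarith
  have hψd : DifferentiableOn ℂ ψ (Metric.ball 0 1) := by
    refine DifferentiableOn.div (hφd.sub (by fun_prop)) ?_ hne'
    exact (differentiableOn_const _).sub ((differentiableOn_const _).mul hφd)
  refine ⟨(1 - ‖a‖) ^ 2, by nlinarith, fun z hz => ?_⟩
  have hz1 := mem_disk_iff.1 hz
  have hle : ‖ψ z‖ ≤ ‖z‖ := by
    refine Complex.norm_le_norm_of_mapsTo_ball (R := 1) hψd (fun w hw => ?_) (by simp [hψ, ha]) hz1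
    have h2 := hid (φ w)
    have h3 := hφ w hw
    have h4 := hne w hw
    simp only [hψ, Metric.mem_closedBall, dist_zero_right, norm_div]
    rw [div_le_one (by linarith)]
    refine le_of_sq_le_sq ?_ (norm_nonneg _)
    have : 0 ≤ (1 - ‖a‖ ^ 2) * (1 - ‖φ w‖ ^ 2) := by
      apply mul_nonneg <;> nlinarith [norm_nonneg a, norm_nonneg (φ w)]
    linarith
  have h4 := hne z hz
  have hpos : 0 < ‖1 - (starRingEnd ℂ) a * φ z‖ := by linarith
  simp only [hψ, norm_div] at hle
  rw [div_le_iff₀ hpos] at hle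
  have h5 := pow_le_pow_left₀ (norm_nonneg _) hle 2
  have h6 := hid (φ z)
  have h3 := hφ z hz
  have h7 : (1 - ‖z‖ ^ 2) * (1 - ‖a‖) ^ 2 ≤ (1 - ‖z‖ ^ 2) * ‖1 - (starRingEnd ℂ) a * φ z‖ ^ 2 := by
    have : 0 ≤ 1 - ‖z‖ ^ 2 := by nlinarith [norm_nonneg z]
    have : 0 ≤ 1 - ‖a‖ := by linarith
    gcongr
  have h8 : (1 - ‖a‖ ^ 2) * (1 - ‖φ z‖ ^ 2) ≤ 1 - ‖φ z‖ ^ 2 := by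
    have h81 : 0 ≤ 1 - ‖φ z‖ ^ 2 := by nlinarith [norm_nonneg (φ z)]
    nlinarith [mul_nonneg (sq_nonneg ‖a‖) h81]
  have h9 : (1 - ‖a‖) ^ 2 * (1 - ‖z‖) ≤ (1 - ‖z‖ ^ 2) * (1 - ‖a‖) ^ 2 := by
    have : 1 - ‖z‖ ≤ 1 - ‖z‖ ^ 2 := by nlinarith [norm_nonneg z]
    nlinarith [sq_nonneg (1 - ‖a‖)]
  nlinarith

/-- The logarithm in `H²`. -/
lemma log_memH2 {η : ℂ} (hη : ‖η‖ = 1) :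
    MemH2 (fun w => Complex.log (1 - (starRingEnd ℂ) η * w)) := by
  have hlt : ∀ w ∈ unitDisk, ‖(starRingEnd ℂ) η * w‖ < 1 := fun w hw => by
    rw [norm_mul, RCLike.norm_conj, hη, one_mul]; exact mem_disk_iff.1 hw
  have hd : DifferentiableOn ℂ (fun w => Complex.log (1 - (starRingEnd ℂ) η * w)) unitDisk := by
    refine DifferentiableOn.clog (by fun_prop) fun w hw => ?_
    refine Complex.mem_slitPlane_iff.2 (Or.inl ?_)
    have h1 := Complex.re_le_norm ((starRingEnd ℂ) η * w)
    have h2 := hlt w hw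
    rw [Complex.sub_re, Complex.one_re]; linarith
  have hk : ∀ k, taylorCoeff (fun w => Complex.log (1 - (starRingEnd ℂ) η * w)) k =
      - ((starRingEnd ℂ) η ^ k / k) := by
    refine taylor_unique hd _ fun w hw => ?_
    have h := (Complex.hasSum_taylorSeries_neg_log (hlt w hw)).neg
    rw [neg_neg] at h
    refine h.congr_fun fun k => ?_
    rw [mul_pow]; ring
  refine ⟨hd, ?_⟩
  simp_rw [hk, norm_neg, norm_div, norm_pow, RCLike.norm_conj, hη, one_pow, Complex.norm_natCast,
    div_pow, one_pow]
  exact Real.summable_one_div_nat_pow.2 one_lt_two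

lemma a1_mul_hb {n : ℕ} {ξ : Fin n → ℂ} {m : Fin n → ℕ} {g : ℂ → ℂ} (hg : MemH2 g) :
    HbDecompOf ξ m (fun z => a1fun ξ m z * g z) g 0 := by
  refine ⟨hg, ?_, fun z _ => by simp⟩
  rw [Polynomial.degree_zero]; exact WithBot.bot_lt_coe _

lemma h2NormSq_zero_poly : h2NormSq (fun z => (0 : Polynomial ℂ).eval z) = 0 := by
  unfold h2NormSq
  simp only [taylorCoeff_poly]
  simp

lemma Rp_eq_zero {n : ℕ} {p : ℕ} {ξ : Fin n → ℂ} {m : Fin n → ℕ} {Λ : Fin n → ℂ} {φ h : ℂ → ℂ}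
    {r : Polynomial ℂ} (S : Stp p ξ m Λ φ h r)
    (hB : ∀ f, MemHb ξ m f → MemHb ξ m fun z => f (φ z)) : Rp p ξ m Λ r = 0 := by
  obtain ⟨k, hk⟩ := poly_comp_hb (memHinf_phi S.hφd S.hφ) S.hd (a1P ξ m * Gp p m Λ)
  change HbDecompOf ξ m _ k (Rp p ξ m Λ r) at hk
  set R := Rp p ξ m Λ r with hRdef
  refine Polynomial.eq_zero_of_dvd_of_degree_lt (p := a1P ξ m) (a1P_dvd S.hinj fun j => ?_)
    (by rw [a1P_degree]; exact hk.2.1)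
  rcases le_or_gt p (j : ℕ) with hj | hj
  · exact Rp_dvd S hj
  obtain ⟨i, hi⟩ := S.hcirc j hj
  by_cases hR : R = 0
  · rw [hR]; exact dvd_zero _
  obtain ⟨R', hR', hnd⟩ := Polynomial.exists_eq_pow_rootMultiplicity_mul_and_not_dvd R hR (ξ j)
  set l := R.rootMultiplicity (ξ j)
  by_cases hl : m j ≤ l
  · exact (pow_dvd_pow _ hl).trans ⟨R', hR'⟩
  exfalso
  push Not at hl
  rw [Polynomial.dvd_iff_isRoot] at hnd
  have hξj := S.hξ j
  -- the logarithm
  set g : ℂ → ℂ := fun w => Complex.log (1 - (starRingEnd ℂ) (ξ i) * w) with hg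
  have hgm : MemH2 g := log_memH2 (S.hξ i)
  have hGg : MemH2 (fun z => (Gp p m Λ).eval z * g z) := (memHinf_poly _).mulH2 hgm
  obtain ⟨⟨kg, qg⟩, hkg⟩ := hB _ ⟨(_, _), a1_mul_hb (ξ := ξ) (m := m) hGg⟩
  have hF : ∀ z ∈ unitDisk, (a1fun ξ m z * k z + R.eval z) * g (φ z) =
      a1fun ξ m z * kg z + qg.eval z := by
    intro z hz
    have e1 := hk.2.2 z hz
    have e2 := hkg.2.2 z hz
    simp only at e1 e2
    rw [Polynomial.eval_mul, a1P_eval] at e1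
    rw [← e2, ← e1]; ring
  obtain ⟨A', hA'⟩ := fac_dvd_a1P ξ m j
  set P'' : Polynomial ℂ := (Polynomial.X - Polynomial.C (ξ j)) ^ (m j - l) * A' with hP''
  have ha1 : ∀ z, a1fun ξ m z = (z - ξ j) ^ l * P''.eval z := by
    intro z
    rw [← a1P_eval, hA', hP'']
    simp only [Polynomial.eval_mul, Polynomial.eval_pow, Polynomial.eval_sub, Polynomial.eval_X,
      Polynomial.eval_C]
    rw [← mul_assoc, ← pow_add, Nat.add_sub_cancel' hl.le]
  have hdv : (Polynomial.X - Polynomial.C (ξ j)) ^ (m j - l) ∣ P'' := Dvd.intro _ rfl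
  have hml : 0 < m j - l := by omega
  have hRz : ∀ z, R.eval z = (z - ξ j) ^ l * R'.eval z := by
    intro z
    rw [hR']
    simp only [Polynomial.eval_mul, Polynomial.eval_pow, Polynomial.eval_sub, Polynomial.eval_X,
      Polynomial.eval_C]
  have grk := gr_dvd_mul hk.1 hξj hdv
  have grkg := gr_dvd_mul hkg.1 hξj hdv
  -- growth of the composite logarithm
  obtain ⟨c, hc, hsp⟩ := schwarz_pick S.hφd S.hφ
  have hgg : ∀ t : ℝ, 0 ≤ t → t < 1 →
      ‖g (φ ((t : ℂ) * ξ j))‖ ^ 2 * (1 - t) ≤ h2NormSq g / c := by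
    intro t h0 h1
    have hz := rad_mem hξj h0 h1
    have h2 := hsp _ hz
    have h3 := h2_pointwise hgm (mem_disk_iff.2 (S.hφ _ hz))
    rw [norm_rad hξj h0] at h2
    rw [le_div_iff₀ hc]
    refine le_trans ?_ h3
    have : ‖g (φ ((t : ℂ) * ξ j))‖ ^ 2 * (1 - t) * c = ‖g (φ ((t : ℂ) * ξ j))‖ ^ 2 * (c * (1 - t)) := by
      ring
    rw [this]
    gcongr
  obtain ⟨BR, hBR0, hBR⟩ := poly_bdd R'
  obtain ⟨Ck, hCk⟩ := grk.mono (l := 1) hml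
  have hgrF : Gr (fun z => (a1fun ξ m z * k z + R.eval z) * g (φ z)) (ξ j) l := by
    refine ⟨2 * (|Ck| + BR ^ 2) * (h2NormSq g / c), fun t h0 h1 => ?_⟩
    have hp : 0 < 1 - t := by linarith
    have e : (a1fun ξ m ((t : ℂ) * ξ j) * k ((t : ℂ) * ξ j) + R.eval ((t : ℂ) * ξ j)) =
        ((t : ℂ) * ξ j - ξ j) ^ l * (P''.eval ((t : ℂ) * ξ j) * k ((t : ℂ) * ξ j) +
          R'.eval ((t : ℂ) * ξ j)) := by
      rw [ha1, hRz]; ring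
    have h5 := hBR ((t : ℂ) * ξ j) (by rw [norm_rad hξj h0]; exact h1.le)
    have h6 : ‖P''.eval ((t : ℂ) * ξ j) * k ((t : ℂ) * ξ j)‖ ^ 2 ≤ |Ck| := by
      have h7 := hCk t h0 h1
      have h8 : ‖P''.eval ((t : ℂ) * ξ j) * k ((t : ℂ) * ξ j)‖ ^ 2 ≤ Ck * (1 - t) := by
        refine le_of_mul_le_mul_right (a := 1 - t) ?_ hp
        refine h7.trans (le_of_eq (by ring))
      refine h8.trans ?_
      calc Ck * (1 - t) ≤ |Ck| * (1 - t) := by gcongr; exact le_abs_self _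
        _ ≤ |Ck| * 1 := by gcongr; linarith
        _ = |Ck| := mul_one _
    have h9 : ‖P''.eval ((t : ℂ) * ξ j) * k ((t : ℂ) * ξ j) + R'.eval ((t : ℂ) * ξ j)‖ ^ 2 ≤
        2 * (|Ck| + BR ^ 2) := by
      set x := P''.eval ((t : ℂ) * ξ j) * k ((t : ℂ) * ξ j)
      set y := R'.eval ((t : ℂ) * ξ j)
      have h10 := pow_le_pow_left₀ (norm_nonneg _) (norm_add_le x y) 2
      have h11 := pow_le_pow_left₀ (norm_nonneg _) h5 2
      nlinarith [sq_nonneg (‖x‖ - ‖y‖)]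
    simp only
    rw [e, norm_mul, norm_mul, norm_pow, norm_rad_sub hξj h1]
    have h12 := hgg t h0 h1
    calc _ = (1 - t) ^ (2 * l) * (‖P''.eval ((t : ℂ) * ξ j) * k ((t : ℂ) * ξ j) +
          R'.eval ((t : ℂ) * ξ j)‖ ^ 2 * (‖g (φ ((t : ℂ) * ξ j))‖ ^ 2 * (1 - t))) := by ring
      _ ≤ (1 - t) ^ (2 * l) * (2 * (|Ck| + BR ^ 2) * (h2NormSq g / c)) := by gcongr
      _ = _ := by ring
  have hqdvd : (Polynomial.X - Polynomial.C (ξ j)) ^ l ∣ qg := by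
    refine gr_dvd hξj ((hgrF.sub ((gr_a1 S.hξ hkg.1 j).mono hl.le)).congr hξj fun z hz => ?_)
    have := hF z hz
    simp only
    rw [this]; ring
  obtain ⟨q', hq'⟩ := hqdvd
  have hqz : ∀ z, qg.eval z = (z - ξ j) ^ l * q'.eval z := by
    intro z
    rw [hq']
    simp only [Polynomial.eval_mul, Polynomial.eval_pow, Polynomial.eval_sub, Polynomial.eval_X,
      Polynomial.eval_C]
  have hpt : ∀ Q : Polynomial ℂ, Tendsto (fun t : ℝ => Q.eval ((t : ℂ) * ξ j))
      (nhdsWithin 1 (Iio 1)) (nhds (Q.eval (ξ j))) := by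
    intro Q
    have : Continuous (fun t : ℝ => Q.eval ((t : ℂ) * ξ j)) := Q.continuous.comp (by fun_prop)
    have h := (this.tendsto 1).mono_left (nhdsWithin_le_nhds (s := Iio 1))
    rwa [Complex.ofReal_one, one_mul] at h
  have hden := (gr_tendsto grk hml).add (hpt R')
  have hnum := (gr_tendsto grkg hml).add (hpt q')
  rw [zero_add] at hden hnum
  have hquot := hnum.div hden hnd
  have hglim : Tendsto (fun t : ℝ => g (φ ((t : ℂ) * ξ j))) (nhdsWithin 1 (Iio 1))
      (nhds (q'.eval (ξ j) / R'.eval (ξ j))) := by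
    refine hquot.congr' ?_
    filter_upwards [hden.eventually_ne hnd, slice_ev (p := fun r => 0 ≤ r ∧ r < 1) fun r a b => ⟨a, b⟩]
      with t ht htt
    have hz := rad_mem hξj htt.1 htt.2
    have e := hF _ hz
    have hne : ((t : ℂ) * ξ j - ξ j) ^ l ≠ 0 := by
      refine pow_ne_zero _ ?_
      rw [← norm_pos_iff, norm_rad_sub hξj htt.2]; linarith [htt.2]
    rw [ha1, hRz, hqz] at e
    rw [Pi.div_apply, div_eq_iff ht]
    refine mul_left_cancel₀ hne ?_
    linear_combination -e
  have hexp : Tendsto (fun t : ℝ => Complex.exp (g (φ ((t : ℂ) * ξ j)))) (nhdsWithin 1 (Iio 1))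
      (nhds (Complex.exp (q'.eval (ξ j) / R'.eval (ξ j)))) :=
    (Complex.continuous_exp.tendsto _).comp hglim
  have h0 : Tendsto (fun t : ℝ => 1 - (starRingEnd ℂ) (ξ i) * φ ((t : ℂ) * ξ j))
      (nhdsWithin 1 (Iio 1)) (nhds 0) := by
    have h1 := ((S.rad j).const_mul ((starRingEnd ℂ) (ξ i))).const_sub 1
    rw [hi, mul_comm, Complex.mul_conj, Complex.normSq_eq_norm_sq, S.hξ i] at h1
    simpa using h1
  have heq := tendsto_nhds_unique_of_eventuallyEq hexp h0 (slice_ev fun t h0 h1 => by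
    have hz := rad_mem hξj h0 h1
    simp only [hg]
    rw [Complex.exp_log]
    intro hcon
    have : ‖(starRingEnd ℂ) (ξ i) * φ ((t : ℂ) * ξ j)‖ = 1 := by
      rw [← sub_eq_zero.1 hcon, norm_one]
    rw [norm_mul, RCLike.norm_conj, S.hξ i, one_mul] at this
    exact absurd (S.hφ _ hz) (by rw [this]; exact lt_irrefl _))
  exact Complex.exp_ne_zero _ heq

lemma u_of_Rp {n : ℕ} {p : ℕ} {ξ : Fin n → ℂ} {m : Fin n → ℕ} {Λ : Fin n → ℂ} {φ h : ℂ → ℂ}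
    {r : Polynomial ℂ} (S : Stp p ξ m Λ φ h r) (hR : Rp p ξ m Λ r = 0) :
    MemH2 (ufun p ξ m Λ φ) := by
  obtain ⟨k, hk⟩ := poly_comp_hb (memHinf_phi S.hφd S.hφ) S.hd (a1P ξ m * Gp p m Λ)
  change HbDecompOf ξ m _ k (Rp p ξ m Λ r) at hk
  rw [hR] at hk
  refine memH2_congr (fun z hz => ?_) hk.1
  have h1 := hk.2.2 z hz
  simp only at h1
  rw [ufun_eq, h1, Polynomial.eval_zero, add_zero, mul_div_cancel_left₀ _ (a1_ne_zero_disk S.hξ hz)]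

/-- The Cauchy kernel. -/
lemma cauchy_memH2 {w : ℂ} (hw : ‖w‖ < 1) :
    MemH2 (fun z => (1 - (starRingEnd ℂ) w * z)⁻¹) ∧
      h2NormSq (fun z => (1 - (starRingEnd ℂ) w * z)⁻¹) = (1 - ‖w‖ ^ 2)⁻¹ := by
  have hlt : ∀ z ∈ unitDisk, ‖(starRingEnd ℂ) w * z‖ < 1 := fun z hz => by
    rw [norm_mul, RCLike.norm_conj]
    have := mem_disk_iff.1 hz
    nlinarith [norm_nonneg w, norm_nonneg z]
  have hd : DifferentiableOn ℂ (fun z => (1 - (starRingEnd ℂ) w * z)⁻¹) unitDisk := by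
    refine DifferentiableOn.inv (by fun_prop) fun z hz hcon => ?_
    have := hlt z hz
    rw [← sub_eq_zero.1 hcon, norm_one] at this
    exact lt_irrefl _ this
  have hk : ∀ k, taylorCoeff (fun z => (1 - (starRingEnd ℂ) w * z)⁻¹) k = (starRingEnd ℂ) w ^ k := by
    refine taylor_unique hd _ fun z hz => ?_
    have h := hasSum_geometric_of_norm_lt_one (hlt z hz)
    simpa only [mul_pow] using h
  have hs : HasSum (fun k => ‖taylorCoeff (fun z => (1 - (starRingEnd ℂ) w * z)⁻¹) k‖ ^ 2)
      (1 - ‖w‖ ^ 2)⁻¹ := by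
    simp_rw [hk, norm_pow, RCLike.norm_conj, ← pow_mul, mul_comm _ 2, pow_mul]
    exact hasSum_geometric_of_lt_one (by positivity) (by nlinarith [norm_nonneg w])
  exact ⟨⟨hd, hs.summable⟩, hs.tsum_eq⟩

lemma bdry_norm_le {φ : ℂ → ℂ} (hφ : ∀ z ∈ unitDisk, ‖φ z‖ < 1) {θ : ℝ} (h : RadAt φ (eC θ)) :
    ‖bdryVal φ (eC θ)‖ ≤ 1 :=
  le_of_tendsto h.norm (slice_ev fun _ h0 h1 => (hφ _ (smul_eC_mem h0 h1 θ)).le)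

lemma one_sub_conj_ne {w z : ℂ} (hw : ‖w‖ < 1) (hz : ‖z‖ ≤ 1) : 1 - (starRingEnd ℂ) w * z ≠ 0 := by
  intro hcon
  have : ‖(starRingEnd ℂ) w * z‖ = 1 := by rw [← sub_eq_zero.1 hcon, norm_one]
  rw [norm_mul, RCLike.norm_conj] at this
  nlinarith [norm_nonneg w, norm_nonneg z]

theorem bdd_imp_kernel {n : ℕ} {p : ℕ} {ξ : Fin n → ℂ} {m : Fin n → ℕ} {Λ : Fin n → ℂ}
    {φ h : ℂ → ℂ} {r : Polynomial ℂ} (S : Stp p ξ m Λ φ h r) (hB : CompBddHb ξ m φ) :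
    ∃ C : ℝ, ∀ w ∈ unitDisk, repKerInt (ufun p ξ m Λ φ) φ w ≤ ENNReal.ofReal C := by
  have hu : MemH2 (ufun p ξ m Λ φ) := u_of_Rp S (Rp_eq_zero S hB.1)
  obtain ⟨C, hC⟩ := hB.2
  set u := ufun p ξ m Λ φ with hudef
  obtain ⟨B, hB0, hBG⟩ := poly_bdd (Gp p m Λ)
  refine ⟨|C| * B ^ 2, fun w hw => ?_⟩
  have hw1 := mem_disk_iff.1 hw
  have hw2 : 0 < 1 - ‖w‖ ^ 2 := by nlinarith [norm_nonneg w]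
  obtain ⟨hg, hgn⟩ := cauchy_memH2 hw1
  set g : ℂ → ℂ := fun z => (1 - (starRingEnd ℂ) w * z)⁻¹ with hgdef
  obtain ⟨hGg, hGgn⟩ := memH2_mul_bdd (f := g) (b := fun z => (Gp p m Λ).eval z) hg
    (Gp p m Λ).differentiable.differentiableOn (B := B) fun z hz => hBG z (mem_disk_iff.1 hz).le
  have hf := a1_mul_hb (ξ := ξ) (m := m) hGg
  have hgφ : ∀ z ∈ unitDisk, ‖g (φ z)‖ ≤ (1 - ‖w‖)⁻¹ := by
    intro z hz
    have h1 := norm_sub_norm_le (1:ℂ) ((starRingEnd ℂ) w * φ z)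
    rw [norm_one, norm_mul, RCLike.norm_conj] at h1
    have h2 := S.hφ z hz
    simp only [hgdef, norm_inv]
    refine inv_anti₀ (by linarith) ?_
    nlinarith [norm_nonneg w, norm_nonneg (φ z)]
  have hug := (memH2_mul_bdd hu (comp_diff S.hφd S.hφ hg.1) hgφ).1
  have hfφ : HbDecompOf ξ m (fun z => a1fun ξ m (φ z) * ((Gp p m Λ).eval (φ z) * g (φ z)))
      (fun z => g (φ z) * u z) 0 := by
    refine ⟨hug, (a1_mul_hb (ξ := ξ) (m := m) hug).2.1, fun z hz => ?_⟩
    have hne := a1_ne_zero_disk (m := m) S.hξ hz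
    have e := ufun_eq p ξ m Λ φ z
    simp only [hudef]
    rw [e, Polynomial.eval_mul, a1P_eval, Polynomial.eval_zero]
    field_simp
    ring
  have hle := hC _ ⟨(_, _), hf⟩
  rw [hbNormSq_eq S.hξ S.hinj hf, hbNormSq_eq S.hξ S.hinj hfφ, h2NormSq_zero_poly, add_zero,
    add_zero] at hle
  have hle2 : h2NormSq (fun z => g (φ z) * u z) ≤ |C| * B ^ 2 * (1 - ‖w‖ ^ 2)⁻¹ := by
    refine hle.trans ?_
    rw [hgn] at hGgn
    calc _ ≤ |C| * h2NormSq (fun z => (Gp p m Λ).eval z * g z) := by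
          gcongr
          · exact h2NormSq_nonneg _
          · exact le_abs_self C
      _ ≤ |C| * (B ^ 2 * (1 - ‖w‖ ^ 2)⁻¹) := by gcongr
      _ = _ := by ring
  have hbd := bdry_le hug
  have hkint : ∫⁻ θ, ENNReal.ofReal ((1 - ‖w‖ ^ 2) * ‖bdryVal u (eC θ)‖ ^ 2 /
        ‖1 - (starRingEnd ℂ) w * bdryVal φ (eC θ)‖ ^ 2) ∂circM =
      ENNReal.ofReal (1 - ‖w‖ ^ 2) * ∫⁻ θ, ‖bdryVal (fun z => g (φ z) * u z) (eC θ)‖ₑ ^ 2 ∂circM := by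
    rw [← lintegral_const_mul' _ _ ENNReal.ofReal_ne_top]
    refine lintegral_congr_ae ?_
    filter_upwards [h2_radial hu, h2_radial (memH2_of_bdd S.hφd fun z hz => (S.hφ z hz).le)]
      with θ h1 h2
    have h3 := bdry_norm_le S.hφ h2
    have hne := one_sub_conj_ne hw1 h3
    have h4 : Tendsto (fun t : ℝ => g (φ ((t : ℂ) * eC θ)) * u ((t : ℂ) * eC θ))
        (nhdsWithin 1 (Iio 1)) (nhds ((1 - (starRingEnd ℂ) w * bdryVal φ (eC θ))⁻¹ *
          bdryVal u (eC θ))) :=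
      (((h2.const_mul _).const_sub 1).inv₀ hne).mul h1
    rw [bdryVal_eq (f := fun z => g (φ z) * u z) h4, enorm_sq_eq, ← ENNReal.ofReal_mul hw2.le]
    congr 1
    rw [norm_mul, norm_inv, mul_pow, inv_pow]
    ring
  unfold repKerInt
  rw [show (∫⁻ θ in Set.Ioc (0:ℝ) (2 * Real.pi),
      ENNReal.ofReal ((1 - ‖w‖ ^ 2) * ‖bdryVal u (Complex.exp (θ * Complex.I))‖ ^ 2 /
        ‖1 - (starRingEnd ℂ) w * bdryVal φ (Complex.exp (θ * Complex.I))‖ ^ 2)) = _ from hkint]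
  have h2pi : ENNReal.ofReal (2 * Real.pi) ≠ ⊤ := ENNReal.ofReal_ne_top
  calc (ENNReal.ofReal (2 * Real.pi))⁻¹ * (ENNReal.ofReal (1 - ‖w‖ ^ 2) *
        ∫⁻ θ, ‖bdryVal (fun z => g (φ z) * u z) (eC θ)‖ₑ ^ 2 ∂circM)
      ≤ (ENNReal.ofReal (2 * Real.pi))⁻¹ * (ENNReal.ofReal (1 - ‖w‖ ^ 2) *
        (ENNReal.ofReal (2 * Real.pi) * ENNReal.ofReal (|C| * B ^ 2 * (1 - ‖w‖ ^ 2)⁻¹))) := by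
        refine mul_le_mul_right (mul_le_mul_right (hbd.trans (mul_le_mul_right ?_ _)) _) _
        exact ENNReal.ofReal_le_ofReal hle2
    _ = ((ENNReal.ofReal (2 * Real.pi))⁻¹ * ENNReal.ofReal (2 * Real.pi)) *
        (ENNReal.ofReal (1 - ‖w‖ ^ 2) * ENNReal.ofReal (|C| * B ^ 2 * (1 - ‖w‖ ^ 2)⁻¹)) := by ring
    _ = ENNReal.ofReal (|C| * B ^ 2) := by
        rw [ENNReal.inv_mul_cancel two_pi_ne_zero' h2pi, one_mul, ← ENNReal.ofReal_mul hw2.le]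
        congr 1; field_simp

/-! ### Part 6: from the kernel condition to the Carleson condition -/

theorem kernel_imp_carleson {u φ : ℂ → ℂ}
    (hK : ∃ C : ℝ, ∀ w ∈ unitDisk, repKerInt u φ w ≤ ENNReal.ofReal C) : IsCarleson u φ := by
  obtain ⟨C, hC⟩ := hK
  refine ⟨4 * (|C| + 1), by positivity, fun ζ hζ r hr => ?_⟩
  have hζ1 := mem_circle_iff.1 hζ
  obtain ⟨hr0, hr1⟩ := hr
  set w : ℂ := ((1 - r : ℝ) : ℂ) * ζ with hw
  have hwn : ‖w‖ = 1 - r := by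
    rw [hw, norm_mul, hζ1, mul_one, Complex.norm_real, Real.norm_of_nonneg (by linarith)]
  have hwd : w ∈ unitDisk := mem_disk_iff.2 (by rw [hwn]; linarith)
  have hc := hC w hwd
  have hle : muMeas u φ (Metric.closedBall ζ r ∩ Metric.closedBall 0 1) ≤
      ENNReal.ofReal (4 * r) * repKerInt u φ w := by
    unfold muMeas repKerInt
    rw [mul_left_comm, ← lintegral_const_mul' _ _ ENNReal.ofReal_ne_top]
    refine mul_le_mul_right (lintegral_mono fun θ => ?_) _
    simp only
    split_ifs with h
    · rw [← ENNReal.ofReal_mul (by positivity)]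
      refine ENNReal.ofReal_le_ofReal ?_
      set v := bdryVal φ (Complex.exp (θ * Complex.I))
      set U := ‖bdryVal u (Complex.exp (θ * Complex.I))‖ ^ 2 with hU
      have hU0 : 0 ≤ U := by positivity
      have h1 : ‖v - ζ‖ ≤ r := by simpa [dist_eq_norm] using h.1
      have h2 : ‖v‖ ≤ 1 := by simpa using h.2
      have hne := one_sub_conj_ne (w := w) (by rw [hwn]; linarith) h2
      have hζζ : (starRingEnd ℂ) ζ * ζ = 1 := by
        rw [mul_comm, Complex.mul_conj, Complex.normSq_eq_norm_sq, hζ1]; simp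
      have e : 1 - (starRingEnd ℂ) w * v = (starRingEnd ℂ) ζ * ((ζ - v) + (r : ℂ) * v) := by
        rw [hw, map_mul, Complex.conj_ofReal]
        push_cast
        linear_combination -hζζ
      have hD : ‖1 - (starRingEnd ℂ) w * v‖ ≤ 2 * r := by
        rw [e, norm_mul, RCLike.norm_conj, hζ1, one_mul]
        refine (norm_add_le _ _).trans ?_
        rw [norm_sub_rev, norm_mul, Complex.norm_real, Real.norm_of_nonneg hr0.le]
        nlinarith
      have hDp : 0 < ‖1 - (starRingEnd ℂ) w * v‖ := norm_pos_iff.2 hne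
      set D := ‖1 - (starRingEnd ℂ) w * v‖
      rw [← mul_div_assoc, le_div_iff₀ (by positivity), hwn]
      have h3 : D ^ 2 ≤ (2 * r) ^ 2 := pow_le_pow_left₀ hDp.le hD 2
      have h4 : D ^ 2 ≤ 4 * r * (1 - (1 - r) ^ 2) := by nlinarith
      calc U * D ^ 2 ≤ U * (4 * r * (1 - (1 - r) ^ 2)) := by gcongr
        _ = _ := by ring
    · exact zero_le
  refine hle.trans ((mul_le_mul_right hc _).trans ?_)
  rw [← ENNReal.ofReal_mul (by positivity)]
  refine ENNReal.ofReal_le_ofReal ?_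
  have := le_abs_self C
  nlinarith

/-! ### Part 7: square integrability of `u` from the Carleson condition -/

lemma ae_ne_pt {ζ : ℂ} (hζ : ‖ζ‖ = 1) : ∀ᵐ θ ∂circM, eC θ ≠ ζ := by
  rw [ae_iff]
  have h : ∀ k : ℕ, circM {θ | ¬ eC θ ≠ ζ} ≤ ENNReal.ofReal (8 * Real.pi * (1 / ((k : ℝ) + 1))) := by
    intro k
    refine (measure_mono ?_).trans (arc_measure hζ (h := 1 / ((k : ℝ) + 1)) (by positivity))
    intro θ hθ
    simp only [ne_eq, not_not, mem_ofPred_eq] at hθ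
    simp only [mem_ofPred_eq, hθ, sub_self, norm_zero]
    positivity
  have ht : Tendsto (fun k : ℕ => ENNReal.ofReal (8 * Real.pi * (1 / ((k : ℝ) + 1)))) atTop (nhds 0) := by
    have h1 := (tendsto_one_div_add_atTop_nhds_zero_nat (𝕜 := ℝ)).const_mul (8 * Real.pi)
    have h2 := ENNReal.tendsto_ofReal h1
    simpa using h2
  exact le_antisymm (ge_of_tendsto' ht h) zero_le

lemma phi_radial {n : ℕ} {p : ℕ} {ξ : Fin n → ℂ} {m : Fin n → ℕ} {Λ : Fin n → ℂ} {φ h : ℂ → ℂ}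
    {r : Polynomial ℂ} (S : Stp p ξ m Λ φ h r) : ∀ᵐ θ ∂circM, RadAt φ (eC θ) :=
  h2_radial (memH2_of_bdd S.hφd fun z hz => (S.hφ z hz).le)

lemma poly_rad (Q : Polynomial ℂ) (ζ : ℂ) : Tendsto (fun t : ℝ => Q.eval ((t : ℂ) * ζ))
      (nhdsWithin 1 (Iio 1)) (nhds (Q.eval ζ)) := by
  have : Continuous (fun t : ℝ => Q.eval ((t : ℂ) * ζ)) := Q.continuous.comp (by fun_prop)
  have h := (this.tendsto 1).mono_left (nhdsWithin_le_nhds (s := Iio 1))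
  rwa [Complex.ofReal_one, one_mul] at h

lemma a1_rad {n : ℕ} (ξ : Fin n → ℂ) (m : Fin n → ℕ) (ζ : ℂ) :
    Tendsto (fun t : ℝ => a1fun ξ m ((t : ℂ) * ζ)) (nhdsWithin 1 (Iio 1)) (nhds (a1fun ξ m ζ)) := by
  simpa only [a1P_eval] using poly_rad (a1P ξ m) ζ

lemma u_tendsto {n : ℕ} {p : ℕ} {ξ : Fin n → ℂ} {m : Fin n → ℕ} {Λ : Fin n → ℂ} {φ : ℂ → ℂ} {θ : ℝ}
    (h1 : RadAt φ (eC θ)) (h2 : ∀ j, eC θ ≠ ξ j) :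
    Tendsto (fun t : ℝ => ufun p ξ m Λ φ ((t : ℂ) * eC θ)) (nhdsWithin 1 (Iio 1))
      (nhds ((a1P ξ m * Gp p m Λ).eval (bdryVal φ (eC θ)) / a1fun ξ m (eC θ))) := by
  simp only [ufun_eq]
  exact (((a1P ξ m * Gp p m Λ).continuous.tendsto _).comp h1).div (a1_rad ξ m (eC θ)) (a1_ne_zero h2)

lemma u_bdry {n : ℕ} {p : ℕ} {ξ : Fin n → ℂ} {m : Fin n → ℕ} {Λ : Fin n → ℂ} {φ h : ℂ → ℂ}
    {r : Polynomial ℂ} (S : Stp p ξ m Λ φ h r) :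
    ∀ᵐ θ ∂circM, RadAt φ (eC θ) ∧ (∀ j, eC θ ≠ ξ j) ∧ RadAt (ufun p ξ m Λ φ) (eC θ) ∧
      bdryVal (ufun p ξ m Λ φ) (eC θ) =
        (a1P ξ m * Gp p m Λ).eval (bdryVal φ (eC θ)) / a1fun ξ m (eC θ) := by
  have hne : ∀ᵐ θ ∂circM, ∀ j, eC θ ≠ ξ j := ae_all_iff.2 fun j => ae_ne_pt (S.hξ j)
  filter_upwards [phi_radial S, hne] with θ h1 h2
  have ht := u_tendsto (p := p) (m := m) (Λ := Λ) h1 h2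
  refine ⟨h1, h2, ?_, bdryVal_eq ht⟩
  unfold RadAt
  rw [bdryVal_eq ht]
  exact ht

lemma u_diff {n : ℕ} {p : ℕ} {ξ : Fin n → ℂ} {m : Fin n → ℕ} {Λ : Fin n → ℂ} {φ h : ℂ → ℂ}
    {r : Polynomial ℂ} (S : Stp p ξ m Λ φ h r) : DifferentiableOn ℂ (ufun p ξ m Λ φ) unitDisk := by
  have h1 : DifferentiableOn ℂ (fun z => (a1P ξ m * Gp p m Λ).eval (φ z) / (a1P ξ m).eval z) unitDisk := by
    refine DifferentiableOn.div
      (comp_diff S.hφd S.hφ (a1P ξ m * Gp p m Λ).differentiable.differentiableOn)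
      (a1P ξ m).differentiable.differentiableOn fun z hz => ?_
    rw [a1P_eval]; exact a1_ne_zero_disk S.hξ hz
  refine h1.congr fun z _ => ?_
  rw [ufun_eq, a1P_eval]

/-- The measure `|u|² dθ`. -/
def uM (u : ℂ → ℂ) : Measure ℝ := circM.withDensity fun θ => ‖bdryVal u (eC θ)‖ₑ ^ 2

lemma uM_ac (u : ℂ → ℂ) : uM u ≪ circM := withDensity_absolutelyContinuous _ _

lemma uM_window {u φ : ℂ → ℂ} (hm : AEMeasurable (fun θ => bdryVal φ (eC θ)) circM) {M : ℝ}
    (hM0 : 0 < M)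
    (hM : ∀ ζ ∈ unitCircle, ∀ r ∈ Set.Ioo (0:ℝ) 1,
      muMeas u φ (Metric.closedBall ζ r ∩ Metric.closedBall 0 1) ≤ ENNReal.ofReal (M * r))
    {ζ : ℂ} (hζ : ‖ζ‖ = 1) {r : ℝ} (h0 : 0 < r) (h1 : r < 1) :
    uM u {θ | bdryVal φ (eC θ) ∈ Metric.closedBall ζ r ∩ Metric.closedBall 0 1} ≤
      ENNReal.ofReal (2 * Real.pi * M * r) := by
  have h := hM ζ (mem_circle_iff.2 hζ) r ⟨h0, h1⟩
  set E : Set ℂ := Metric.closedBall ζ r ∩ Metric.closedBall 0 1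
  have hE : MeasurableSet E := Metric.isClosed_closedBall.measurableSet.inter
    Metric.isClosed_closedBall.measurableSet
  have hnm : NullMeasurableSet {θ | bdryVal φ (eC θ) ∈ E} circM := hm.nullMeasurable hE
  have e : uM u {θ | bdryVal φ (eC θ) ∈ E} = ENNReal.ofReal (2 * Real.pi) * muMeas u φ E := by
    unfold uM muMeas
    rw [withDensity_apply', ← mul_assoc, ENNReal.mul_inv_cancel two_pi_ne_zero' ENNReal.ofReal_ne_top,
      one_mul, ← lintegral_indicator₀ hnm]
    refine lintegral_congr fun θ => ?_
    simp only [indicator, mem_ofPred_eq, enorm_sq_eq]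
    congr
  rw [e]
  refine (mul_le_mul_right h _).trans ?_
  rw [← ENNReal.ofReal_mul (by positivity)]
  exact le_of_eq (by congr 1; ring)

lemma four_windows {v : ℂ} (h1 : 1 / 2 ≤ ‖v‖) (h2 : ‖v‖ ≤ 1) :
    (‖v - 1‖ ≤ 9 / 10 ∨ ‖v - (-1)‖ ≤ 9 / 10) ∨ (‖v - Complex.I‖ ≤ 9 / 10 ∨ ‖v - (-Complex.I)‖ ≤ 9 / 10) := by
  have hs : ‖v‖ ^ 2 = v.re ^ 2 + v.im ^ 2 := by
    rw [← Complex.normSq_eq_norm_sq, Complex.normSq_apply]; ring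
  set s := ‖v‖
  set x := v.re with hx
  set y := v.im with hy
  have key : ∀ a : ℝ, 0 ≤ a → s ^ 2 ≤ 2 * a ^ 2 → s ^ 2 - 2 * a + 1 ≤ (9 / 10) ^ 2 := by
    intro a ha hle
    have : 7 / 10 * s ≤ a := by
      refine le_of_sq_le_sq ?_ ha
      nlinarith
    nlinarith
  have hn : ∀ w : ℂ, ∀ t : ℝ, ‖v - w‖ ^ 2 = t → t ≤ (9 / 10) ^ 2 → ‖v - w‖ ≤ 9 / 10 := by
    intro w t ht h
    refine le_of_sq_le_sq (by rw [ht]; exact h) (by norm_num)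
  have e1 : ‖v - 1‖ ^ 2 = s ^ 2 - 2 * x + 1 := by
    rw [← Complex.normSq_eq_norm_sq, Complex.normSq_apply, hs]
    simp only [Complex.sub_re, Complex.sub_im, Complex.one_re, Complex.one_im]; ring
  have e2 : ‖v - (-1)‖ ^ 2 = s ^ 2 - 2 * (-x) + 1 := by
    rw [← Complex.normSq_eq_norm_sq, Complex.normSq_apply, hs]
    simp only [Complex.sub_re, Complex.sub_im, Complex.neg_re, Complex.neg_im, Complex.one_re, Complex.one_im]; ring
  have e3 : ‖v - Complex.I‖ ^ 2 = s ^ 2 - 2 * y + 1 := by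
    rw [← Complex.normSq_eq_norm_sq, Complex.normSq_apply, hs]
    simp only [Complex.sub_re, Complex.sub_im, Complex.I_re, Complex.I_im]; ring
  have e4 : ‖v - (-Complex.I)‖ ^ 2 = s ^ 2 - 2 * (-y) + 1 := by
    rw [← Complex.normSq_eq_norm_sq, Complex.normSq_apply, hs]
    simp only [Complex.sub_re, Complex.sub_im, Complex.neg_re, Complex.neg_im, Complex.I_re, Complex.I_im]; ring
  rcases le_total (y ^ 2) (x ^ 2) with hxy | hxy
  · left
    rcases le_total 0 x with h0 | h0
    · left; exact hn _ _ e1 (key x h0 (by linarith))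
    · right; exact hn _ _ e2 (key (-x) (by linarith) (by rw [neg_sq]; linarith))
  · right
    rcases le_total 0 y with h0 | h0
    · left; exact hn _ _ e3 (key y h0 (by linarith))
    · right; exact hn _ _ e4 (key (-y) (by linarith) (by rw [neg_sq]; linarith))

/-- Boundedness of `R / a₁` away from the points sent to the circle. -/
lemma R_div_bdd {n : ℕ} {p : ℕ} {ξ : Fin n → ℂ} {m : Fin n → ℕ} {Λ : Fin n → ℂ} {φ h : ℂ → ℂ}
    {r : Polynomial ℂ} (S : Stp p ξ m Λ φ h r) :
    ∃ C : ℝ, 0 ≤ C ∧ ∀ z : ℂ, ‖z‖ = 1 → (∀ j, z ≠ ξ j) → ‖r.eval z‖ ≤ 3 / 4 →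
      ‖(Rp p ξ m Λ r).eval z / a1fun ξ m z‖ ≤ C := by
  set Pd : Polynomial ℂ := ∏ j ∈ Finset.univ.filter (fun j : Fin n => p ≤ (j : ℕ)),
    (Polynomial.X - Polynomial.C (ξ j)) ^ (m j) with hPd
  set Pc : Polynomial ℂ := ∏ j ∈ Finset.univ.filter (fun j : Fin n => ¬ p ≤ (j : ℕ)),
    (Polynomial.X - Polynomial.C (ξ j)) ^ (m j) with hPc
  have hP : a1P ξ m = Pd * Pc := (Finset.prod_filter_mul_prod_filter_not _ _ _).symm
  have hdv : Pd ∣ Rp p ξ m Λ r := by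
    refine Finset.prod_dvd_of_coprime (fun i _ j _ hij => ?_) fun j hj =>
      Rp_dvd S (Finset.mem_filter.1 hj).2
    exact (Polynomial.isCoprime_X_sub_C_of_isUnit_sub
      ((sub_ne_zero.2 fun h => hij (S.hinj h)).isUnit)).pow
  obtain ⟨R1, hR1⟩ := hdv
  have hK : IsCompact (Metric.sphere (0:ℂ) 1 ∩ {z | ‖r.eval z‖ ≤ 3 / 4}) :=
    (isCompact_sphere _ _).inter_right (isClosed_le r.continuous.norm continuous_const)
  have hPc0 : ∀ z ∈ Metric.sphere (0:ℂ) 1 ∩ {z | ‖r.eval z‖ ≤ 3 / 4}, Pc.eval z ≠ 0 := by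
    intro z hz
    rw [hPc, Polynomial.eval_prod]
    refine Finset.prod_ne_zero_iff.2 fun j hj => ?_
    rw [Polynomial.eval_pow, Polynomial.eval_sub, Polynomial.eval_X, Polynomial.eval_C]
    refine pow_ne_zero _ (sub_ne_zero.2 fun hzj => ?_)
    have h1 : ‖r.eval z‖ ≤ 3 / 4 := hz.2
    obtain ⟨i, hi⟩ := S.hcirc j (not_le.1 (Finset.mem_filter.1 hj).2)
    rw [hzj, S.hr j, hi, S.hξ i] at h1
    norm_num at h1
  obtain ⟨C, hC⟩ := hK.exists_bound_of_continuousOn (f := fun z => R1.eval z / Pc.eval z)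
    (R1.continuous.continuousOn.div Pc.continuous.continuousOn hPc0)
  refine ⟨max C 0, le_max_right _ _, fun z hz hne hr => le_trans (le_of_eq ?_)
    ((hC z ⟨by simpa using hz, hr⟩).trans (le_max_left _ _))⟩
  have h0 := a1_ne_zero (m := m) hne
  rw [← a1P_eval, hP, Polynomial.eval_mul] at h0
  rw [← a1P_eval, hP, hR1, Polynomial.eval_mul, Polynomial.eval_mul,
    mul_div_mul_left _ _ (left_ne_zero_of_mul h0)]

lemma u_finite {n : ℕ} {p : ℕ} {ξ : Fin n → ℂ} {m : Fin n → ℕ} {Λ : Fin n → ℂ} {φ h : ℂ → ℂ}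
    {r : Polynomial ℂ} (S : Stp p ξ m Λ φ h r) (hC : IsCarleson (ufun p ξ m Λ φ) φ) :
    ∫⁻ θ, ‖bdryVal (ufun p ξ m Λ φ) (eC θ)‖ₑ ^ 2 ∂circM < ⊤ := by
  obtain ⟨M, hM0, hM⟩ := hC
  set u := ufun p ξ m Λ φ with hu
  have hφm := aemeas_bdry S.hφd (phi_radial S)
  obtain ⟨k, hk⟩ := poly_comp_hb (memHinf_phi S.hφd S.hφ) S.hd (a1P ξ m * Gp p m Λ)
  change HbDecompOf ξ m _ k (Rp p ξ m Λ r) at hk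
  obtain ⟨B, hB0, hB⟩ := poly_bdd (a1P ξ m * Gp p m Λ)
  obtain ⟨C, hC0, hC⟩ := R_div_bdd S
  have hh := S.hd.1
  -- pointwise bound
  have hpt : ∀ᵐ θ ∂circM, θ ∈ {θ | ‖bdryVal φ (eC θ)‖ ≤ 1 / 2} → ‖bdryVal u (eC θ)‖ₑ ^ 2 ≤
      ENNReal.ofReal 2 * ‖bdryVal k (eC θ)‖ₑ ^ 2 + ENNReal.ofReal (16 * B ^ 2) * ‖bdryVal h (eC θ)‖ₑ ^ 2
        + ENNReal.ofReal (2 * C ^ 2) := by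
    filter_upwards [u_bdry S, h2_radial hk.1, h2_radial hh] with θ ⟨h1, h2, h3, h4⟩ h5 h6 h7
    have h7 : ‖bdryVal φ (eC θ)‖ ≤ 1 / 2 := h7
    rw [h4, enorm_sq_eq, enorm_sq_eq, enorm_sq_eq, ← ENNReal.ofReal_mul (by norm_num),
      ← ENNReal.ofReal_mul (by positivity), ← ENNReal.ofReal_add (by positivity) (by positivity),
      ← ENNReal.ofReal_add (by positivity) (by positivity)]
    refine ENNReal.ofReal_le_ofReal ?_
    have ha := a1_ne_zero (m := m) h2
    have e1 : bdryVal φ (eC θ) = a1fun ξ m (eC θ) * bdryVal h (eC θ) + r.eval (eC θ) := by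
      refine tendsto_nhds_unique_of_eventuallyEq h1 (((a1_rad ξ m (eC θ)).mul h6).add (poly_rad r (eC θ)))
        (slice_ev fun t h0 h1 => S.hd.2.2 _ (smul_eC_mem h0 h1 θ))
    have e2 : (a1P ξ m * Gp p m Λ).eval (bdryVal φ (eC θ)) =
        a1fun ξ m (eC θ) * bdryVal k (eC θ) + (Rp p ξ m Λ r).eval (eC θ) := by
      refine tendsto_nhds_unique_of_eventuallyEq
        (((a1P ξ m * Gp p m Λ).continuous.tendsto _).comp h1)
        (((a1_rad ξ m (eC θ)).mul h5).add (poly_rad (Rp p ξ m Λ r) (eC θ)))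
        (slice_ev fun t h0 h1 => hk.2.2 _ (smul_eC_mem h0 h1 θ))
    rcases le_or_gt ‖r.eval (eC θ)‖ (3 / 4) with hr | hr
    · have h8 := hC (eC θ) (norm_eC θ) h2 hr
      rw [e2, add_div, mul_div_cancel_left₀ _ ha]
      set x := bdryVal k (eC θ)
      set y := (Rp p ξ m Λ r).eval (eC θ) / a1fun ξ m (eC θ)
      have h10 := pow_le_pow_left₀ (norm_nonneg _) (norm_add_le x y) 2
      have h11 := pow_le_pow_left₀ (norm_nonneg _) h8 2
      have : 0 ≤ 16 * B ^ 2 * ‖bdryVal h (eC θ)‖ ^ 2 := by positivity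
      nlinarith [sq_nonneg (‖x‖ - ‖y‖)]
    · have h8 : 1 / 4 ≤ ‖a1fun ξ m (eC θ)‖ * ‖bdryVal h (eC θ)‖ := by
        have e3 : r.eval (eC θ) = bdryVal φ (eC θ) - a1fun ξ m (eC θ) * bdryVal h (eC θ) := by
          rw [e1]; ring
        have h9 := norm_sub_le (bdryVal φ (eC θ)) (a1fun ξ m (eC θ) * bdryVal h (eC θ))
        rw [← e3, norm_mul] at h9
        linarith
      have h9 := hB (bdryVal φ (eC θ)) (by linarith)
      have hap : 0 < ‖a1fun ξ m (eC θ)‖ := norm_pos_iff.2 ha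
      have h10 : ‖(a1P ξ m * Gp p m Λ).eval (bdryVal φ (eC θ)) / a1fun ξ m (eC θ)‖ ≤
          4 * B * ‖bdryVal h (eC θ)‖ := by
        rw [norm_div, div_le_iff₀ hap]
        nlinarith [norm_nonneg (bdryVal h (eC θ))]
      have h11 := pow_le_pow_left₀ (norm_nonneg _) h10 2
      have : 0 ≤ 2 * ‖bdryVal k (eC θ)‖ ^ 2 := by positivity
      have : 0 ≤ 2 * C ^ 2 := by positivity
      nlinarith
  have hkm := aemeas_bdry hk.1.1 (h2_radial hk.1)
  have hhm := aemeas_bdry hh.1 (h2_radial hh)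
  have hA : AEMeasurable (fun θ => ENNReal.ofReal 2 * ‖bdryVal k (eC θ)‖ₑ ^ 2 +
      ENNReal.ofReal (16 * B ^ 2) * ‖bdryVal h (eC θ)‖ₑ ^ 2 + ENNReal.ofReal (2 * C ^ 2)) circM :=
    (((hkm.enorm.pow_const 2).const_mul _).add ((hhm.enorm.pow_const 2).const_mul _)).add
      aemeasurable_const
  have hlow : uM u {θ | ‖bdryVal φ (eC θ)‖ ≤ 1 / 2} < ⊤ := by
    unfold uM
    rw [withDensity_apply']
    refine (setLIntegral_mono_ae hA.restrict hpt).trans_lt ?_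
    refine (setLIntegral_le_lintegral _ _).trans_lt ?_
    rw [lintegral_add_right' _ aemeasurable_const, lintegral_add_right' _
      ((hhm.enorm.pow_const 2).const_mul _), lintegral_const_mul' _ _ ENNReal.ofReal_ne_top,
      lintegral_const_mul' _ _ ENNReal.ofReal_ne_top, lintegral_const]
    refine ENNReal.add_lt_top.2 ⟨ENNReal.add_lt_top.2 ⟨?_, ?_⟩, ?_⟩
    · exact ENNReal.mul_lt_top ENNReal.ofReal_lt_top ((bdry_le hk.1).trans_lt
        (ENNReal.mul_lt_top ENNReal.ofReal_lt_top ENNReal.ofReal_lt_top))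
    · exact ENNReal.mul_lt_top ENNReal.ofReal_lt_top ((bdry_le hh).trans_lt
        (ENNReal.mul_lt_top ENNReal.ofReal_lt_top ENNReal.ofReal_lt_top))
    · exact ENNReal.mul_lt_top ENNReal.ofReal_lt_top (measure_lt_top _ _)
  have hwin : ∀ ζ : ℂ, ‖ζ‖ = 1 →
      uM u {θ | bdryVal φ (eC θ) ∈ Metric.closedBall ζ (9 / 10) ∩ Metric.closedBall 0 1} < ⊤ :=
    fun ζ hζ => (uM_window hφm hM0 hM hζ (by norm_num) (by norm_num)).trans_lt ENNReal.ofReal_lt_top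
  have htot : uM u univ < ⊤ := by
    set W : ℂ → Set ℝ := fun ζ =>
      {θ | bdryVal φ (eC θ) ∈ Metric.closedBall ζ (9 / 10) ∩ Metric.closedBall 0 1} with hW
    have hcov : univ ≤ᵐ[uM u] ({θ | ‖bdryVal φ (eC θ)‖ ≤ 1 / 2} ∪
        ((W 1 ∪ W (-1)) ∪ (W Complex.I ∪ W (-Complex.I))) : Set ℝ) := by
      filter_upwards [(uM_ac u).ae_le (phi_radial S)] with θ h1 _
      have h2 := bdry_norm_le S.hφ h1
      rcases le_total ‖bdryVal φ (eC θ)‖ (1 / 2) with h3 | h3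
      · exact Or.inl h3
      · right
        rcases four_windows h3 h2 with (h4 | h4) | (h4 | h4)
        · exact Or.inl (Or.inl ⟨by simpa [dist_eq_norm] using h4, by simpa using h2⟩)
        · exact Or.inl (Or.inr ⟨by simpa [dist_eq_norm] using h4, by simpa using h2⟩)
        · exact Or.inr (Or.inl ⟨by simpa [dist_eq_norm] using h4, by simpa using h2⟩)
        · exact Or.inr (Or.inr ⟨by simpa [dist_eq_norm] using h4, by simpa using h2⟩)
    refine (measure_mono_ae hcov).trans_lt ?_
    refine measure_union_lt_top hlow (measure_union_lt_top (measure_union_lt_top (hwin _ ?_) (hwin _ ?_))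
      (measure_union_lt_top (hwin _ ?_) (hwin _ ?_))) <;> simp
  unfold uM at htot
  rwa [withDensity_apply', setLIntegral_univ] at htot

/-! ### Part 8: membership of `u` in `H²` and the weighted composition operator -/

lemma norm_eC_sub_le (s t : ℝ) : ‖eC s - eC t‖ ≤ |s - t| := by
  have h : eC s - eC t = eC t * (Complex.exp (Complex.I * ((s - t : ℝ) : ℂ)) - 1) := by
    unfold eC
    rw [mul_sub, ← Complex.exp_add, mul_one]
    congr 2
    push_cast; ring
  rw [h, norm_mul, norm_eC, one_mul]
  exact (Real.norm_exp_I_mul_ofReal_sub_one_le).trans (le_of_eq (Real.norm_eq_abs _))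

lemma exists_eC {ζ : ℂ} (hζ : ‖ζ‖ = 1) : ∃ t : ℝ, 0 < t ∧ t ≤ 2 * Real.pi ∧ eC t = ζ := by
  have hpi := Real.pi_pos
  have e : eC (Complex.arg ζ) = ζ := by
    have := Complex.norm_mul_exp_arg_mul_I ζ
    rwa [hζ, Complex.ofReal_one, one_mul] at this
  have h1 := Complex.neg_pi_lt_arg ζ
  have h2 := Complex.arg_le_pi ζ
  rcases lt_or_ge 0 (Complex.arg ζ) with h | h
  · exact ⟨_, h, by linarith, e⟩
  · refine ⟨Complex.arg ζ + 2 * Real.pi, by linarith, by linarith, ?_⟩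
    refine Eq.trans ?_ e
    unfold eC
    push_cast
    rw [add_mul, Complex.exp_add, Complex.exp_two_pi_mul_I, mul_one, ← eC, e]

/-- A function with a pole on the circle is not square integrable. -/
lemma not_l2_pole {ζ : ℂ} (hζ : ‖ζ‖ = 1) {F : ℝ → ℂ} {c δ : ℝ} (hc : 0 < c) (hδ : 0 < δ)
    (hF : ∀ᵐ θ ∂circM, ‖eC θ - ζ‖ < δ → c ≤ ‖F θ‖ * ‖eC θ - ζ‖)
    (hfin : ∫⁻ θ, ‖F θ‖ₑ ^ 2 ∂circM < ⊤) : False := by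
  obtain ⟨t, ht0, ht1, rfl⟩ := exists_eC hζ
  set I := ∫⁻ θ, ‖F θ‖ₑ ^ 2 ∂circM with hI
  have hkey : ∀ ε : ℝ, 0 < ε → ε < δ → ε < t → ENNReal.ofReal (c ^ 2 / ε) ≤ I := by
    intro ε h0 h1 h2
    have hsub : Ioc (t - ε) t ⊆ Ioc 0 (2 * Real.pi) := fun x hx => ⟨by linarith [hx.1], hx.2.trans ht1⟩
    have hm : circM (Ioc (t - ε) t) = ENNReal.ofReal ε := by
      unfold circM
      rw [Measure.restrict_apply measurableSet_Ioc, inter_eq_left.2 hsub, Real.volume_Ioc]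
      congr 1; ring
    calc ENNReal.ofReal (c ^ 2 / ε) = ∫⁻ θ in Ioc (t - ε) t, ENNReal.ofReal ((c / ε) ^ 2) ∂circM := by
          rw [setLIntegral_const, hm, ← ENNReal.ofReal_mul (by positivity)]
          congr 1; field_simp
      _ ≤ ∫⁻ θ in Ioc (t - ε) t, ‖F θ‖ₑ ^ 2 ∂circM := by
          refine setLIntegral_mono_ae' measurableSet_Ioc ?_
          filter_upwards [hF] with θ h3 h4
          have h5 : ‖eC θ - eC t‖ ≤ ε := by
            refine (norm_eC_sub_le θ t).trans ?_
            rw [abs_le]; exact ⟨by linarith [h4.1], by linarith [h4.2]⟩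
          have h6 := h3 (by linarith)
          rw [enorm_sq_eq]
          refine ENNReal.ofReal_le_ofReal (pow_le_pow_left₀ (by positivity) ?_ 2)
          rw [div_le_iff₀ h0]
          exact h6.trans (by gcongr)
      _ ≤ I := setLIntegral_le_lintegral _ _
  set T := I.toReal with hT
  set ε := min (min (δ / 2) (t / 2)) (c ^ 2 / (T + 1)) with hε
  have hT0 : 0 ≤ T := ENNReal.toReal_nonneg
  have hε0 : 0 < ε := lt_min (lt_min (by linarith) (by linarith)) (by positivity)
  have h := hkey ε hε0 (by
    have : ε ≤ δ / 2 := (min_le_left _ _).trans (min_le_left _ _)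
    linarith) (by
    have : ε ≤ t / 2 := (min_le_left _ _).trans (min_le_right _ _)
    linarith)
  have h2 : c ^ 2 / ε ≤ T := (ENNReal.ofReal_le_iff_le_toReal hfin.ne).1 h
  have h3 : ε ≤ c ^ 2 / (T + 1) := min_le_right _ _
  rw [le_div_iff₀ (by positivity)] at h3
  rw [div_le_iff₀ hε0] at h2
  nlinarith

lemma enorm_sub_sq_le (x y : ℂ) : ‖x - y‖ₑ ^ 2 ≤ ENNReal.ofReal 2 * ‖x‖ₑ ^ 2 + ENNReal.ofReal 2 * ‖y‖ₑ ^ 2 := by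
  rw [enorm_sq_eq, enorm_sq_eq, enorm_sq_eq, ← ENNReal.ofReal_mul (by norm_num),
    ← ENNReal.ofReal_mul (by norm_num), ← ENNReal.ofReal_add (by positivity) (by positivity)]
  refine ENNReal.ofReal_le_ofReal ?_
  have h10 := pow_le_pow_left₀ (norm_nonneg _) (norm_sub_le x y) 2
  nlinarith [sq_nonneg (‖x‖ - ‖y‖)]

lemma Rp_zero_of_carleson {n : ℕ} {p : ℕ} {ξ : Fin n → ℂ} {m : Fin n → ℕ} {Λ : Fin n → ℂ}
    {φ h : ℂ → ℂ} {r : Polynomial ℂ} (S : Stp p ξ m Λ φ h r)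
    (hfin : ∫⁻ θ, ‖bdryVal (ufun p ξ m Λ φ) (eC θ)‖ₑ ^ 2 ∂circM < ⊤) : Rp p ξ m Λ r = 0 := by
  obtain ⟨k, hk⟩ := poly_comp_hb (memHinf_phi S.hφd S.hφ) S.hd (a1P ξ m * Gp p m Λ)
  change HbDecompOf ξ m _ k (Rp p ξ m Λ r) at hk
  set R := Rp p ξ m Λ r with hRdef
  set u := ufun p ξ m Λ φ with hu
  refine Polynomial.eq_zero_of_dvd_of_degree_lt (p := a1P ξ m) (a1P_dvd S.hinj fun j => ?_)
    (by rw [a1P_degree]; exact hk.2.1)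
  by_cases hR : R = 0
  · rw [hR]; exact dvd_zero _
  obtain ⟨R', hR', hnd⟩ := Polynomial.exists_eq_pow_rootMultiplicity_mul_and_not_dvd R hR (ξ j)
  set l := R.rootMultiplicity (ξ j)
  by_cases hl : m j ≤ l
  · exact (pow_dvd_pow _ hl).trans ⟨R', hR'⟩
  exfalso
  push Not at hl
  rw [Polynomial.dvd_iff_isRoot] at hnd
  have hnd : R'.eval (ξ j) ≠ 0 := hnd
  obtain ⟨A', hA'⟩ := fac_dvd_a1P ξ m j
  set P'' : Polynomial ℂ := (Polynomial.X - Polynomial.C (ξ j)) ^ (m j - l - 1) * A' with hP''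
  have ha1 : ∀ z, a1fun ξ m z = (z - ξ j) ^ l * ((z - ξ j) * P''.eval z) := by
    intro z
    rw [← a1P_eval, hA', hP'']
    simp only [Polynomial.eval_mul, Polynomial.eval_pow, Polynomial.eval_sub, Polynomial.eval_X,
      Polynomial.eval_C]
    have : m j = l + 1 + (m j - l - 1) := by omega
    nth_rewrite 1 [this]
    rw [pow_add, pow_add, pow_one]
    ring
  have hRz : ∀ z, R.eval z = (z - ξ j) ^ l * R'.eval z := by
    intro z
    rw [hR']
    simp only [Polynomial.eval_mul, Polynomial.eval_pow, Polynomial.eval_sub, Polynomial.eval_X,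
      Polynomial.eval_C]
  obtain ⟨B, hB0, hB⟩ := poly_bdd P''
  have hρ : 0 < ‖R'.eval (ξ j)‖ := norm_pos_iff.2 hnd
  set ρ := ‖R'.eval (ξ j)‖
  obtain ⟨δ, hδ, hcont⟩ := Metric.continuous_iff.1 R'.continuous.norm (ξ j) (ρ / 2) (by positivity)
  have hum := aemeas_bdry (u_diff S) ((u_bdry S).mono fun θ hθ => hθ.2.2.1)
  have hkm := aemeas_bdry hk.1.1 (h2_radial hk.1)
  refine not_l2_pole (S.hξ j) (F := fun θ => bdryVal u (eC θ) - bdryVal k (eC θ))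
    (c := ρ / 2 / (B + 1)) (δ := δ) (by positivity) hδ ?_ ?_
  · filter_upwards [u_bdry S, h2_radial hk.1] with θ ⟨h1, h2, h3, h4⟩ h5 hlt
    have ha := a1_ne_zero (m := m) h2
    have e2 : (a1P ξ m * Gp p m Λ).eval (bdryVal φ (eC θ)) =
        a1fun ξ m (eC θ) * bdryVal k (eC θ) + R.eval (eC θ) := by
      refine tendsto_nhds_unique_of_eventuallyEq
        (((a1P ξ m * Gp p m Λ).continuous.tendsto _).comp h1)
        (((a1_rad ξ m (eC θ)).mul h5).add (poly_rad R (eC θ)))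
        (slice_ev fun t h0 h1 => hk.2.2 _ (smul_eC_mem h0 h1 θ))
    have e3 : bdryVal u (eC θ) - bdryVal k (eC θ) = R.eval (eC θ) / a1fun ξ m (eC θ) := by
      rw [h4, e2, add_div, mul_div_cancel_left₀ _ ha]; ring
    have hz : eC θ - ξ j ≠ 0 := sub_ne_zero.2 (h2 j)
    rw [ha1] at ha
    have hP0 : P''.eval (eC θ) ≠ 0 := right_ne_zero_of_mul (right_ne_zero_of_mul ha)
    rw [e3, hRz, ha1, mul_div_mul_left _ _ (left_ne_zero_of_mul ha), ← norm_mul]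
    have e4 : R'.eval (eC θ) / ((eC θ - ξ j) * P''.eval (eC θ)) * (eC θ - ξ j) =
        R'.eval (eC θ) / P''.eval (eC θ) := by field_simp
    rw [e4, norm_div]
    have h6 := hcont (eC θ) (by rw [dist_eq_norm]; exact hlt)
    rw [Real.dist_eq, abs_lt] at h6
    have h7 := hB (eC θ) (norm_eC θ).le
    have h8 : 0 < ‖P''.eval (eC θ)‖ := norm_pos_iff.2 hP0
    have h9 : ρ / 2 ≤ ‖R'.eval (eC θ)‖ := by linarith [h6.1]
    gcongr
    linarith
  · refine (lintegral_mono fun θ => enorm_sub_sq_le _ _).trans_lt ?_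
    rw [lintegral_add_right' _ ((hkm.enorm.pow_const 2).const_mul _),
      lintegral_const_mul' _ _ ENNReal.ofReal_ne_top, lintegral_const_mul' _ _ ENNReal.ofReal_ne_top]
    refine ENNReal.add_lt_top.2 ⟨ENNReal.mul_lt_top ENNReal.ofReal_lt_top hfin,
      ENNReal.mul_lt_top ENNReal.ofReal_lt_top ((bdry_le hk.1).trans_lt
        (ENNReal.mul_lt_top ENNReal.ofReal_lt_top ENNReal.ofReal_lt_top))⟩

lemma bdryVal_poly (g : Polynomial ℂ) (ζ : ℂ) : bdryVal (fun z => g.eval z) ζ = g.eval ζ :=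
  bdryVal_eq (poly_rad g ζ)

/-- The weighted embedding for polynomials. -/
lemma embed_poly {n : ℕ} {p : ℕ} {ξ : Fin n → ℂ} {m : Fin n → ℕ} {Λ : Fin n → ℂ}
    {φ h : ℂ → ℂ} {r : Polynomial ℂ} (S : Stp p ξ m Λ φ h r)
    (hC : IsCarleson (ufun p ξ m Λ φ) φ) :
    ∃ C : ℝ, 0 ≤ C ∧ ∀ g : Polynomial ℂ,
      ∫⁻ θ, ‖bdryVal (ufun p ξ m Λ φ) (eC θ)‖ₑ ^ 2 * ‖g.eval (bdryVal φ (eC θ))‖ₑ ^ 2 ∂circM ≤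
        ENNReal.ofReal (2 * Real.pi) * ENNReal.ofReal (C * h2NormSq (fun z => g.eval z)) := by
  have hfin := u_finite S hC
  obtain ⟨M, hM0, hM⟩ := hC
  set u := ufun p ξ m Λ φ with hu
  have hφm := aemeas_bdry S.hφd (phi_radial S)
  have hum := aemeas_bdry (u_diff S) ((u_bdry S).mono fun θ hθ => hθ.2.2.1)
  set T := (∫⁻ θ, ‖bdryVal u (eC θ)‖ₑ ^ 2 ∂circM).toReal with hT
  have hT0 : 0 ≤ T := ENNReal.toReal_nonneg
  have htot : uM u univ = ENNReal.ofReal T := by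
    rw [hT, ENNReal.ofReal_toReal hfin.ne]
    unfold uM
    rw [withDensity_apply', setLIntegral_univ]
  set v : ℝ → ℂ := fun θ => if ‖bdryVal φ (eC θ)‖ ≤ 1 then bdryVal φ (eC θ) else 0 with hv
  have hv1 : ∀ θ, ‖v θ‖ ≤ 1 := by
    intro θ; simp only [hv]; split_ifs with h
    · exact h
    · simp
  have hvφ : v =ᵐ[circM] fun θ => bdryVal φ (eC θ) := by
    filter_upwards [phi_radial S] with θ h1
    simp only [hv]; rw [if_pos (bdry_norm_le S.hφ h1)]
  have hvm : AEMeasurable v circM := hφm.congr hvφ.symm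
  set M' := 4 * Real.pi * M + 2 * T with hM'
  have hM'0 : 0 ≤ M' := by positivity
  refine ⟨2560 * M', by positivity, fun g => ?_⟩
  have hemb := carleson_embedding (uM u) (fun (i : ℕ) θ => (rseq i : ℂ) * v θ) (M := M')
    (f := fun z => g.eval z) (F := fun θ => ‖g.eval (v θ)‖) ?_ hM'0 ?_ ?_ (fun _ => norm_nonneg _) ?_ ?_
  · have e1 : ∫⁻ θ, ‖bdryVal u (eC θ)‖ₑ ^ 2 * ‖g.eval (bdryVal φ (eC θ))‖ₑ ^ 2 ∂circM =
        ∫⁻ θ, ENNReal.ofReal (‖g.eval (v θ)‖ ^ 2) ∂(uM u) := by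
      unfold uM
      have hum2 : AEMeasurable (fun θ => ‖bdryVal u (eC θ)‖ₑ ^ 2) circM := hum.enorm.pow_const 2
      have hgm : AEMeasurable (fun θ => ENNReal.ofReal (‖g.eval (v θ)‖ ^ 2)) circM :=
        ((g.continuous.measurable.comp_aemeasurable hvm).norm.pow_const 2).ennreal_ofReal
      rw [lintegral_withDensity_eq_lintegral_mul₀ hum2 hgm]
      refine lintegral_congr_ae ?_
      filter_upwards [hvφ] with θ h1
      rw [Pi.mul_apply, h1, enorm_sq_eq (g.eval _)]
    rw [e1]
    refine hemb.trans ?_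
    have h2 := bdry_le (memH2_poly g)
    simp only [bdryVal_poly] at h2
    refine (mul_le_mul_right h2 _).trans (le_of_eq ?_)
    rw [mul_left_comm, ← ENNReal.ofReal_mul (by positivity)]
  · intro i θ
    rw [norm_mul, Complex.norm_real, Real.norm_of_nonneg (rseq_nonneg i)]
    nlinarith [rseq_lt i, rseq_nonneg i, hv1 θ, norm_nonneg (v θ)]
  · intro ζ hζ η hη
    rcases lt_or_ge η (1 / 2) with hh | hh
    · have hsub : {θ | ∃ i : ℕ, ‖(rseq i : ℂ) * v θ - ζ‖ ≤ η} ≤ᵐ[uM u]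
          {θ | bdryVal φ (eC θ) ∈ Metric.closedBall ζ (2 * η) ∩ Metric.closedBall 0 1} := by
        filter_upwards [(uM_ac u).ae_le hvφ] with θ h1 h2
        obtain ⟨i, hi⟩ := h2
        show bdryVal φ (eC θ) ∈ _
        rw [← h1]
        have h3 := hv1 θ
        have h4 := rseq_nonneg i
        have h5 := rseq_lt i
        refine ⟨?_, by simpa using h3⟩
        rw [Metric.mem_closedBall, dist_eq_norm]
        have h6 : ‖ζ‖ - ‖(rseq i : ℂ) * v θ‖ ≤ η := by
          refine (norm_sub_norm_le _ _).trans ?_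
          rwa [norm_sub_rev]
        rw [norm_mul, Complex.norm_real, Real.norm_of_nonneg h4, hζ] at h6
        have h7 : 1 - rseq i ≤ η := by nlinarith
        have e : v θ - ζ = ((rseq i : ℂ) * v θ - ζ) + ((1 - rseq i : ℝ) : ℂ) * v θ := by
          push_cast; ring
        rw [e]
        refine (norm_add_le _ _).trans ?_
        rw [norm_mul ((1 - rseq i : ℝ) : ℂ), Complex.norm_real, Real.norm_of_nonneg (by linarith)]
        nlinarith [norm_nonneg (v θ)]
      refine (measure_mono_ae hsub).trans ((uM_window hφm hM0 hM hζ (by linarith) (by linarith)).trans ?_)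
      refine ENNReal.ofReal_le_ofReal ?_
      rw [hM']
      nlinarith [Real.pi_pos]
    · refine (measure_mono (subset_univ _)).trans ?_
      rw [htot]
      refine ENNReal.ofReal_le_ofReal ?_
      rw [hM']
      have : 0 ≤ 4 * Real.pi * M * η := by positivity
      nlinarith
  · exact g.differentiable.diffContOnCl
  · exact ((g.continuous.measurable.comp_aemeasurable hvm).norm).mono_ac (uM_ac u)
  · intro θ t ht0 ht
    have hlim : Tendsto (fun i : ℕ => ‖g.eval ((rseq i : ℂ) * v θ)‖) atTop (nhds ‖g.eval (v θ)‖) :=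
      ((poly_rad g (v θ)).comp rseq_tendsto).norm
    exact (hlim.eventually (lt_mem_nhds ht)).exists

/-- Boundedness of the weighted composition operator. -/
theorem wcomp_bdd {n : ℕ} {p : ℕ} {ξ : Fin n → ℂ} {m : Fin n → ℕ} {Λ : Fin n → ℂ}
    {φ h : ℂ → ℂ} {r : Polynomial ℂ} (S : Stp p ξ m Λ φ h r)
    (hC : IsCarleson (ufun p ξ m Λ φ) φ) :
    ∃ C : ℝ, 0 ≤ C ∧ ∀ g : ℂ → ℂ, MemH2 g → MemH2 (fun z => g (φ z) * ufun p ξ m Λ φ z) ∧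
      h2NormSq (fun z => g (φ z) * ufun p ξ m Λ φ z) ≤ C * h2NormSq g := by
  have hu := u_of_Rp S (Rp_zero_of_carleson S (u_finite S hC))
  obtain ⟨C, hC0, hC⟩ := embed_poly S hC
  set u := ufun p ξ m Λ φ with hudef
  have hpoly : ∀ g : Polynomial ℂ, MemH2 (fun z => g.eval (φ z) * u z) ∧
      h2NormSq (fun z => g.eval (φ z) * u z) ≤ C * h2NormSq (fun z => g.eval z) := by
    intro g
    obtain ⟨B, _, hB⟩ := poly_bdd g
    have hgd := comp_diff S.hφd S.hφ (g := fun z => g.eval z) g.differentiable.differentiableOn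
    have hmem : MemH2 (fun z => g.eval (φ z) * u z) :=
      (memH2_mul_bdd hu hgd fun z hz => hB _ (S.hφ z hz).le).1
    refine ⟨hmem, bdry_ge hmem (mul_nonneg hC0 (h2NormSq_nonneg _)) (le_trans (le_of_eq ?_) (hC g))⟩
    refine lintegral_congr_ae ?_
    filter_upwards [u_bdry S] with θ ⟨h1, h2, h3, h4⟩
    have : Tendsto (fun t : ℝ => g.eval (φ ((t : ℂ) * eC θ)) * u ((t : ℂ) * eC θ))
        (nhdsWithin 1 (Iio 1)) (nhds (g.eval (bdryVal φ (eC θ)) * bdryVal u (eC θ))) :=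
      ((g.continuous.tendsto _).comp h1).mul h3
    rw [bdryVal_eq (f := fun z => g.eval (φ z) * u z) this, enorm_mul, mul_pow, mul_comm]
  refine ⟨C, hC0, fun g hg => ?_⟩
  have hgd : DifferentiableOn ℂ (fun z => g (φ z) * u z) unitDisk := (comp_diff S.hφd S.hφ hg.1).mul hu.1
  refine memH2_of_slice hgd (mul_nonneg hC0 (h2NormSq_nonneg _))
    (Eventually.frequently (slice_ev fun t h0 h1 => ?_))
  have hlim : ∀ θ : ℝ, Tendsto (fun N => ‖(tayP g N).eval (φ ((t : ℂ) * eC θ)) * u ((t : ℂ) * eC θ)‖ₑ ^ 2)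
      atTop (nhds (‖g (φ ((t : ℂ) * eC θ)) * u ((t : ℂ) * eC θ)‖ₑ ^ 2)) := by
    intro θ
    have h2 := (tayP_tendsto hg.1 (mem_disk_iff.2 (S.hφ _ (smul_eC_mem h0 h1 θ)))).mul_const
      (u ((t : ℂ) * eC θ))
    exact ((ENNReal.continuous_pow 2).tendsto _).comp ((continuous_enorm.tendsto _).comp h2)
  calc ∫⁻ θ, ‖g (φ ((t : ℂ) * eC θ)) * u ((t : ℂ) * eC θ)‖ₑ ^ 2 ∂circM
      = ∫⁻ θ, liminf (fun N => ‖(tayP g N).eval (φ ((t : ℂ) * eC θ)) * u ((t : ℂ) * eC θ)‖ₑ ^ 2) atTop ∂circM :=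
        lintegral_congr fun θ => (hlim θ).liminf_eq.symm
    _ ≤ liminf (fun N => ∫⁻ θ, ‖(tayP g N).eval (φ ((t : ℂ) * eC θ)) * u ((t : ℂ) * eC θ)‖ₑ ^ 2 ∂circM) atTop := by
        refine lintegral_liminf_le fun N => ?_
        exact ((cont_slice (hpoly (tayP g N)).1.1 h0 h1).measurable.enorm.pow_const 2)
    _ ≤ liminf (fun _ : ℕ => ENNReal.ofReal (2 * Real.pi) * ENNReal.ofReal (C * h2NormSq g)) atTop := by
        refine liminf_le_liminf (Eventually.of_forall fun N => ?_)
        refine (h2_slice_le (hpoly (tayP g N)).1 h0 h1).trans (mul_le_mul_right ?_ _)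
        refine ENNReal.ofReal_le_ofReal ((hpoly (tayP g N)).2.trans ?_)
        exact mul_le_mul_of_nonneg_left (tayP_norm hg N) hC0
    _ = _ := by rw [liminf_const]

/-! ### Part 9: the Carleson condition implies boundedness -/

/-- `f` has a decomposition with squared norm at most `t`. -/
def HbBd {n : ℕ} (ξ : Fin n → ℂ) (m : Fin n → ℕ) (f : ℂ → ℂ) (t : ℝ) : Prop :=
  ∃ (g : ℂ → ℂ) (q : Polynomial ℂ), HbDecompOf ξ m f g q ∧
    h2NormSq g + h2NormSq (fun z => q.eval z) ≤ t

lemma HbBd.mono {n : ℕ} {ξ : Fin n → ℂ} {m : Fin n → ℕ} {f f' : ℂ → ℂ} {t s : ℝ}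
    (hf : HbBd ξ m f t) (hff : ∀ z ∈ unitDisk, f' z = f z) (h : t ≤ s) : HbBd ξ m f' s := by
  obtain ⟨g, q, ⟨h1, h2, h3⟩, h4⟩ := hf
  exact ⟨g, q, ⟨h1, h2, fun z hz => (hff z hz).trans (h3 z hz)⟩, h4.trans h⟩

lemma HbBd.add {n : ℕ} {ξ : Fin n → ℂ} {m : Fin n → ℕ} {f f' : ℂ → ℂ} {t s : ℝ}
    (hf : HbBd ξ m f t) (hf' : HbBd ξ m f' s) :
    HbBd ξ m (fun z => f z + f' z) (2 * (t + s)) := by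
  obtain ⟨g, q, ⟨h1, h2, h3⟩, h4⟩ := hf
  obtain ⟨g', q', ⟨h1', h2', h3'⟩, h4'⟩ := hf'
  have a1 := memH2_add h1 h1'
  have a2 := memH2_add (memH2_poly q) (memH2_poly q')
  refine ⟨fun z => g z + g' z, q + q',
    ⟨a1.1, lt_of_le_of_lt (Polynomial.degree_add_le _ _) (max_lt h2 h2'), fun z hz => ?_⟩, ?_⟩
  · simp only
    rw [h3 z hz, h3' z hz, Polynomial.eval_add]; ring
  · have e : (fun z => (q + q').eval z) = fun z => q.eval z + q'.eval z := by
      funext z; rw [Polynomial.eval_add]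
    rw [e]
    linarith [a1.2, a2.2]

lemma HbBd.smul {n : ℕ} {ξ : Fin n → ℂ} {m : Fin n → ℕ} {f : ℂ → ℂ} {t : ℝ}
    (hf : HbBd ξ m f t) (c : ℂ) : HbBd ξ m (fun z => c * f z) (‖c‖ ^ 2 * t) := by
  obtain ⟨g, q, ⟨h1, h2, h3⟩, h4⟩ := hf
  have a1 := memH2_const_mul h1 c
  have a2 := memH2_const_mul (memH2_poly q) c
  refine ⟨fun z => c * g z, Polynomial.C c * q, ⟨a1.1, ?_, fun z hz => ?_⟩, ?_⟩
  · refine lt_of_le_of_lt ?_ h2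
    rw [← Polynomial.smul_eq_C_mul]
    exact Polynomial.degree_smul_le _ _
  · simp only
    rw [h3 z hz, Polynomial.eval_mul, Polynomial.eval_C]; ring
  · have e : (fun z => (Polynomial.C c * q).eval z) = fun z => c * q.eval z := by
      funext z; rw [Polynomial.eval_mul, Polynomial.eval_C]
    rw [e]
    have := mul_le_mul_of_nonneg_left h4 (sq_nonneg ‖c‖)
    linarith [a1.2, a2.2]

lemma poly_HbBd {n : ℕ} {ξ : Fin n → ℂ} {m : Fin n → ℕ} {φ h : ℂ → ℂ} {r : Polynomial ℂ}
    (hφ : MemHinf φ) (hd : HbDecompOf ξ m φ h r) (P : Polynomial ℂ) :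
    ∃ t : ℝ, 0 ≤ t ∧ HbBd ξ m (fun z => P.eval (φ z)) t := by
  obtain ⟨k, hk⟩ := poly_comp_hb hφ hd P
  exact ⟨_, add_nonneg (h2NormSq_nonneg _) (h2NormSq_nonneg _), _, _, hk, le_rfl⟩

/-- Division by a linear factor with a zero in the disk. -/
lemma h2_divide {L : ℂ} (hL : ‖L‖ < 1) : ∃ C : ℝ, 0 ≤ C ∧ ∀ g : ℂ → ℂ, MemH2 g →
    ∃ g' : ℂ → ℂ, MemH2 g' ∧ h2NormSq g' ≤ C * h2NormSq g ∧
      ‖g L‖ ^ 2 ≤ C * h2NormSq g ∧ ∀ z, g z = (z - L) * g' z + g L := by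
  set d := (1 - ‖L‖) / 2 with hd
  have hd0 : 0 < d := by rw [hd]; linarith
  have hL2 : 0 < 1 - ‖L‖ ^ 2 := by nlinarith [norm_nonneg L]
  set A := (1 - ‖L‖ ^ 2)⁻¹ with hA
  have hA0 : 0 < A := inv_pos.2 hL2
  refine ⟨(d ^ 2)⁻¹ * (2 * (1 + A)) + A, by positivity, fun g hg => ?_⟩
  have hLd : L ∈ unitDisk := mem_disk_iff.2 hL
  have hn := h2NormSq_nonneg g
  have hgL : ‖g L‖ ^ 2 ≤ A * h2NormSq g := by
    have := h2_pointwise hg hLd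
    rw [hA, inv_mul_eq_div, le_div_iff₀ hL2]; exact this
  have heq : ∀ z, g z = (z - L) * dslope g L z + g L := by
    intro z
    have := sub_smul_dslope g L z
    rw [smul_eq_mul] at this
    rw [this]; ring
  have hone := memH2_const_mul memH2_one.1 (-g L)
  have hsub := memH2_add hg hone.1
  have hK : h2NormSq (fun z => g z + -g L * 1) ≤ 2 * (1 + A) * h2NormSq g := by
    have h1 := hone.2
    rw [norm_neg] at h1
    have h2 := mul_le_mul_of_nonneg_left memH2_one.2 (sq_nonneg ‖g L‖)
    linarith [hsub.2]
  have hdiff : DifferentiableOn ℂ (dslope g L) unitDisk :=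
    (Complex.differentiableOn_dslope (isOpen_unitDisk.mem_nhds hLd)).2 hg.1
  have hmain := memH2_of_slice (C := (d ^ 2)⁻¹ * (2 * (1 + A) * h2NormSq g)) hdiff (by positivity)
    (Eventually.frequently ?_)
  · refine ⟨dslope g L, hmain.1, hmain.2.trans ?_, hgL.trans ?_, heq⟩
    · nlinarith [mul_nonneg hA0.le hn]
    · have : 0 ≤ (d ^ 2)⁻¹ * (2 * (1 + A)) * h2NormSq g := by positivity
      linarith
  · have h1 : ∀ᶠ t : ℝ in nhdsWithin 1 (Iio 1), 0 ≤ t ∧ t < 1 := slice_ev fun t h0 h1 => ⟨h0, h1⟩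
    have h2 : ∀ᶠ t : ℝ in nhdsWithin 1 (Iio 1), ‖L‖ + d < t :=
      nhdsWithin_le_nhds (lt_mem_nhds (by rw [hd]; linarith))
    filter_upwards [h1, h2] with t ⟨ht0, ht1⟩ ht2
    have hpt : ∀ θ : ℝ, ‖dslope g L ((t : ℂ) * eC θ)‖ₑ ^ 2 ≤
        ENNReal.ofReal ((d ^ 2)⁻¹) * ‖g ((t : ℂ) * eC θ) + -g L * 1‖ₑ ^ 2 := by
      intro θ
      set z := (t : ℂ) * eC θ with hz
      have hzn : ‖z‖ = t := by
        rw [hz, norm_mul, norm_eC, mul_one, Complex.norm_real, Real.norm_eq_abs, abs_of_nonneg ht0]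
      have h3 : d ≤ ‖z - L‖ := by
        have := norm_sub_norm_le z L
        rw [hzn] at this; linarith
      rw [enorm_sq_eq, enorm_sq_eq, ← ENNReal.ofReal_mul (by positivity)]
      refine ENNReal.ofReal_le_ofReal ?_
      have h4 : g z + -g L * 1 = (z - L) * dslope g L z := by
        have := heq z
        linear_combination this
      rw [h4, norm_mul, mul_pow, inv_mul_eq_div, le_div_iff₀ (by positivity), mul_comm]
      gcongr
    calc ∫⁻ θ, ‖dslope g L ((t : ℂ) * eC θ)‖ₑ ^ 2 ∂circM
        ≤ ∫⁻ θ, ENNReal.ofReal ((d ^ 2)⁻¹) * ‖g ((t : ℂ) * eC θ) + -g L * 1‖ₑ ^ 2 ∂circM :=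
          lintegral_mono hpt
      _ = ENNReal.ofReal ((d ^ 2)⁻¹) * ∫⁻ θ, ‖g ((t : ℂ) * eC θ) + -g L * 1‖ₑ ^ 2 ∂circM :=
          lintegral_const_mul' _ _ ENNReal.ofReal_ne_top
      _ ≤ ENNReal.ofReal ((d ^ 2)⁻¹) * (ENNReal.ofReal (2 * Real.pi) *
            ENNReal.ofReal (2 * (1 + A) * h2NormSq g)) := by
          gcongr
          exact (h2_slice_le hsub.1 ht0 ht1).trans (by gcongr)
      _ = _ := by
          rw [mul_left_comm, ← ENNReal.ofReal_mul (by positivity)]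

/-- The map `g ↦ (a₁ G g) ∘ φ` is bounded into `H(b)`. -/
def SB {n : ℕ} (ξ : Fin n → ℂ) (m : Fin n → ℕ) (φ : ℂ → ℂ) (G : Polynomial ℂ) : Prop :=
  ∃ C : ℝ, 0 ≤ C ∧ ∀ g : ℂ → ℂ, MemH2 g →
    HbBd ξ m (fun z => a1fun ξ m (φ z) * G.eval (φ z) * g (φ z)) (C * h2NormSq g)

lemma SB_step {n : ℕ} {ξ : Fin n → ℂ} {m : Fin n → ℕ} {φ h : ℂ → ℂ} {r : Polynomial ℂ}
    (hφ : MemHinf φ) (hd : HbDecompOf ξ m φ h r) {G : Polynomial ℂ} {L : ℂ} (hL : ‖L‖ < 1)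
    (hS : SB ξ m φ (G * (Polynomial.X - Polynomial.C L))) : SB ξ m φ G := by
  obtain ⟨C, hC0, hC⟩ := hS
  obtain ⟨D, hD0, hD⟩ := h2_divide hL
  obtain ⟨t, ht0, ht⟩ := poly_HbBd hφ hd (a1P ξ m * G)
  refine ⟨2 * (C * D + D * t), by positivity, fun g hg => ?_⟩
  obtain ⟨g', hg', hn, hgL, e⟩ := hD g hg
  refine ((hC g' hg').add (ht.smul (g L))).mono (fun z _ => ?_) ?_
  · simp only [Polynomial.eval_mul, Polynomial.eval_sub, Polynomial.eval_X, Polynomial.eval_C,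
      a1P_eval]
    linear_combination (a1fun ξ m (φ z) * G.eval (φ z)) * e (φ z)
  · have h1 := mul_le_mul_of_nonneg_left hn hC0
    have h2 := mul_le_mul_of_nonneg_right hgL ht0
    nlinarith

lemma SB_pow {n : ℕ} {ξ : Fin n → ℂ} {m : Fin n → ℕ} {φ h : ℂ → ℂ} {r : Polynomial ℂ}
    (hφ : MemHinf φ) (hd : HbDecompOf ξ m φ h r) {L : ℂ} (hL : ‖L‖ < 1) (k : ℕ) :
    ∀ G : Polynomial ℂ, SB ξ m φ (G * (Polynomial.X - Polynomial.C L) ^ k) → SB ξ m φ G := by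
  induction k with
  | zero => intro G hG; simpa using hG
  | succ k ih =>
    intro G hG
    refine ih G (SB_step hφ hd hL ?_)
    rwa [mul_assoc, ← pow_succ]

lemma SB_prod {n : ℕ} {ξ : Fin n → ℂ} {m : Fin n → ℕ} {φ h : ℂ → ℂ} {r : Polynomial ℂ}
    (hφ : MemHinf φ) (hd : HbDecompOf ξ m φ h r) {Λ : Fin n → ℂ} (s : Finset (Fin n)) :
    (∀ j ∈ s, ‖Λ j‖ < 1) → ∀ G : Polynomial ℂ,
      SB ξ m φ (G * ∏ j ∈ s, (Polynomial.X - Polynomial.C (Λ j)) ^ (m j)) → SB ξ m φ G := by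
  induction s using Finset.induction_on with
  | empty => intro _ G hG; simpa using hG
  | insert a s ha ih =>
    intro hs G hG
    rw [Finset.prod_insert ha, ← mul_assoc] at hG
    exact SB_pow hφ hd (hs a (Finset.mem_insert_self _ _)) _ G
      (ih (fun j hj => hs j (Finset.mem_insert_of_mem hj)) _ hG)

lemma polyPart_bdd {n : ℕ} {ξ : Fin n → ℂ} {m : Fin n → ℕ} {φ h : ℂ → ℂ} {r : Polynomial ℂ}
    (hφ : MemHinf φ) (hd : HbDecompOf ξ m φ h r) (K : ℕ) :
    ∃ C : ℝ, 0 ≤ C ∧ ∀ q : Polynomial ℂ,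
      HbBd ξ m (fun z => ∑ k ∈ Finset.range K, q.coeff k * φ z ^ k)
        (C * h2NormSq (fun z => q.eval z)) := by
  induction K with
  | zero =>
    obtain ⟨t, _, ht⟩ := poly_HbBd hφ hd 0
    refine ⟨0, le_rfl, fun q => (ht.smul 0).mono (fun z _ => by simp) (by simp)⟩
  | succ K ih =>
    obtain ⟨C, hC0, hC⟩ := ih
    obtain ⟨t, ht0, ht⟩ := poly_HbBd hφ hd (Polynomial.X ^ K)
    refine ⟨2 * (C + t), by positivity, fun q => ?_⟩
    refine ((hC q).add (ht.smul (q.coeff K))).mono (fun z _ => ?_) ?_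
    · rw [Finset.sum_range_succ, Polynomial.eval_pow, Polynomial.eval_X]
    · have h1 := mul_le_mul_of_nonneg_right (coeff_sq_le q K) ht0
      linarith

theorem carleson_imp_bdd {n : ℕ} {p : ℕ} {ξ : Fin n → ℂ} {m : Fin n → ℕ} {Λ : Fin n → ℂ}
    {φ h : ℂ → ℂ} {r : Polynomial ℂ} (S : Stp p ξ m Λ φ h r)
    (hC : IsCarleson (ufun p ξ m Λ φ) φ) : CompBddHb ξ m φ := by
  have hφ := memHinf_phi S.hφd S.hφ
  have hSG : SB ξ m φ (1 * Gp p m Λ) := by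
    obtain ⟨C, hC0, hW⟩ := wcomp_bdd S hC
    refine ⟨C, hC0, fun g hg => ?_⟩
    obtain ⟨h1, h2⟩ := hW g hg
    have h3 := a1_mul_hb (ξ := ξ) (m := m) h1
    refine HbBd.mono (f := fun z => a1fun ξ m z * (g (φ z) * ufun p ξ m Λ φ z))
      ⟨_, _, h3, le_rfl⟩ (fun z hz => ?_) ?_
    · have h4 := a1_ne_zero_disk (m := m) S.hξ hz
      simp only [ufun_eq]
      rw [one_mul, Polynomial.eval_mul, a1P_eval]
      field_simp
    · rw [h2NormSq_zero_poly, add_zero]; exact h2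
  have hS1 : SB ξ m φ 1 :=
    SB_prod hφ S.hd _ (fun j hj => S.hdisk j (Finset.mem_filter.1 hj).2) 1 hSG
  obtain ⟨C, hC0, hSC⟩ := hS1
  obtain ⟨D, hD0, hD⟩ := polyPart_bdd hφ S.hd (∑ j, m j)
  have key : ∀ f g q, HbDecompOf ξ m f g q → HbBd ξ m (fun z => f (φ z))
      (2 * (C * h2NormSq g + D * h2NormSq (fun z => q.eval z))) := by
    intro f g q hf
    refine ((hSC g hf.1).add (hD q)).mono (fun z hz => ?_) le_rfl
    rw [hf.2.2 _ (mem_disk_iff.2 (S.hφ z hz)), Polynomial.eval_one, mul_one]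
    congr 1
    by_cases hq : q = 0
    · simp [hq]
    · exact Polynomial.eval_eq_sum_range' ((Polynomial.natDegree_lt_iff_degree_lt hq).2 hf.2.1) _
  refine ⟨?_, 2 * (C + D), ?_⟩
  · rintro f ⟨⟨g, q⟩, hf⟩
    obtain ⟨g', q', h1, _⟩ := key f g q hf
    exact ⟨(g', q'), h1⟩
  · rintro f ⟨⟨g, q⟩, hf⟩
    obtain ⟨g', q', h1, h2⟩ := key f g q hf
    rw [hbNormSq_eq S.hξ S.hinj h1, hbNormSq_eq S.hξ S.hinj hf]
    refine h2.trans ?_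
    have e1 := mul_nonneg hC0 (h2NormSq_nonneg fun z => q.eval z)
    have e2 := mul_nonneg hD0 (h2NormSq_nonneg g)
    simp only
    linarith

/-- Corollary 4.2. `C_φ` is bounded on `H(b)` iff `μ_{u,φ}` is a
Carleson measure, iff `sup_{w ∈ D} ∫_T (1−|w|²)|u|²/|1 − conj(w)φ|² dm < ∞`. -/
theorem comp_bounded_iff_carleson
    (b a : ℂ → ℂ) (n : ℕ) (ξ : Fin n → ℂ) (m : Fin n → ℕ)
    (hset : RationalSetting b a n ξ m)
    (φ : ℂ → ℂ) (hφb : MemHb ξ m φ) (hφball : MemBallHinf φ)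
    (hφmap : ∀ z ∈ unitDisk, φ z ∈ unitDisk)
    (Λ : Fin n → ℂ) (hΛ : ∀ j, NTLimit φ (ξ j) (Λ j))
    (p : ℕ) (hp : p ≤ n)
    (hΛcirc : ∀ j : Fin n, (j : ℕ) < p → ∃ i, Λ j = ξ i)
    (hΛdisk : ∀ j : Fin n, p ≤ (j : ℕ) → Λ j ∈ unitDisk) :
    (CompBddHb ξ m φ ↔ IsCarleson (ufun p ξ m Λ φ) φ) ∧
    (CompBddHb ξ m φ ↔
      ∃ C : ℝ, ∀ w ∈ unitDisk, repKerInt (ufun p ξ m Λ φ) φ w ≤ ENNReal.ofReal C) := by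
  obtain ⟨⟨h, r⟩, hd⟩ := hφb
  have hξ : ∀ j, ‖ξ j‖ = 1 := fun j => mem_circle_iff.1 (hset.zeros_mem j)
  have S : Stp p ξ m Λ φ h r :=
    { hξ := hξ
      hinj := hset.zeros_inj
      hm := hset.mult_pos
      hφd := hφball.1
      hφ := fun z hz => mem_disk_iff.1 (hφmap z hz)
      hd := hd
      hr := fun j => r_eval hξ hset.mult_pos hd (hΛ j)
      rad := fun j => radial_of_NT (hξ j) (hΛ j)
      hcirc := hΛcirc
      hdisk := fun j hj => mem_disk_iff.1 (hΛdisk j hj) }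
  exact ⟨⟨fun hB => kernel_imp_carleson (bdd_imp_kernel S hB), carleson_imp_bdd S⟩,
    ⟨fun hB => bdd_imp_kernel S hB, fun hK => carleson_imp_bdd S (kernel_imp_carleson hK)⟩⟩

end
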